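/- For every δ > 0 there exist n0 ∈ ℕ and σ > 0 such that the following holds: for any n ≥ n0, if H is an n-vertex linear hypergraph with maximum degree at most (1−δ)n such that the number of edges e of H with (1−δ)√n ≤ |e| ≤ (1+δ)√n is at most (1−3δ)n, then the chromatic index of H is at most (1−σ)n. -/

import Mathlib

open Finset
open scoped Classical

/-- A hypergraph on vertex set `Fin n` is *linear* if any two distinct edges intersect in at
most one vertex. -/
def LinearHG {n : ℕ} (H : Finset (Finset (Fin n))) : Prop :=
  ∀ e ∈ H, ∀ f ∈ H, e ≠ f → (e ∩ f).card ≤ 1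

/-- `φ` is a proper edge-colouring of the hypergraph `H`. -/
def IsProperEC {n : ℕ} (H : Finset (Finset (Fin n))) (φ : Finset (Fin n) → ℕ) : Prop :=
  ∀ e ∈ H, ∀ f ∈ H, e ≠ f → (e ∩ f).Nonempty → φ e ≠ φ f

/-- The chromatic index of the hypergraph `H` is at most `k`. -/
def ChromIndexLE {n : ℕ} (H : Finset (Finset (Fin n))) (k : ℕ) : Prop :=
  ∃ φ : Finset (Fin n) → ℕ, (∀ e ∈ H, φ e < k) ∧ IsProperEC H φ

/-- The degree of a vertex `v` in the hypergraph `H`. -/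
def degHG {n : ℕ} (H : Finset (Finset (Fin n))) (v : Fin n) : ℕ :=
  (H.filter fun e => v ∈ e).card

/-- Derandomised supermartingale argument: a potential cannot exceed its initial bound along a
suitably chosen trajectory, provided that whenever it equals the bound either it is decreasing in
time or some available step does not push it above the bound. -/
theorem exists_reachable_potential_le {S : Type*} (m : S → ℕ) (step : S → S → Prop)
    (hm : ∀ Z Z', step Z Z' → m Z' < m Z) (Φ Φ' : S → ℝ → ℝ) (T c : ℝ)
    (hderiv : ∀ Z t, HasDerivAt (Φ Z) (Φ' Z t) t)
    (hgen : ∀ Z t, 0 ≤ t → t < T → Φ Z t = c → Φ' Z t < 0 ∨ ∃ Z', step Z Z' ∧ Φ Z' t ≤ c)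
    (Z₀ : S) (hT : 0 ≤ T) (h₀ : Φ Z₀ 0 ≤ c) :
    ∃ Z, Relation.ReflTransGen step Z₀ Z ∧ Φ Z T ≤ c := by
  suffices H : ∀ (k : ℕ) (Z₀ : S), m Z₀ = k → ∀ t₀, 0 ≤ t₀ → t₀ ≤ T → Φ Z₀ t₀ ≤ c →
      ∃ Z, Relation.ReflTransGen step Z₀ Z ∧ Φ Z T ≤ c from H _ Z₀ rfl 0 le_rfl hT h₀
  intro k
  induction k using Nat.strong_induction_on with
  | _ k ih =>
    intro Z₀ hk t₀ ht₀ htT hΦ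
    by_cases hex : ∃ t Z', t₀ ≤ t ∧ t < T ∧ step Z₀ Z' ∧ Φ Z' t ≤ c
    · obtain ⟨t, Z', h1, h2, h3, h4⟩ := hex
      obtain ⟨Z, hZ, hZc⟩ := ih (m Z') (hk ▸ hm _ _ h3) Z' rfl t (ht₀.trans h1) h2.le h4
      exact ⟨Z, Relation.ReflTransGen.head h3 hZ, hZc⟩
    · push Not at hex
      refine ⟨Z₀, Relation.ReflTransGen.refl, ?_⟩
      have hcont : ContinuousOn (Φ Z₀) (Set.Icc t₀ T) := fun t _ =>
        (hderiv Z₀ t).continuousAt.continuousWithinAt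
      refine image_le_of_deriv_right_lt_deriv_boundary (f := Φ Z₀) (f' := Φ' Z₀)
        (B := fun _ => c) (B' := fun _ => 0) hcont (fun t _ => (hderiv Z₀ t).hasDerivWithinAt) hΦ
        (fun t => hasDerivAt_const t c) ?_ (Set.right_mem_Icc.2 htT)
      intro t ht hc
      rcases hgen Z₀ t (ht₀.trans ht.1) ht.2 hc with h | ⟨Z', h1, h2⟩
      · exact h
      · exact absurd h2 (not_le.2 (hex t Z' ht.1 ht.2 h1))

/-- The same for a family of nonnegative observables of a jump process, each of which decays on
average as long as all of them are at most `1`. -/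
theorem exists_reachable_observables_le {S ι J : Type*} [Fintype J] (m : S → ℕ)
    (moves : S → Finset ι) (next : S → ι → S)
    (hm : ∀ Z, ∀ i ∈ moves Z, m (next Z i) < m Z) (rate : S → ℝ → ι → ℝ)
    (hrate : ∀ Z t, ∀ i ∈ moves Z, 0 ≤ rate Z t i) (g g' : J → S → ℝ → ℝ)
    (hg : ∀ j Z t, 0 ≤ g j Z t) (hderiv : ∀ j Z t, HasDerivAt (g j Z) (g' j Z t) t) (T : ℝ)
    (hgen : ∀ Z t, 0 ≤ t → t < T → (∀ j, g j Z t ≤ 1) → ∀ j,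
      g' j Z t + ∑ i ∈ moves Z, rate Z t i * (g j (next Z i) t - g j Z t) ≤ - g j Z t)
    (Z₀ : S) (hT : 0 ≤ T) (h₀ : ∑ j, g j Z₀ 0 ≤ 1) :
    ∃ Z, Relation.ReflTransGen (fun Z Z' => ∃ i ∈ moves Z, Z' = next Z i) Z₀ Z ∧
      ∀ j, g j Z T ≤ 1 := by
  obtain ⟨Z, hZ, hle⟩ := exists_reachable_potential_le m
    (fun Z Z' => ∃ i ∈ moves Z, Z' = next Z i) (by rintro Z _ ⟨i, hi, rfl⟩; exact hm Z i hi)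
    (fun Z t => ∑ j, g j Z t) (fun Z t => ∑ j, g' j Z t) T 1
    (fun Z t => HasDerivAt.fun_sum fun j _ => hderiv j Z t) (by
      intro Z t h0 hT hc
      have h1 : ∀ j, g j Z t ≤ 1 := fun j => by
        rw [← hc]; exact single_le_sum (f := fun j => g j Z t) (fun j _ => hg j Z t) (mem_univ j)
      have h2 := sum_le_sum fun j (_ : j ∈ univ) => hgen Z t h0 hT h1 j
      rw [sum_add_distrib, sum_neg_distrib, hc, sum_comm] at h2
      by_contra! hcon
      obtain ⟨h3, h4⟩ := hcon
      have h5 : 0 ≤ ∑ i ∈ moves Z, ∑ j, rate Z t i * (g j (next Z i) t - g j Z t) := by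
        refine sum_nonneg fun i hi => ?_
        rw [← mul_sum, sum_sub_distrib, hc]
        have := h4 _ ⟨i, hi, rfl⟩
        exact mul_nonneg (hrate Z t i hi) (by linarith)
      linarith) Z₀ hT h₀
  exact ⟨Z, hZ, fun j =>
    (single_le_sum (f := fun j => g j Z T) (fun j _ => hg j Z T) (mem_univ j)).trans hle⟩

theorem sum_filter_meet_eq {X : Type*} {E : Finset (Finset X)}
    (hlin : ∀ a ∈ E, ∀ b ∈ E, a ≠ b → (a ∩ b).card ≤ 1) (q : Finset X → ℝ) {x : X}
    {b : Finset X} (hb : b ∈ E) (hx : x ∈ b) :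
    ∑ a ∈ E with x ∉ a ∧ ¬Disjoint a b, q a =
      ∑ y ∈ b.erase x, ((∑ a ∈ E with y ∈ a, q a) - q b) := by
  have h1 : ∀ y ∈ b.erase x, (∑ a ∈ E with y ∈ a, q a) - q b =
      ∑ a ∈ E.erase b, if y ∈ a then q a else 0 := by
    intro y hy
    rw [sum_filter, ← add_sum_erase E _ hb, if_pos (mem_of_mem_erase hy)]
    ring
  rw [sum_congr rfl h1, sum_comm, sum_filter, ← add_sum_erase E _ hb, if_neg (by simp [hx]),
    zero_add]
  refine sum_congr rfl fun a ha => ?_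
  have hab : (a ∩ b).card ≤ 1 := hlin a (mem_of_mem_erase ha) b hb (ne_of_mem_erase ha)
  rw [← sum_filter, sum_const]
  split_ifs with h
  · obtain ⟨h2, h3⟩ := h
    obtain ⟨y, hya, hyb⟩ := not_disjoint_iff.1 h3
    have : (b.erase x).filter (· ∈ a) = {y} := by
      ext z
      simp only [mem_filter, mem_erase, mem_singleton]
      constructor
      · rintro ⟨⟨_, hz⟩, hz'⟩
        exact card_le_one.1 hab z (mem_inter.2 ⟨hz', hz⟩) y (mem_inter.2 ⟨hya, hyb⟩)
      · rintro rfl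
        exact ⟨⟨fun h => h2 (h ▸ hya), hyb⟩, hya⟩
    simp [this]
  · have : (b.erase x).filter (· ∈ a) = ∅ := by
      refine filter_eq_empty_iff.2 fun z hz hza => h ⟨fun hxa => ?_, ?_⟩
      · exact (mem_erase.1 hz).1 (card_le_one.1 hab z
          (mem_inter.2 ⟨hza, mem_of_mem_erase hz⟩) x (mem_inter.2 ⟨hxa, hx⟩))
      · exact not_disjoint_iff.2 ⟨z, hza, mem_of_mem_erase hz⟩
    simp [this]

theorem sum_mul_loss_eq {X : Type*} {E : Finset (Finset X)}
    (hlin : ∀ a ∈ E, ∀ b ∈ E, a ≠ b → (a ∩ b).card ≤ 1) (q : Finset X → ℝ) (x : X) :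
    ∑ a ∈ E with x ∉ a, q a * ∑ b ∈ E with x ∈ b ∧ ¬Disjoint a b, q b =
      ∑ b ∈ E with x ∈ b, q b * ∑ y ∈ b.erase x, ((∑ a ∈ E with y ∈ a, q a) - q b) := by
  have h1 : ∀ b ∈ E.filter (x ∈ ·), q b * ∑ y ∈ b.erase x, ((∑ a ∈ E with y ∈ a, q a) - q b) =
      ∑ a ∈ E with x ∉ a, if ¬Disjoint a b then q a * q b else 0 := by
    intro b hb
    rw [← sum_filter_meet_eq hlin q (mem_filter.1 hb).1 (mem_filter.1 hb).2, mul_sum,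
      ← filter_filter, sum_filter]
    refine sum_congr rfl fun a _ => ?_
    split_ifs <;> ring
  rw [sum_congr rfl h1, sum_comm]
  refine sum_congr rfl fun a _ => ?_
  rw [mul_sum, ← filter_filter, sum_filter]

theorem card_filter_meet_le {X : Type*} {E : Finset (Finset X)}
    (hlin : ∀ a ∈ E, ∀ b ∈ E, a ≠ b → (a ∩ b).card ≤ 1) {x : X} {a : Finset X} (hx : x ∉ a) :
    (E.filter fun b => x ∈ b ∧ ¬Disjoint a b).card ≤ a.card := by
  have h : (E.filter fun b => x ∈ b ∧ ¬Disjoint a b) ⊆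
      a.biUnion fun y => E.filter fun b => x ∈ b ∧ y ∈ b := by
    intro b hb
    obtain ⟨hbE, hxb, hab⟩ := mem_filter.1 hb
    obtain ⟨y, hya, hyb⟩ := not_disjoint_iff.1 hab
    exact mem_biUnion.2 ⟨y, hya, mem_filter.2 ⟨hbE, hxb, hyb⟩⟩
  refine (card_le_card h).trans ((card_biUnion_le_card_mul _ _ 1 fun y hy => ?_).trans (by simp))
  refine card_le_one.2 fun b hb c hc => ?_
  simp only [mem_filter] at hb hc
  by_contra hbc
  have := card_le_one.1 (hlin b hb.1 c hc.1 hbc) x (mem_inter.2 ⟨hb.2.1, hc.2.1⟩) y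
    (mem_inter.2 ⟨hb.2.2, hc.2.2⟩)
  exact hx (this ▸ hy)

theorem exp_sub_one_le_add_sq {u : ℝ} (hu : |u| ≤ 1) : Real.exp u - 1 ≤ u + u ^ 2 := by
  have := (abs_le.1 (Real.abs_exp_sub_one_sub_id_le hu)).2
  linarith

/-- Bounds for the effect of one random step of the nibble on the weight at a vertex `x`. -/
theorem sum_mul_loss_bounds {X : Type*} {E : Finset (Finset X)} {Z : Finset X} {k : ℕ}
    {q : Finset X → ℝ} {η κ : ℝ}
    (hlin : ∀ a ∈ E, ∀ b ∈ E, a ≠ b → (a ∩ b).card ≤ 1) (hZ : ∀ a ∈ E, a ⊆ Z)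
    (hcard : ∀ a ∈ E, a.card ≤ k) (hq : ∀ a ∈ E, 0 ≤ q a)
    (hκ : ∀ a ∈ E, 2 ≤ a.card → q a ≤ κ) (hκ0 : 0 ≤ κ) (hη : η ≤ 1)
    (hw : ∀ y ∈ Z, |(∑ a ∈ E with y ∈ a, q a) - 1| ≤ η) {x : X} (hx : x ∈ Z) :
    |(∑ a ∈ E with x ∉ a, q a * ∑ b ∈ E with x ∈ b ∧ ¬Disjoint a b, q b) -
        ∑ b ∈ E with x ∈ b, q b * ((b.card : ℝ) - 1)| ≤ 2 * k * (η + κ) ∧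
      (∑ a ∈ E with x ∉ a, q a * ∑ b ∈ E with x ∈ b ∧ ¬Disjoint a b, q b) ≤ 4 * k ∧
      ∀ u : ℝ, |u| * (k * κ) ≤ 1 →
        ∑ a ∈ E with x ∉ a, q a * (Real.exp (u * ∑ b ∈ E with x ∈ b ∧ ¬Disjoint a b, q b) - 1) ≤
          (u + u ^ 2 * (k * κ)) *
            ∑ a ∈ E with x ∉ a, q a * ∑ b ∈ E with x ∈ b ∧ ¬Disjoint a b, q b := by
  have hη0 : 0 ≤ η := (abs_nonneg _).trans (hw x hx)
  have hb1 : ∀ b ∈ E.filter (x ∈ ·), (0 : ℝ) ≤ (b.card : ℝ) - 1 ∧ (b.card : ℝ) - 1 ≤ k := by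
    intro b hb
    have h1 : 1 ≤ b.card := card_pos.2 ⟨x, (mem_filter.1 hb).2⟩
    have h2 := hcard b (mem_filter.1 hb).1
    have h1' : (1 : ℝ) ≤ b.card := by exact_mod_cast h1
    have h2' : (b.card : ℝ) ≤ k := by exact_mod_cast h2
    constructor <;> linarith
  have hD : ∑ b ∈ E with x ∈ b, q b * ((b.card : ℝ) - 1) ≤ 2 * k := by
    calc _ ≤ ∑ b ∈ E with x ∈ b, q b * k := sum_le_sum fun b hb =>
          mul_le_mul_of_nonneg_left (hb1 b hb).2 (hq b (mem_filter.1 hb).1)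
      _ = (∑ b ∈ E with x ∈ b, q b) * k := (sum_mul _ _ _).symm
      _ ≤ 2 * k := by
          have := (abs_le.1 (hw x hx)).2
          exact mul_le_mul_of_nonneg_right (by linarith) (Nat.cast_nonneg k)
  have hD0 : 0 ≤ ∑ b ∈ E with x ∈ b, q b * ((b.card : ℝ) - 1) :=
    sum_nonneg fun b hb => mul_nonneg (hq b (mem_filter.1 hb).1) (hb1 b hb).1
  have hterm : ∀ b ∈ E.filter (x ∈ ·),
      ((b.card : ℝ) - 1) * (1 - η - κ) ≤ ∑ y ∈ b.erase x, ((∑ a ∈ E with y ∈ a, q a) - q b) ∧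
      ∑ y ∈ b.erase x, ((∑ a ∈ E with y ∈ a, q a) - q b) ≤ ((b.card : ℝ) - 1) * (1 + η) := by
    intro b hb
    obtain ⟨hbE, hxb⟩ := mem_filter.1 hb
    have hc : ((b.erase x).card : ℝ) = (b.card : ℝ) - 1 := by
      rw [card_erase_of_mem hxb, Nat.cast_sub (card_pos.2 ⟨x, hxb⟩), Nat.cast_one]
    have hy : ∀ y ∈ b.erase x, 1 - η - κ ≤ (∑ a ∈ E with y ∈ a, q a) - q b ∧
        (∑ a ∈ E with y ∈ a, q a) - q b ≤ 1 + η := by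
      intro y hy
      have h1 := abs_le.1 (hw y (hZ b hbE (mem_of_mem_erase hy)))
      have h2 := hq b hbE
      have h3 := hκ b hbE (one_lt_card.2 ⟨y, mem_of_mem_erase hy, x, hxb, ne_of_mem_erase hy⟩)
      constructor <;> linarith
    constructor
    · have := card_nsmul_le_sum (b.erase x) _ _ fun y h => (hy y h).1
      rwa [nsmul_eq_mul, hc] at this
    · have := sum_le_card_nsmul (b.erase x) _ _ fun y h => (hy y h).2
      rwa [nsmul_eq_mul, hc] at this
  have hL1 := sum_mul_loss_eq hlin q x
  have hlow : (∑ b ∈ E with x ∈ b, q b * ((b.card : ℝ) - 1)) * (1 - η - κ) ≤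
      ∑ a ∈ E with x ∉ a, q a * ∑ b ∈ E with x ∈ b ∧ ¬Disjoint a b, q b := by
    rw [hL1, sum_mul]
    refine sum_le_sum fun b hb => ?_
    rw [mul_assoc]
    exact mul_le_mul_of_nonneg_left (hterm b hb).1 (hq b (mem_filter.1 hb).1)
  have hup : ∑ a ∈ E with x ∉ a, q a * ∑ b ∈ E with x ∈ b ∧ ¬Disjoint a b, q b ≤
      (∑ b ∈ E with x ∈ b, q b * ((b.card : ℝ) - 1)) * (1 + η) := by
    rw [hL1, sum_mul]
    refine sum_le_sum fun b hb => ?_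
    rw [mul_assoc]
    exact mul_le_mul_of_nonneg_left (hterm b hb).2 (hq b (mem_filter.1 hb).1)
  refine ⟨abs_le.2 ⟨?_, ?_⟩, ?_, ?_⟩
  · nlinarith
  · nlinarith
  · nlinarith
  · intro u hu
    rw [mul_sum]
    refine sum_le_sum fun a ha => ?_
    obtain ⟨haE, hxa⟩ := mem_filter.1 ha
    have hl0 : 0 ≤ ∑ b ∈ E with x ∈ b ∧ ¬Disjoint a b, q b :=
      sum_nonneg fun b hb => hq b (mem_filter.1 hb).1
    have hl1 : ∑ b ∈ E with x ∈ b ∧ ¬Disjoint a b, q b ≤ k * κ := by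
      refine (sum_le_card_nsmul _ _ κ fun b hb => ?_).trans ?_
      · obtain ⟨hbE, hxb, hab⟩ := mem_filter.1 hb
        obtain ⟨y, hya, hyb⟩ := not_disjoint_iff.1 hab
        exact hκ b hbE (one_lt_card.2 ⟨y, hyb, x, hxb, fun h => hxa (h ▸ hya)⟩)
      · rw [nsmul_eq_mul]
        refine mul_le_mul_of_nonneg_right ?_ hκ0
        exact_mod_cast (card_filter_meet_le hlin hxa).trans (hcard a haE)
    set l := ∑ b ∈ E with x ∈ b ∧ ¬Disjoint a b, q b
    have hul : |u * l| ≤ 1 := by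
      rw [abs_mul, abs_of_nonneg hl0]
      exact (mul_le_mul_of_nonneg_left hl1 (abs_nonneg u)).trans hu
    have h1 := exp_sub_one_le_add_sq hul
    have h2 : u * l + (u * l) ^ 2 ≤ (u + u ^ 2 * (k * κ)) * l := by
      nlinarith [mul_nonneg (sq_nonneg u) hl0]
    calc q a * (Real.exp (u * l) - 1) ≤ q a * ((u + u ^ 2 * (k * κ)) * l) :=
          mul_le_mul_of_nonneg_left (h1.trans h2) (hq a haE)
      _ = _ := by ring

/-- The generator inequality for the exponential of the (signed) weight deviation at `x`; here
`d` is the sign. -/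
theorem generator_weight_le {X : Type*} {E : Finset (Finset X)} {Z : Finset X} {k : ℕ}
    {q : Finset X → ℝ} {η η₀ κ l d : ℝ}
    (hlin : ∀ a ∈ E, ∀ b ∈ E, a ≠ b → (a ∩ b).card ≤ 1) (hZ : ∀ a ∈ E, a ⊆ Z)
    (hcard : ∀ a ∈ E, a.card ≤ k) (hk : 1 ≤ k) (hq : ∀ a ∈ E, 0 ≤ q a)
    (hκ : ∀ a ∈ E, 2 ≤ a.card → q a ≤ κ) (hκ0 : 0 ≤ κ) (hη : η ≤ 1)
    (hw : ∀ y ∈ Z, |(∑ a ∈ E with y ∈ a, q a) - 1| ≤ η) {x : X} (hx : x ∈ Z)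
    (hd : d = 1 ∨ d = -1) (hκη : κ ≤ η₀) (hηη : η₀ ≤ η) (hl : 1 ≤ l * η₀)
    (hlk : l * (k * κ) ≤ η₀ / 4) :
    l * (d * (∑ b ∈ E with x ∈ b, q b * ((b.card : ℝ) - 1)) - 8 * k * η) +
      ∑ a ∈ E with x ∉ a,
        q a * (Real.exp (-(d * l) * ∑ b ∈ E with x ∈ b ∧ ¬Disjoint a b, q b) - 1) ≤ -1 := by
  have hη₀ : 0 ≤ η₀ := hκ0.trans hκη
  have hl0 : 0 < l := by
    by_contra h
    nlinarith
  have hk' : (1 : ℝ) ≤ k := by exact_mod_cast hk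
  obtain ⟨h1, h2, h3⟩ := sum_mul_loss_bounds hlin hZ hcard hq hκ hκ0 hη hw hx
  have habs : |-(d * l)| = l := by
    rcases hd with rfl | rfl
    · rw [one_mul, abs_neg, abs_of_pos hl0]
    · rw [neg_mul, one_mul, neg_neg, abs_of_pos hl0]
  have h4 := h3 (-(d * l)) (by rw [habs]; linarith)
  have hd2 : (-(d * l)) ^ 2 = l ^ 2 := by rw [← sq_abs, habs]
  rw [hd2] at h4
  have h6 : 0 ≤ ∑ a ∈ E with x ∉ a, q a * ∑ b ∈ E with x ∈ b ∧ ¬Disjoint a b, q b :=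
    sum_nonneg fun a ha => mul_nonneg (hq a (mem_filter.1 ha).1)
      (sum_nonneg fun b hb => hq b (mem_filter.1 hb).1)
  set D := ∑ b ∈ E with x ∈ b, q b * ((b.card : ℝ) - 1)
  set L := ∑ a ∈ E with x ∉ a, q a * ∑ b ∈ E with x ∈ b ∧ ¬Disjoint a b, q b
  have h5 : d * D - d * L ≤ 2 * k * (η + κ) := by
    have := abs_le.1 h1
    rcases hd with rfl | rfl <;> linarith
  have h7 : l * (k * κ) * L ≤ η₀ / 4 * (4 * k) :=
    mul_le_mul hlk h2 h6 (by linarith)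
  have h8 : d * D - d * L - 8 * k * η + l * (k * κ) * L ≤ - η₀ := by
    have : 2 * k * (η + κ) ≤ 2 * k * (η + η) := by gcongr; linarith
    have : (k : ℝ) * η₀ ≤ k * η := by gcongr
    have : η₀ ≤ k * η₀ := by nlinarith
    linarith
  have h9 : l * (d * D - d * L - 8 * k * η + l * (k * κ) * L) ≤ l * (-η₀) :=
    mul_le_mul_of_nonneg_left h8 hl0.le
  calc _ ≤ l * (d * D - 8 * k * η) + (-(d * l) + l ^ 2 * (k * κ)) * L := by gcongr
    _ = l * (d * D - d * L - 8 * k * η + l * (k * κ) * L) := by ring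
    _ ≤ -1 := by linarith

theorem generator_size_le {X : Type*} {E : Finset (Finset X)} {Z F : Finset X} {k : ℕ}
    {q : Finset X → ℝ} {s : ℝ} (hZ : ∀ a ∈ E, a ⊆ Z)
    (hcard : ∀ a ∈ E, a.card ≤ k) (hq : ∀ a ∈ E, 0 ≤ q a)
    (hw : ∀ y ∈ Z, |(∑ a ∈ E with y ∈ a, q a) - 1| ≤ 1 / 8) (hs : 0 ≤ s) (hsk : s * k ≤ 1 / 8) :
    s * (F ∩ Z).card / 2 + ∑ a ∈ E, q a * (Real.exp (-(s * (F ∩ a).card)) - 1) ≤ 0 := by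
  have h1 : ∀ a ∈ E, q a * (Real.exp (-(s * (F ∩ a).card)) - 1) ≤
      q a * (-(7 / 8 * s) * (F ∩ a).card) := by
    intro a ha
    refine mul_le_mul_of_nonneg_left ?_ (hq a ha)
    have h2 : ((F ∩ a).card : ℝ) ≤ k := by
      exact_mod_cast (card_le_card inter_subset_right).trans (hcard a ha)
    have h3 : s * (F ∩ a).card ≤ 1 / 8 := (mul_le_mul_of_nonneg_left h2 hs).trans hsk
    have h4 : 0 ≤ s * (F ∩ a).card := by positivity
    have h5 := exp_sub_one_le_add_sq (u := -(s * (F ∩ a).card))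
      (by rw [abs_neg, abs_of_nonneg h4]; linarith)
    nlinarith
  have h2 : ∑ a ∈ E, q a * ((F ∩ a).card : ℝ) = ∑ y ∈ F ∩ Z, ∑ a ∈ E with y ∈ a, q a := by
    simp_rw [sum_filter]
    rw [sum_comm]
    refine sum_congr rfl fun a ha => ?_
    rw [← sum_filter, sum_const, nsmul_eq_mul, mul_comm]
    congr 3
    ext y
    simp only [mem_inter, mem_filter]
    exact ⟨fun h => ⟨⟨h.1, hZ a ha h.2⟩, h.2⟩, fun h => ⟨h.1.1, h.2⟩⟩
  have h3 : (7 / 8 : ℝ) * (F ∩ Z).card ≤ ∑ y ∈ F ∩ Z, ∑ a ∈ E with y ∈ a, q a := by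
    have := card_nsmul_le_sum (F ∩ Z) (fun y => ∑ a ∈ E with y ∈ a, q a) (7 / 8) fun y hy => by
      have := (abs_le.1 (hw y (mem_inter.1 hy).2)).1
      linarith
    rw [nsmul_eq_mul] at this
    linarith
  have h4 : ∑ a ∈ E, q a * (-(7 / 8 * s) * (F ∩ a).card) =
      -(7 / 8 * s) * ∑ a ∈ E, q a * ((F ∩ a).card : ℝ) := by
    rw [mul_sum]
    exact sum_congr rfl fun a _ => by ring
  have h5 := sum_le_sum h1
  rw [h4, h2] at h5
  have h6 : s * (7 / 8 * ((F ∩ Z).card : ℝ)) ≤ s * ∑ y ∈ F ∩ Z, ∑ a ∈ E with y ∈ a, q a :=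
    mul_le_mul_of_nonneg_left h3 hs
  have h7 : 0 ≤ s * ((F ∩ Z).card : ℝ) := by positivity
  linarith

/-- The edges of `A` all of whose vertices survive in `Z`. -/
noncomputable def aliveEdges {X : Type*} (A : Finset (Finset X)) (Z : Finset X) :
    Finset (Finset X) := A.filter (· ⊆ Z)

/-- The weight of an edge at time `t`: an edge loses each of its vertices at rate one, and the
weights are rescaled to compensate for the expected loss. -/
noncomputable def nibbleWeight {X : Type*} (p : Finset X → ℝ) (t : ℝ) (b : Finset X) : ℝ :=
  p b * Real.exp (((b.card : ℝ) - 1) * t)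

theorem hasDerivAt_nibbleWeight {X : Type*} (p : Finset X → ℝ) (t : ℝ) (b : Finset X) :
    HasDerivAt (fun t => nibbleWeight p t b) (nibbleWeight p t b * ((b.card : ℝ) - 1)) t := by
  have h := (((hasDerivAt_id t).const_mul ((b.card : ℝ) - 1)).exp).const_mul (p b)
  simp only [id, mul_one] at h
  unfold nibbleWeight
  rw [mul_assoc]
  exact h

theorem sum_alive_sdiff {X : Type*} (A : Finset (Finset X)) (Z a : Finset X) (q : Finset X → ℝ)
    (x : X) :
    ∑ b ∈ aliveEdges A (Z \ a) with x ∈ b, q b = (∑ b ∈ aliveEdges A Z with x ∈ b, q b) -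
      ∑ b ∈ aliveEdges A Z with x ∈ b ∧ ¬Disjoint a b, q b := by
  rw [eq_sub_iff_add_eq, ← sum_filter_add_sum_filter_not ((aliveEdges A Z).filter (x ∈ ·))
    (fun b => Disjoint a b), filter_filter, filter_filter]
  congr 1
  refine sum_congr ?_ fun _ _ => rfl
  ext b
  simp only [aliveEdges, mem_filter, subset_sdiff, disjoint_comm (a := b)]
  tauto

theorem exists_alive_set {X : Type*} [Fintype X] {k : ℕ} (hk : 1 ≤ k) {A : Finset (Finset X)}
    {p : Finset X → ℝ} {Fam : Finset (Finset X)} {n T κ η₀ s : ℝ}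
    (hlin : ∀ a ∈ A, ∀ b ∈ A, a ≠ b → (a ∩ b).card ≤ 1)
    (hne : ∀ a ∈ A, a.Nonempty) (hcard : ∀ a ∈ A, a.card ≤ k) (hp : ∀ a ∈ A, 0 ≤ p a)
    (hpκ : ∀ a ∈ A, 2 ≤ a.card → p a * Real.exp (k * T) ≤ κ) (hκ0 : 0 ≤ κ)
    (hw : ∀ x, ∑ a ∈ A with x ∈ a, p a = 1) (hFam : ∀ F ∈ Fam, (F.card : ℝ) ≤ n)
    (hT : 0 ≤ T) (hs : 0 < s) (hη₀ : 0 < η₀) (hη₀T : η₀ * Real.exp (8 * k * T) ≤ 1 / 8)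
    (hsT : s * Real.exp (T / 2) * k ≤ 1 / 8) (hκη : κ ≤ η₀)
    (hl : 1 ≤ s * n * η₀) (hlk : s * n * (k * κ) ≤ η₀ / 4)
    (hinit : 2 * Fintype.card X * Real.exp (-(s * n * η₀)) + Fam.card * Real.exp (-(s * n)) ≤ 1) :
    ∃ Z, Relation.ReflTransGen (fun Z Z' => ∃ a ∈ aliveEdges A Z, Z' = Z \ a) univ Z ∧
      ∀ F ∈ Fam, s * Real.exp (T / 2) * (F ∩ Z).card ≤ 2 * s * n + T := by
  let sg : Bool → ℝ := fun b => if b then 1 else -1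
  have hsg : ∀ b, sg b = 1 ∨ sg b = -1 := by intro b; cases b <;> simp [sg]
  let w : Finset X → ℝ → X → ℝ := fun Z t x => ∑ b ∈ aliveEdges A Z with x ∈ b, nibbleWeight p t b
  let g : (Bool × X) ⊕ Fam → Finset X → ℝ → ℝ := fun j Z t => Sum.elim
    (fun i => if i.2 ∈ Z then
      Real.exp (s * n * (sg i.1 * (w Z t i.2 - 1) - η₀ * Real.exp (8 * k * t))) else 0)
    (fun F => Real.exp (s * Real.exp (t / 2) * (F.1 ∩ Z).card - 2 * s * n - t)) j
  let g' : (Bool × X) ⊕ Fam → Finset X → ℝ → ℝ := fun j Z t => Sum.elim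
    (fun i => if i.2 ∈ Z then
      Real.exp (s * n * (sg i.1 * (w Z t i.2 - 1) - η₀ * Real.exp (8 * k * t))) *
        (s * n * (sg i.1 * (∑ b ∈ aliveEdges A Z with i.2 ∈ b,
          nibbleWeight p t b * ((b.card : ℝ) - 1)) - 8 * k * (η₀ * Real.exp (8 * k * t)))) else 0)
    (fun F => Real.exp (s * Real.exp (t / 2) * (F.1 ∩ Z).card - 2 * s * n - t) *
      (s * Real.exp (t / 2) * (F.1 ∩ Z).card / 2 - 1)) j
  have hsub : ∀ Z, aliveEdges A Z ⊆ A := fun Z => filter_subset _ _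
  have hsubZ : ∀ Z, ∀ a ∈ aliveEdges A Z, a ⊆ Z := fun Z a ha => (mem_filter.1 ha).2
  have hq : ∀ t, ∀ a ∈ A, 0 ≤ nibbleWeight p t a := fun t a ha =>
    mul_nonneg (hp a ha) (Real.exp_pos _).le
  obtain ⟨Z, hZ, hZg⟩ := exists_reachable_observables_le (J := (Bool × X) ⊕ Fam)
    (fun Z : Finset X => Z.card) (aliveEdges A) (fun Z a => Z \ a) (by
      intro Z a ha
      refine card_lt_card (sdiff_ssubset (hsubZ Z a ha) (hne a (hsub Z ha))))
    (fun _ t a => nibbleWeight p t a) (fun Z t a ha => hq t a (hsub Z ha)) g g'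
    (by
      rintro (i | F) Z t
      · simp only [g, Sum.elim_inl]
        split_ifs
        · exact (Real.exp_pos _).le
        · exact le_rfl
      · exact (Real.exp_pos _).le)
    (by
      rintro (i | F) Z t
      · simp only [g, g', Sum.elim_inl]
        split_ifs
        · refine HasDerivAt.exp (HasDerivAt.const_mul _ (HasDerivAt.sub
            (((HasDerivAt.fun_sum fun b _ => hasDerivAt_nibbleWeight p t b).sub_const 1).const_mul
              _) ?_))
          have := ((((hasDerivAt_id t).const_mul (8 * k : ℝ)).exp).const_mul η₀)
          simp only [id, mul_one] at this
          exact this.congr_deriv (by ring)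
        · exact hasDerivAt_const _ _
      · simp only [g, g', Sum.elim_inr]
        refine HasDerivAt.exp (HasDerivAt.sub (HasDerivAt.sub_const _ ?_) (hasDerivAt_id t))
        have := ((((hasDerivAt_id t).div_const 2).exp).const_mul s).mul_const
          ((F.1 ∩ Z).card : ℝ)
        simp only [id] at this
        exact this.congr_deriv (by ring)) T
    (by
      intro Z t ht htT hle
      have hη1 : η₀ * Real.exp (8 * k * t) ≤ 1 / 8 := le_trans (by gcongr) hη₀T
      have hη2 : η₀ ≤ η₀ * Real.exp (8 * k * t) :=
        le_mul_of_one_le_right hη₀.le (Real.one_le_exp (by positivity))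
      have hwZ : ∀ y ∈ Z, |w Z t y - 1| ≤ η₀ * Real.exp (8 * k * t) := by
        intro y hy
        have hsn : 0 < s * n := by
          by_contra h
          nlinarith
        have h : ∀ b, sg b * (w Z t y - 1) - η₀ * Real.exp (8 * k * t) ≤ 0 := by
          intro b
          have := hle (Sum.inl (b, y))
          simp only [g, Sum.elim_inl, if_pos hy, Real.exp_le_one_iff] at this
          by_contra! h
          exact absurd this (not_le.2 (mul_pos hsn h))
        have h1 := h true
        have h2 := h false
        simp only [sg] at h1 h2
        refine abs_le.2 ⟨?_, ?_⟩ <;> norm_num at h1 h2 <;> linarith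
      have hqκ : ∀ a ∈ aliveEdges A Z, 2 ≤ a.card → nibbleWeight p t a ≤ κ := by
        intro a ha h2
        refine le_trans ?_ (hpκ a (hsub Z ha) h2)
        refine mul_le_mul_of_nonneg_left (Real.exp_le_exp.2 ?_) (hp a (hsub Z ha))
        have : (a.card : ℝ) ≤ k := by exact_mod_cast hcard a (hsub Z ha)
        have h2' : (2 : ℝ) ≤ a.card := by exact_mod_cast h2
        exact mul_le_mul (by linarith) htT.le ht (by linarith)
      rintro (⟨b, x⟩ | F)
      · by_cases hx : x ∈ Z
        · have hgen := generator_weight_le (E := aliveEdges A Z) (Z := Z) (l := s * n)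
            (fun a ha c hc => hlin a (hsub Z ha) c (hsub Z hc)) (hsubZ Z)
            (fun a ha => hcard a (hsub Z ha)) hk (fun a ha => hq t a (hsub Z ha)) hqκ hκ0
            (hη1.trans (by norm_num)) hwZ hx (hsg b) hκη hη2 hl hlk
          have hmove : ∀ a ∈ aliveEdges A Z, nibbleWeight p t a *
              (g (Sum.inl (b, x)) (Z \ a) t - g (Sum.inl (b, x)) Z t) ≤
              if x ∉ a then g (Sum.inl (b, x)) Z t * (nibbleWeight p t a *
                (Real.exp (-(sg b * (s * n)) * ∑ c ∈ aliveEdges A Z with x ∈ c ∧ ¬Disjoint a c,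
                  nibbleWeight p t c) - 1)) else 0 := by
            intro a ha
            by_cases hxa : x ∉ a
            · rw [if_pos hxa]
              simp only [g, Sum.elim_inl, if_pos hx, if_pos (mem_sdiff.2 ⟨hx, hxa⟩)]
              have : w (Z \ a) t x = w Z t x - ∑ c ∈ aliveEdges A Z with x ∈ c ∧ ¬Disjoint a c,
                  nibbleWeight p t c := sum_alive_sdiff A Z a _ x
              rw [this, mul_left_comm, mul_sub (Real.exp _), ← Real.exp_add, mul_one]
              refine le_of_eq ?_
              congr 3
              ring
            · rw [if_neg hxa]
              have hx' : x ∉ Z \ a := fun h => (mem_sdiff.1 h).2 (not_not.1 hxa)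
              simp only [g, Sum.elim_inl, if_pos hx, if_neg hx']
              have := hq t a (hsub Z ha)
              have := Real.exp_pos
                (s * n * (sg b * (w Z t x - 1) - η₀ * Real.exp (8 * k * t)))
              nlinarith
          have hsum := sum_le_sum hmove
          rw [← sum_filter, ← mul_sum] at hsum
          have hg0 : 0 ≤ g (Sum.inl (b, x)) Z t := by
            simp only [g, Sum.elim_inl, if_pos hx]; exact (Real.exp_pos _).le
          have hg' : g' (Sum.inl (b, x)) Z t = g (Sum.inl (b, x)) Z t *
              (s * n * (sg b * (∑ c ∈ aliveEdges A Z with x ∈ c,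
              nibbleWeight p t c * ((c.card : ℝ) - 1)) - 8 * k * (η₀ * Real.exp (8 * k * t)))) := by
            simp only [g, g', Sum.elim_inl, if_pos hx]
          rw [hg']
          have h := mul_le_mul_of_nonneg_left hgen hg0
          rw [mul_add] at h
          linarith
        · have hx' : ∀ a, x ∉ Z \ a := fun a h => hx (mem_sdiff.1 h).1
          simp [g, g', hx, hx']
      · have hgen := generator_size_le (E := aliveEdges A Z) (Z := Z) (F := F.1) (k := k)
          (q := nibbleWeight p t) (s := s * Real.exp (t / 2)) (hsubZ Z)
          (fun a ha => hcard a (hsub Z ha)) (fun a ha => hq t a (hsub Z ha))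
          (fun y hy => (hwZ y hy).trans hη1) (by positivity)
          (le_trans (by gcongr) hsT)
        have hmove : ∀ a ∈ aliveEdges A Z, nibbleWeight p t a *
            (g (Sum.inr F) (Z \ a) t - g (Sum.inr F) Z t) =
            g (Sum.inr F) Z t * (nibbleWeight p t a *
              (Real.exp (-(s * Real.exp (t / 2) * (F.1 ∩ a).card)) - 1)) := by
          intro a ha
          have hc : ((F.1 ∩ (Z \ a)).card : ℝ) = (F.1 ∩ Z).card - (F.1 ∩ a).card := by
            have h1 : F.1 ∩ (Z \ a) = (F.1 ∩ Z) \ (F.1 ∩ a) := by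
              ext y; simp only [mem_inter, mem_sdiff]; tauto
            have h2 : F.1 ∩ a ⊆ F.1 ∩ Z := inter_subset_inter_left (hsubZ Z a ha)
            rw [h1, card_sdiff_of_subset h2, Nat.cast_sub (card_le_card h2)]
          simp only [g, Sum.elim_inr, hc]
          rw [mul_left_comm, mul_sub (Real.exp _), ← Real.exp_add, mul_one]
          congr 3
          ring
        rw [sum_congr rfl hmove, ← mul_sum]
        have hg' : g' (Sum.inr F) Z t = g (Sum.inr F) Z t *
            (s * Real.exp (t / 2) * (F.1 ∩ Z).card / 2 - 1) := rfl
        have hg0 : 0 ≤ g (Sum.inr F) Z t := (Real.exp_pos _).le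
        rw [hg']
        nlinarith [mul_le_mul_of_nonneg_left hgen hg0])
    univ hT (by
      have hw0 : ∀ x, w univ 0 x = 1 := by
        intro x
        rw [← hw x]
        simp [w, nibbleWeight, aliveEdges]
      rw [Fintype.sum_sum_type]
      refine le_trans (add_le_add ?_ ?_) hinit
      · simp [g, hw0, mul_comm]
      · simp only [g, Sum.elim_inr]
        have : ∀ F : Fam, Real.exp (s * Real.exp (0 / 2) * (F.1 ∩ univ).card - 2 * s * n - 0) ≤
            Real.exp (-(s * n)) := by
          intro F
          have := mul_le_mul_of_nonneg_left (hFam F.1 F.2) hs.le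
          simp only [inter_univ, zero_div, Real.exp_zero, mul_one, sub_zero]
          exact Real.exp_le_exp.2 (by linarith)
        refine (sum_le_sum fun F _ => this F).trans ?_
        simp)
  refine ⟨Z, hZ, fun F hF => ?_⟩
  have := hZg (Sum.inr ⟨F, hF⟩)
  simp only [g, Sum.elim_inr, Real.exp_le_one_iff] at this
  linarith

/-- A fractional perfect matching with small weights in a linear hypergraph of bounded rank can be
rounded to a matching that covers nearly all of each of polynomially many given vertex sets.
Edges of size one may have large weights. -/
theorem eventually_exists_matching (k : ℕ) (hk : 1 ≤ k) (K ε : ℝ) (hK : 0 < K) (hε : 0 < ε) :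
    ∀ᶠ n : ℝ in Filter.atTop, ∀ {X : Type} [Fintype X] (A : Finset (Finset X))
      (p : Finset X → ℝ) (Fam : Finset (Finset X)),
      (∀ a ∈ A, ∀ b ∈ A, a ≠ b → (a ∩ b).card ≤ 1) → (∀ a ∈ A, a.Nonempty) →
      (∀ a ∈ A, a.card ≤ k) → (∀ a ∈ A, 0 ≤ p a) → (∀ a ∈ A, 2 ≤ a.card → p a ≤ K / n) →
      (∀ x, ∑ a ∈ A with x ∈ a, p a = 1) → (∀ F ∈ Fam, (F.card : ℝ) ≤ n) →
      (Fintype.card X : ℝ) ≤ n ^ 4 → (Fam.card : ℝ) ≤ n ^ 4 →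
      ∃ M ⊆ A, (∀ a ∈ M, ∀ b ∈ M, a ≠ b → Disjoint a b) ∧
        ∀ F ∈ Fam, ((F.filter fun x => ∀ a ∈ M, x ∉ a).card : ℝ) ≤ ε * n := by
  set T : ℝ := 6 / ε with hTdef
  have hT : 0 < T := by positivity
  have hTe : 3 ≤ ε * Real.exp (T / 2) := by
    have h1 : 3 / ε ≤ Real.exp (T / 2) := by
      have := Real.add_one_le_exp (T / 2)
      have h2 : T / 2 = 3 / ε := by rw [hTdef]; ring
      linarith
    rwa [div_le_iff₀' hε] at h1
  have hk0 : (0 : ℝ) < k := by exact_mod_cast hk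
  set η₀ : ℝ := 1 / (8 * Real.exp (8 * k * T)) with hη₀def
  have hη₀ : 0 < η₀ := by positivity
  set K' : ℝ := K * Real.exp (k * T) with hK'
  have hK'0 : 0 < K' := by positivity
  set s : ℝ := min (1 / (8 * (Real.exp (T / 2) * k))) (η₀ / (4 * (k * K'))) with hsdef
  have hs : 0 < s := by positivity
  have hη₀1 : η₀ ≤ 1 := by
    rw [hη₀def, div_le_one (by positivity)]
    have : 1 ≤ Real.exp (8 * k * T) := Real.one_le_exp (by positivity)
    linarith
  have hlim : Filter.Tendsto (fun n : ℝ => 3 * (n ^ 4 * Real.exp (-(s * η₀) * n))) Filter.atTop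
      (nhds 0) := by
    have h := Real.tendsto_pow_mul_exp_neg_atTop_nhds_zero 4
    have h1 : Filter.Tendsto (fun n : ℝ => (s * η₀) * n) Filter.atTop Filter.atTop :=
      Filter.Tendsto.const_mul_atTop (by positivity) Filter.tendsto_id
    have h2 := ((h.comp h1).const_mul (3 / (s * η₀) ^ 4))
    rw [mul_zero] at h2
    refine h2.congr fun n => ?_
    simp only [Function.comp]
    field_simp
  filter_upwards [Filter.eventually_ge_atTop (K' / η₀), Filter.eventually_ge_atTop (1 / (s * η₀)),
    Filter.eventually_ge_atTop (T / s), Filter.eventually_gt_atTop 0,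
    hlim.eventually_le_const one_pos] with n h1 h2 h3 hn h4
  intro X _ A p Fam hlin hne hcard hp hpK hw hFam hX hFamc
  rw [div_le_iff₀ (by positivity)] at h1 h2 h3
  obtain ⟨Z, hZ, hF⟩ := exists_alive_set (n := n) (T := T) (κ := K' / n) (η₀ := η₀) (s := s) hk
    hlin hne hcard hp (by
      intro a ha h2
      rw [hK', mul_div_right_comm]
      exact mul_le_mul_of_nonneg_right (hpK a ha h2) (Real.exp_pos _).le) (by positivity) hw hFam
    hT.le hs hη₀ (by rw [hη₀def]; field_simp; exact le_rfl) (by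
      have := min_le_left (1 / (8 * (Real.exp (T / 2) * k))) (η₀ / (4 * (k * K')))
      rw [← hsdef, le_div_iff₀ (by positivity)] at this
      linarith) (by rwa [div_le_iff₀ hn, mul_comm]) (by linarith) (by
      have := min_le_right (1 / (8 * (Real.exp (T / 2) * k))) (η₀ / (4 * (k * K')))
      rw [← hsdef, le_div_iff₀ (by positivity)] at this
      have h5 : s * n * (k * (K' / n)) = s * (k * K') := by field_simp
      rw [h5]
      linarith) (by
      have h5 : Real.exp (-(s * n)) ≤ Real.exp (-(s * η₀) * n) :=
        Real.exp_le_exp.2 (by nlinarith [mul_pos hs hn])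
      have h6 : Real.exp (-(s * n * η₀)) = Real.exp (-(s * η₀) * n) := by congr 1; ring
      rw [h6]
      have h7 := mul_le_mul hFamc h5 (Real.exp_pos _).le (by positivity)
      have h8 := mul_le_mul_of_nonneg_right hX (Real.exp_pos (-(s * η₀) * n)).le
      linarith)
  have hM : ∀ Z, Relation.ReflTransGen (fun Z Z' => ∃ a ∈ aliveEdges A Z, Z' = Z \ a) univ Z →
      ∃ M ⊆ A, (∀ a ∈ M, ∀ b ∈ M, a ≠ b → Disjoint a b) ∧ ∀ x, x ∈ Z ↔ ∀ a ∈ M, x ∉ a := by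
    intro Z hZ
    induction hZ with
    | refl => exact ⟨∅, empty_subset _, by simp, by simp⟩
    | tail _ hstep ih =>
      obtain ⟨a, ha, rfl⟩ := hstep
      obtain ⟨M, hMA, hMd, hMZ⟩ := ih
      obtain ⟨haA, haZ⟩ := mem_filter.1 ha
      have hda : ∀ b ∈ M, Disjoint a b := fun b hb =>
        disjoint_left.2 fun x hx => (hMZ x).1 (haZ hx) b hb
      refine ⟨insert a M, insert_subset haA hMA, ?_, ?_⟩
      · intro b hb c hc hbc
        rcases mem_insert.1 hb with h | h <;> rcases mem_insert.1 hc with h' | h'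
        · exact absurd (h.trans h'.symm) hbc
        · exact h ▸ hda c h'
        · exact h' ▸ (hda b h).symm
        · exact hMd b h c h' hbc
      · intro x
        rw [mem_sdiff, hMZ, forall_mem_insert, and_comm]
  obtain ⟨M, hMA, hMd, hMZ⟩ := hM Z hZ
  refine ⟨M, hMA, hMd, fun F hFF => ?_⟩
  have h5 : F.filter (fun x => ∀ a ∈ M, x ∉ a) = F ∩ Z := by
    ext x
    rw [mem_filter, mem_inter, hMZ]
  rw [h5]
  have h6 := hF F hFF
  have h7 : s * Real.exp (T / 2) * (F ∩ Z).card ≤ 3 * s * n := by linarith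
  have h8 : Real.exp (T / 2) * (F ∩ Z).card ≤ 3 * n := by
    by_contra! h
    nlinarith
  have h9 : 3 * n ≤ ε * Real.exp (T / 2) * n := by nlinarith
  have h10 : Real.exp (T / 2) * (F ∩ Z).card ≤ Real.exp (T / 2) * (ε * n) := by linarith
  exact le_of_mul_le_mul_left h10 (Real.exp_pos _)

/-- `φ` colours the elements of `S` from their lists, giving adjacent elements distinct colours. -/
def IsListColoring {W : Type*} (adj : W → W → Prop) (L : W → Finset ℕ) (S : Finset W)
    (φ : W → ℕ) : Prop :=
  (∀ w ∈ S, φ w ∈ L w) ∧ ∀ u ∈ S, ∀ w ∈ S, u ≠ w → adj u w → φ u ≠ φ w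

/-- Every set `S` has a core in which every element has at least as many neighbours as available
colours, and colourings of the core extend to `S`. -/
theorem exists_core {W : Type*} [DecidableEq W] {adj : W → W → Prop}
    (hadj : ∀ u w, adj u w → adj w u)
    (L : W → Finset ℕ) (S : Finset W) :
    ∃ C ⊆ S, (∀ w ∈ C, (L w).card ≤ (C.filter fun u => u ≠ w ∧ adj w u).card) ∧
      ((∃ φ, IsListColoring adj L C φ) → ∃ φ, IsListColoring adj L S φ) := by
  induction S using Finset.strongInduction with
  | H S ih =>
    by_cases h : ∀ w ∈ S, (L w).card ≤ (S.filter fun u => u ≠ w ∧ adj w u).card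
    · exact ⟨S, Subset.rfl, h, id⟩
    · push Not at h
      obtain ⟨w, hw, hlt⟩ := h
      obtain ⟨C, hC, hdeg, hext⟩ := ih (S.erase w) (erase_ssubset hw)
      refine ⟨C, hC.trans (erase_subset _ _), hdeg, fun hφ => ?_⟩
      obtain ⟨φ, hφL, hφ⟩ := hext hφ
      obtain ⟨c, hc, hc'⟩ := exists_mem_notMem_of_card_lt_card
        (card_image_le.trans_lt hlt : ((S.filter fun u => u ≠ w ∧ adj w u).image φ).card < _)
      have hc'' : ∀ u ∈ S, u ≠ w → adj w u → φ u ≠ c := fun u hu huw ha h =>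
        hc' (mem_image.2 ⟨u, mem_filter.2 ⟨hu, huw, ha⟩, h⟩)
      refine ⟨Function.update φ w c, fun u hu => ?_, fun u hu v hv huv ha => ?_⟩
      · rcases eq_or_ne u w with rfl | huw
        · simpa using hc
        · simpa [huw] using hφL u (mem_erase.2 ⟨huw, hu⟩)
      · rcases eq_or_ne u w with rfl | huw
        · rw [Function.update_self, Function.update_of_ne huv.symm]
          exact (hc'' v hv huv.symm ha).symm
        · rcases eq_or_ne v w with rfl | hvw
          · rw [Function.update_self, Function.update_of_ne huv]
            exact hc'' u hu huv (hadj _ _ ha)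
          · rw [Function.update_of_ne huw, Function.update_of_ne hvw]
            exact hφ u (mem_erase.2 ⟨huw, hu⟩) v (mem_erase.2 ⟨hvw, hv⟩) huv ha

theorem exists_isListColoring_of_card_lt {W : Type*} [DecidableEq W] {adj : W → W → Prop}
    (hadj : ∀ u w, adj u w → adj w u) (L : W → Finset ℕ) (S : Finset W)
    (h : ∀ w ∈ S, (S.filter fun u => u ≠ w ∧ adj w u).card < (L w).card) :
    ∃ φ, IsListColoring adj L S φ := by
  obtain ⟨C, hC, hdeg, hext⟩ := exists_core hadj L S
  have : C = ∅ := eq_empty_of_forall_notMem fun w hw => absurd (hdeg w hw)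
    (not_le.2 ((card_le_card (filter_subset_filter _ hC)).trans_lt (h w (hC hw))))
  exact hext ⟨fun _ => 0, by simp [IsListColoring, this]⟩

/-- A linear hypergraph of bounded rank and maximum degree `D` has a matching that covers nearly
all of each of polynomially many given sets of vertices of degree `D`. -/
theorem eventually_exists_matching_of_degree (k : ℕ) (hk : 1 ≤ k) (ζ ε : ℝ) (hζ : 0 < ζ)
    (hε : 0 < ε) :
    ∀ᶠ n : ℝ in Filter.atTop, ∀ {X : Type} [Fintype X] [DecidableEq X] (A : Finset (Finset X))
      (Fam : Finset (Finset X)) (D : ℕ),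
      (∀ a ∈ A, ∀ b ∈ A, a ≠ b → (a ∩ b).card ≤ 1) → (∀ a ∈ A, 2 ≤ a.card) →
      (∀ a ∈ A, a.card ≤ k) → (ζ * n ≤ D) → (∀ x, (A.filter (x ∈ ·)).card ≤ D) →
      (∀ F ∈ Fam, ∀ x ∈ F, (A.filter (x ∈ ·)).card = D) → (∀ F ∈ Fam, (F.card : ℝ) ≤ n) →
      (Fintype.card X : ℝ) ≤ n ^ 4 → (Fam.card : ℝ) ≤ n ^ 4 →
      ∃ M ⊆ A, (∀ a ∈ M, ∀ b ∈ M, a ≠ b → Disjoint a b) ∧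
        ∀ F ∈ Fam, ((F.filter fun x => ∀ a ∈ M, x ∉ a).card : ℝ) ≤ ε * n := by
  filter_upwards [eventually_exists_matching k hk (1 / ζ) ε (by positivity) hε,
    Filter.eventually_gt_atTop 0] with n hn hn0
  intro X _ hX₀ A Fam D hlin h2 hcard hζD hdeg hfull hFam hX hFamc
  obtain rfl : hX₀ = fun a b => Classical.propDecidable (a = b) := Subsingleton.elim _ _
  have hD : (0 : ℝ) < D := lt_of_lt_of_le (by positivity) hζD
  set B : Finset (Finset X) := (univ.filter fun x => (A.filter (x ∈ ·)).card < D).image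
    fun x => {x} with hB
  have hBc : ∀ b ∈ B, b.card = 1 := by
    intro b hb
    obtain ⟨x, -, rfl⟩ := mem_image.1 hb
    exact card_singleton x
  have hdisj : Disjoint A B := disjoint_left.2 fun a ha hb => by
    have := h2 a ha
    have := hBc a hb
    omega
  let p : Finset X → ℝ := fun a =>
    if a ∈ A then 1 / D else 1 - ((A.filter (a ⊆ ·)).card : ℝ) / D
  have hpA : ∀ a ∈ A, p a = 1 / D := fun a ha => if_pos ha
  have hpx : ∀ x, {x} ∉ A → p {x} = 1 - ((A.filter (x ∈ ·)).card : ℝ) / D := by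
    intro x hx
    simp only [p, if_neg hx, singleton_subset_iff]
  have hsing : ∀ x, {x} ∉ A := fun x hx => by
    have := h2 _ hx
    simp at this
  obtain ⟨M, hMA, hMd, hMF⟩ := hn (A ∪ B) p Fam (by
      intro a ha b hb hab
      rcases mem_union.1 ha with ha | ha
      · rcases mem_union.1 hb with hb | hb
        · exact hlin a ha b hb hab
        · exact (card_le_card inter_subset_right).trans (hBc b hb).le
      · exact (card_le_card inter_subset_left).trans (hBc a ha).le) (by
      intro a ha
      rw [← card_pos]
      rcases mem_union.1 ha with ha | ha
      · have := h2 a ha; omega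
      · have := hBc a ha; omega) (by
      intro a ha
      rcases mem_union.1 ha with ha | ha
      · exact hcard a ha
      · rw [hBc a ha]; exact hk) (by
      intro a ha
      rcases mem_union.1 ha with ha | ha
      · rw [hpA a ha]; positivity
      · obtain ⟨x, -, rfl⟩ := mem_image.1 ha
        rw [hpx x (hsing x), sub_nonneg, div_le_one hD]
        exact_mod_cast hdeg x) (by
      intro a ha hc
      rcases mem_union.1 ha with ha | ha
      · rw [hpA a ha, div_div]
        exact one_div_le_one_div_of_le (by positivity) hζD
      · have := hBc a ha; omega) (by
      intro x
      rw [filter_union, sum_union (disjoint_filter_filter hdisj),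
        sum_congr rfl (fun a ha => hpA a (mem_filter.1 ha).1), sum_const, nsmul_eq_mul]
      have hBx : B.filter (x ∈ ·) = if (A.filter (x ∈ ·)).card < D then {{x}} else ∅ := by
        ext b
        simp only [hB, mem_filter, mem_image, mem_univ, true_and]
        constructor
        · rintro ⟨⟨y, hy, rfl⟩, hx⟩
          rw [mem_singleton] at hx
          subst hx
          simp [hy]
        · split_ifs with h
          · intro hb
            rw [mem_singleton] at hb
            exact ⟨⟨x, h, hb.symm⟩, by simp [hb]⟩
          · simp
      rw [hBx]
      split_ifs with h
      · rw [sum_singleton, hpx x (hsing x)]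
        ring
      · rw [le_antisymm (hdeg x) (not_lt.1 h), sum_empty]
        field_simp
        ring) hFam hX hFamc
  refine ⟨M ∩ A, inter_subset_right, fun a ha b hb =>
    hMd a (mem_inter.1 ha).1 b (mem_inter.1 hb).1, fun F hF => ?_⟩
  refine le_trans ?_ (hMF F hF)
  refine Nat.cast_le.2 (card_le_card fun x hx => ?_)
  obtain ⟨hxF, hx⟩ := mem_filter.1 hx
  refine mem_filter.2 ⟨hxF, fun a ha hxa => ?_⟩
  rcases mem_union.1 (hMA ha) with h | h
  · exact hx a (mem_inter.2 ⟨ha, h⟩) hxa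
  · obtain ⟨y, hy, rfl⟩ := mem_image.1 h
    rw [mem_singleton] at hxa
    subst hxa
    exact (mem_filter.1 hy).2.ne (hfull F hF x hxF)

/-- The two hyperedges intersect. -/
def Meets {n : ℕ} (e f : Finset (Fin n)) : Prop := (e ∩ f).Nonempty

theorem Meets.symm {n : ℕ} (e f : Finset (Fin n)) (h : Meets e f) : Meets f e := by
  rwa [Meets, inter_comm]

/-- The set recording that the edge `e` receives the colour `c`: it contains the edge `e` and all
pairs of a vertex of `e` and `c`. -/
noncomputable def colorBlock {n m : ℕ} {H : Finset (Finset (Fin n))} (e : H) (c : Fin m) :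
    Finset (H ⊕ Fin n × Fin m) :=
  insert (Sum.inl e) (e.1.image fun v => Sum.inr (v, c))

theorem inl_mem_colorBlock {n m : ℕ} {H : Finset (Finset (Fin n))} {e f : H} {c : Fin m} :
    Sum.inl f ∈ colorBlock e c ↔ f = e := by
  simp [colorBlock]

theorem inr_mem_colorBlock {n m : ℕ} {H : Finset (Finset (Fin n))} {e : H} {c d : Fin m}
    {v : Fin n} : Sum.inr (v, d) ∈ colorBlock e c ↔ v ∈ e.1 ∧ d = c := by
  simp only [colorBlock, mem_insert, reduceCtorEq, mem_image, Sum.inr.injEq, Prod.mk.injEq,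
    false_or]
  constructor
  · rintro ⟨w, hw, rfl, rfl⟩
    exact ⟨hw, rfl⟩
  · rintro ⟨hv, rfl⟩
    exact ⟨v, hv, rfl, rfl⟩

theorem card_colorBlock {n m : ℕ} {H : Finset (Finset (Fin n))} (e : H) (c : Fin m) :
    (colorBlock e c).card = e.1.card + 1 := by
  rw [colorBlock, card_insert_of_notMem (by simp), card_image_of_injective]
  intro v w h
  simpa using h

theorem colorBlock_inj {n m : ℕ} {H : Finset (Finset (Fin n))} (hne : ∀ e ∈ H, e.Nonempty)
    {e f : H} {c d : Fin m} (h : colorBlock e c = colorBlock f d) : e = f ∧ c = d := by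
  obtain ⟨v, hv⟩ := hne e.1 e.2
  have h1 : Sum.inl e ∈ colorBlock f d := h ▸ inl_mem_colorBlock.2 rfl
  have h2 : Sum.inr (v, c) ∈ colorBlock f d := h ▸ inr_mem_colorBlock.2 ⟨hv, rfl⟩
  exact ⟨inl_mem_colorBlock.1 h1, (inr_mem_colorBlock.1 h2).2⟩

theorem card_colorBlock_inter_le {n m : ℕ} {H : Finset (Finset (Fin n))} (hlin : LinearHG H)
    {e f : H} {c d : Fin m} (h : colorBlock e c ≠ colorBlock f d) :
    (colorBlock e c ∩ colorBlock f d).card ≤ 1 := by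
  by_cases hef : e = f
  · subst hef
    refine card_le_one.2 ?_
    have key : ∀ x ∈ colorBlock e c ∩ colorBlock e d, x = Sum.inl e := by
      rintro (g | ⟨v, b⟩) hx <;> rw [mem_inter] at hx
      · rw [inl_mem_colorBlock.1 hx.1]
      · rw [inr_mem_colorBlock, inr_mem_colorBlock] at hx
        exact absurd (hx.1.2 ▸ hx.2.2 ▸ rfl) h
    intro x hx y hy
    rw [key x hx, key y hy]
  · refine le_trans (card_le_card (t := (e.1 ∩ f.1).image fun v => Sum.inr (v, c)) ?_)
      (card_image_le.trans (hlin e.1 e.2 f.1 f.2 fun h => hef (Subtype.ext h)))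
    rintro (g | ⟨v, b⟩) hx <;> rw [mem_inter] at hx
    · rw [inl_mem_colorBlock, inl_mem_colorBlock] at hx
      exact absurd (hx.1.symm.trans hx.2) hef
    · rw [inr_mem_colorBlock, inr_mem_colorBlock] at hx
      exact mem_image.2 ⟨v, mem_inter.2 ⟨hx.1.1, hx.2.1⟩, by rw [hx.1.2]⟩

theorem card_filter_meets_le {n : ℕ} {H : Finset (Finset (Fin n))} {d : ℕ} (e : Finset (Fin n))
    (h : ∀ v ∈ e, degHG H v ≤ d) : (H.filter fun f => Meets e f).card ≤ e.card * d := by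
  have : H.filter (fun f => Meets e f) ⊆ e.biUnion fun v => H.filter fun f => v ∈ f := by
    intro f hf
    obtain ⟨hfH, v, hv⟩ := mem_filter.1 hf
    rw [mem_inter] at hv
    exact mem_biUnion.2 ⟨v, hv.1, mem_filter.2 ⟨hfH, hv.2⟩⟩
  exact (card_le_card this).trans (card_biUnion_le_card_mul _ _ _ h)

/-- Linear hypergraphs of rank at most `r` and maximum degree at most `D` can be coloured from
lists of size `D` except for a few edges, which use a few further colours. -/
theorem eventually_exists_list_coloring (r : ℕ) (ζ ε : ℝ) (hζ : 0 < ζ) (hε : 0 < ε) :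
    ∀ᶠ n : ℕ in Filter.atTop, ∀ (H : Finset (Finset (Fin n))) (L : Finset (Fin n) → Finset ℕ)
      (D m : ℕ), LinearHG H → (∀ e ∈ H, e.Nonempty) → (∀ e ∈ H, e.card ≤ r) → ζ * n ≤ D →
      (∀ v, degHG H v ≤ D) → D ≤ n → m ≤ n → (∀ e ∈ H, L e ⊆ range m) →
      (∀ e ∈ H, D ≤ (L e).card) →
      ∃ ψ, IsProperEC H ψ ∧ ∀ e ∈ H, ψ e ∈ L e ∨ (m ≤ ψ e ∧ (ψ e : ℝ) ≤ m + ε * n) := by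
  have hr0 : (0 : ℝ) < r + 1 := by positivity
  have hev := (tendsto_natCast_atTop_atTop (R := ℝ)).eventually
    (eventually_exists_matching_of_degree (r + 1) (by omega) ζ (ε / (r + 1)) hζ (by positivity))
  filter_upwards [hev, Filter.eventually_ge_atTop 2] with n hn hn2
  intro H L D m hlin hne hr hζD hdeg hDn hmn hL hLD
  have hL' : ∀ e : H, ∃ l : Finset (Fin m), l.card = D ∧ ∀ c ∈ l, (c : ℕ) ∈ L e := by
    intro e
    have h1 : ((L e).attachFin fun c hc => mem_range.1 (hL e e.2 hc)).card = (L e).card :=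
      card_attachFin _ _
    obtain ⟨l, hl, hlc⟩ := exists_subset_card_eq (h1 ▸ hLD e e.2)
    exact ⟨l, hlc, fun c hc => (mem_attachFin _).1 (hl hc)⟩
  choose l hlc hl using hL'
  set A : Finset (Finset (H ⊕ Fin n × Fin m)) :=
    univ.biUnion fun e : H => (l e).image (colorBlock e) with hA
  have hAmem : ∀ a ∈ A, ∃ e : H, ∃ c ∈ l e, colorBlock e c = a := by
    intro a ha
    obtain ⟨e, -, he⟩ := mem_biUnion.1 ha
    obtain ⟨c, hc, h⟩ := mem_image.1 he
    exact ⟨e, c, hc, h⟩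
  have hdegl : ∀ e : H, (A.filter (Sum.inl e ∈ ·)).card = D := by
    intro e
    have : A.filter (Sum.inl e ∈ ·) = (l e).image (colorBlock e) := by
      ext a
      constructor
      · intro ha
        obtain ⟨ha, hea⟩ := mem_filter.1 ha
        obtain ⟨f, c, hc, rfl⟩ := hAmem a ha
        rw [inl_mem_colorBlock] at hea
        subst hea
        exact mem_image_of_mem _ hc
      · intro ha
        refine mem_filter.2 ⟨mem_biUnion.2 ⟨e, mem_univ _, ha⟩, ?_⟩
        obtain ⟨c, hc, rfl⟩ := mem_image.1 ha
        exact inl_mem_colorBlock.2 rfl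
    rw [this, card_image_of_injective _ fun c d h => (colorBlock_inj hne h).2, hlc]
  have hHc : H.card ≤ n * n := by
    have h := card_filter_meets_le (H := H) (d := D) univ fun v _ => hdeg v
    rw [filter_true_of_mem fun e he => by simpa [Meets] using hne e he] at h
    refine h.trans ?_
    simp only [card_univ, Fintype.card_fin]
    exact Nat.mul_le_mul_left _ hDn
  have hn2' : (2 : ℝ) ≤ n := by exact_mod_cast hn2
  have hn4 : (n : ℝ) * n + n * n ≤ n ^ 4 := by
    nlinarith [mul_le_mul hn2' hn2' (by norm_num) (by positivity)]
  obtain ⟨M, hMA, hMd, hMF⟩ := hn A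
    (univ.image fun v : Fin n => (univ.filter fun e : H => v ∈ e.1).image Sum.inl) D (by
      intro a ha b hb hab
      obtain ⟨e, c, hc, rfl⟩ := hAmem a ha
      obtain ⟨f, d, hd, rfl⟩ := hAmem b hb
      exact card_colorBlock_inter_le hlin hab) (by
      intro a ha
      obtain ⟨e, c, hc, rfl⟩ := hAmem a ha
      have := card_pos.2 (hne e.1 e.2)
      rw [card_colorBlock]
      omega) (by
      intro a ha
      obtain ⟨e, c, hc, rfl⟩ := hAmem a ha
      rw [card_colorBlock]
      exact Nat.succ_le_succ (hr e.1 e.2)) hζD (by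
      rintro (e | ⟨v, c⟩)
      · exact (hdegl e).le
      · refine le_trans ?_ (hdeg v)
        refine card_le_card_of_forall_subsingleton
          (fun a f => ∃ hf : f ∈ H, a = colorBlock ⟨f, hf⟩ c) ?_ ?_
        · intro a ha
          obtain ⟨ha, hva⟩ := mem_filter.1 ha
          obtain ⟨e, d, hd, rfl⟩ := hAmem a ha
          obtain ⟨hve, rfl⟩ := inr_mem_colorBlock.1 hva
          exact ⟨e.1, mem_filter.2 ⟨e.2, hve⟩, e.2, rfl⟩
        · rintro f - a ⟨-, _, ha⟩ b ⟨-, _, hb⟩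
          rw [ha, hb]) (by
      intro F hF x hx
      obtain ⟨v, -, rfl⟩ := mem_image.1 hF
      obtain ⟨e, -, rfl⟩ := mem_image.1 hx
      exact hdegl e) (by
      intro F hF
      obtain ⟨v, -, rfl⟩ := mem_image.1 hF
      refine Nat.cast_le.2 (card_image_le.trans ((le_trans ?_ (hdeg v)).trans hDn))
      refine card_le_card_of_injOn (fun e : H => e.1) ?_ (Subtype.val_injective.injOn)
      intro e he
      simp only [coe_filter, mem_univ, true_and, Set.mem_ofPred_eq] at he
      simp [he]) (by
      simp only [Fintype.card_sum, Fintype.card_prod, Fintype.card_fin, Fintype.card_coe]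
      push_cast
      refine le_trans (add_le_add ?_ ?_) hn4
      · exact_mod_cast hHc
      · exact_mod_cast Nat.mul_le_mul_left _ hmn) (by
      refine le_trans (Nat.cast_le.2 card_image_le) ?_
      simp only [card_univ, Fintype.card_fin]
      nlinarith)
  set U : Finset (Finset (Fin n)) :=
    H.filter fun e => ∀ he : e ∈ H, ∀ a ∈ M, Sum.inl ⟨e, he⟩ ∉ a with hU
  have hUdeg : ∀ v, (degHG U v : ℝ) ≤ ε / (r + 1) * n := by
    intro v
    refine le_trans (Nat.cast_le.2 ?_) (hMF _ (mem_image_of_mem _ (mem_univ v)))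
    refine card_le_card_of_forall_subsingleton
      (fun e x => ∃ he : e ∈ H, x = Sum.inl ⟨e, he⟩) ?_ ?_
    · intro e he
      obtain ⟨he, hve⟩ := mem_filter.1 he
      obtain ⟨heH, heM⟩ := mem_filter.1 he
      refine ⟨Sum.inl ⟨e, heH⟩, ?_, heH, rfl⟩
      simp only [mem_filter]
      exact ⟨mem_image_of_mem _ (mem_filter.2 ⟨mem_univ _, hve⟩), heM heH⟩
    · rintro x - e ⟨-, he, rfl⟩ f ⟨-, hf, h⟩
      simpa using h
  have hcol : ∀ e ∈ H, e ∉ U → ∃ he : e ∈ H, ∃ c ∈ l ⟨e, he⟩, colorBlock ⟨e, he⟩ c ∈ M := by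
    intro e he heU
    obtain ⟨a, ha, hea⟩ : ∃ a ∈ M, Sum.inl ⟨e, he⟩ ∈ a := by
      by_contra! h
      exact heU (mem_filter.2 ⟨he, fun _ => h⟩)
    obtain ⟨f, c, hc, rfl⟩ := hAmem a (hMA ha)
    rw [inl_mem_colorBlock] at hea
    subst hea
    exact ⟨he, c, hc, ha⟩
  set d : ℕ := ⌊ε / (r + 1) * n⌋₊ with hd
  have hUd : ∀ v, degHG U v ≤ d := fun v => Nat.le_floor (hUdeg v)
  obtain ⟨χ, hχL, hχ⟩ := exists_isListColoring_of_card_lt (adj := Meets) Meets.symm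
    (fun _ => Ico m (m + (r * d + 1))) U (by
      intro e he
      rw [Nat.card_Ico, Nat.add_sub_cancel_left, Nat.lt_succ_iff]
      refine le_trans (card_le_card ?_) ((card_filter_meets_le e fun v _ => hUd v).trans
        (Nat.mul_le_mul_right _ (hr e (mem_filter.1 he).1)))
      intro f hf
      rw [mem_filter] at hf ⊢
      exact ⟨hf.1, hf.2.2⟩)
  choose! hcolH c hc hcM using hcol
  let ψ : Finset (Fin n) → ℕ := fun e =>
    if h : e ∈ H ∧ e ∉ U then c e h.1 h.2 else χ e
  have hψ₁ : ∀ e, ∀ (h : e ∈ H) (h' : e ∉ U), ψ e = c e h h' := fun e h h' => dif_pos ⟨h, h'⟩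
  have hψ₂ : ∀ e ∈ U, ψ e = χ e := fun e h => dif_neg fun h' => h'.2 h
  have hd' : (r * d : ℝ) ≤ ε * n := by
    have h1 : (d : ℝ) ≤ ε / (r + 1) * n := Nat.floor_le (by positivity)
    calc (r * d : ℝ) ≤ (r + 1) * (ε / (r + 1) * n) := by
          refine mul_le_mul (by linarith) h1 (by positivity) (by positivity)
      _ = ε * n := by field_simp
  refine ⟨ψ, ?_, fun e he => ?_⟩
  · intro e he f hf hef hmeet
    by_cases heU : e ∈ U <;> by_cases hfU : f ∈ U
    · rw [hψ₂ e heU, hψ₂ f hfU]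
      exact hχ e heU f hfU hef hmeet
    · rw [hψ₂ e heU, hψ₁ f hf hfU]
      have := mem_Ico.1 (hχL e heU)
      have := (c f hf hfU).2
      omega
    · rw [hψ₁ e he heU, hψ₂ f hfU]
      have := mem_Ico.1 (hχL f hfU)
      have := (c e he heU).2
      omega
    · rw [hψ₁ e he heU, hψ₁ f hf hfU]
      intro h
      obtain ⟨v, hv⟩ := hmeet
      rw [mem_inter] at hv
      have h1 := hcM e he heU
      have h2 := hcM f hf hfU
      by_cases hab : colorBlock ⟨e, hcolH e he heU⟩ (c e he heU) =
        colorBlock ⟨f, hcolH f hf hfU⟩ (c f hf hfU)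
      · exact hef (congrArg Subtype.val (colorBlock_inj hne hab).1)
      · exact disjoint_left.1 (hMd _ h1 _ h2 hab) (inr_mem_colorBlock.2 ⟨hv.1, rfl⟩)
          (inr_mem_colorBlock.2 ⟨hv.2, Fin.ext h⟩)
  · by_cases heU : e ∈ U
    · rw [hψ₂ e heU]
      have := mem_Ico.1 (hχL e heU)
      refine Or.inr ⟨this.1, ?_⟩
      have h2 : χ e ≤ m + r * d := by omega
      have h3 : (χ e : ℝ) ≤ m + r * d := by exact_mod_cast h2
      linarith
    · rw [hψ₁ e he heU]
      exact Or.inl (hl _ _ (hc e he heU))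

section PartialColoring

variable {W : Type*} [Fintype W] (G : SimpleGraph W) (L : W → Finset ℕ) (Z : W → Option ℕ)

/-- The neighbours of `e`. -/
noncomputable def nbrs (e : W) : Finset W := univ.filter (G.Adj e)

/-- The colours appearing on the neighbours of `e`. -/
noncomputable def seenColors (e : W) : Finset ℕ := (nbrs G e).biUnion fun f => (Z f).toFinset

/-- The colours still available at `e`. -/
noncomputable def availColors (e : W) : Finset ℕ := L e \ seenColors G Z e

/-- The uncoloured neighbours of `e`. -/
noncomputable def openNbrs (e : W) : Finset W := (nbrs G e).filter (Z · = none)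

/-- The coloured neighbours of `e`. -/
noncomputable def doneNbrs (e : W) : Finset W := (nbrs G e).filter (Z · ≠ none)

/-- The number of pairs of an uncoloured neighbour `f` of `e` and a colour available at `f` that
already appears around `e`. -/
noncomputable def repeatPairs (e : W) : ℕ :=
  ∑ f ∈ openNbrs G Z e, (availColors G L Z f ∩ seenColors G Z e).card

variable {G L Z}

theorem mem_nbrs {e f : W} : f ∈ nbrs G e ↔ G.Adj e f := by simp [nbrs]

theorem mem_seenColors {e : W} {c : ℕ} :
    c ∈ seenColors G Z e ↔ ∃ f, G.Adj e f ∧ Z f = some c := by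
  simp [seenColors, mem_nbrs]

theorem mem_openNbrs {e f : W} : f ∈ openNbrs G Z e ↔ G.Adj e f ∧ Z f = none := by
  simp [openNbrs, mem_nbrs]

theorem card_openNbrs_add_card_doneNbrs (e : W) :
    (openNbrs G Z e).card + (doneNbrs G Z e).card = (nbrs G e).card :=
  card_filter_add_card_filter_not _

theorem card_seenColors_le (e : W) : (seenColors G Z e).card ≤ (doneNbrs G Z e).card := by
  have : seenColors G Z e ⊆ (doneNbrs G Z e).image fun f => (Z f).getD 0 := by
    intro c hc
    obtain ⟨f, hf, hfc⟩ := mem_seenColors.1 hc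
    exact mem_image.2 ⟨f, mem_filter.2 ⟨mem_nbrs.2 hf, by simp [hfc]⟩, by simp [hfc]⟩
  exact (card_le_card this).trans card_image_le

variable {f : W} {c : ℕ}

theorem seenColors_update (hf : Z f = none) (e : W) :
    seenColors G (Function.update Z f (some c)) e =
    if G.Adj e f then insert c (seenColors G Z e) else seenColors G Z e := by
  ext d
  have key : d ∈ seenColors G (Function.update Z f (some c)) e ↔
      (G.Adj e f ∧ d = c) ∨ d ∈ seenColors G Z e := by
    rw [mem_seenColors, mem_seenColors]
    constructor
    · rintro ⟨g, hg, hgd⟩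
      rcases eq_or_ne g f with rfl | hgf
      · rw [Function.update_self] at hgd
        exact Or.inl ⟨hg, (Option.some.inj hgd).symm⟩
      · rw [Function.update_of_ne hgf] at hgd
        exact Or.inr ⟨g, hg, hgd⟩
    · rintro (⟨h, rfl⟩ | ⟨g, hg, hgd⟩)
      · exact ⟨f, h, Function.update_self ..⟩
      · refine ⟨g, hg, ?_⟩
        rw [Function.update_of_ne, hgd]
        rintro rfl
        simp [hf] at hgd
  rw [key]
  split_ifs with h <;> simp [h]

theorem openNbrs_update (e : W) :
    openNbrs G (Function.update Z f (some c)) e = (openNbrs G Z e).erase f := by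
  ext g
  rw [mem_erase, mem_openNbrs, mem_openNbrs]
  rcases eq_or_ne g f with rfl | hgf
  · simp
  · simp [hgf]

theorem card_doneNbrs_update (hf : Z f = none) (e : W) :
    (doneNbrs G (Function.update Z f (some c)) e).card =
      (doneNbrs G Z e).card + if G.Adj e f then 1 else 0 := by
  have h1 := card_openNbrs_add_card_doneNbrs (G := G) (Z := Z) e
  have h2 := card_openNbrs_add_card_doneNbrs (G := G) (Z := Function.update Z f (some c)) e
  rw [openNbrs_update] at h2
  split_ifs with h
  · have h3 : f ∈ openNbrs G Z e := mem_openNbrs.2 ⟨h, hf⟩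
    have := card_erase_add_one h3
    omega
  · have h3 : f ∉ openNbrs G Z e := fun h' => h (mem_openNbrs.1 h').1
    rw [erase_eq_of_notMem h3] at h2
    omega

theorem card_inter_le_update (hf : Z f = none) (e g : W) :
    (availColors G L Z g ∩ seenColors G Z e).card +
      (if G.Adj e f ∧ c ∉ seenColors G Z e ∧ ¬G.Adj f g ∧ c ∈ availColors G L Z g then 1 else 0) ≤
    (availColors G L (Function.update Z f (some c)) g ∩
      seenColors G (Function.update Z f (some c)) e).card +
      (if G.Adj f g ∧ c ∈ availColors G L Z g ∩ seenColors G Z e then 1 else 0) := by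
  have hB : seenColors G Z e ⊆ seenColors G (Function.update Z f (some c)) e := by
    rw [seenColors_update hf]
    split_ifs
    · exact subset_insert _ _
    · exact Subset.rfl
  by_cases hfg : G.Adj f g
  · rw [if_neg (by tauto)]
    have hA : availColors G L (Function.update Z f (some c)) g = (availColors G L Z g).erase c := by
      rw [availColors, seenColors_update hf, if_pos hfg.symm, availColors, erase_eq, insert_eq,
        union_comm, sdiff_union_distrib]
      ext d
      simp only [mem_inter, mem_sdiff]
      tauto
    have hsub : (availColors G L Z g ∩ seenColors G Z e).erase c ⊆
        availColors G L (Function.update Z f (some c)) g ∩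
          seenColors G (Function.update Z f (some c)) e := by
      intro d hd
      rw [mem_erase, mem_inter] at hd
      rw [mem_inter, hA, mem_erase]
      exact ⟨⟨hd.1, hd.2.1⟩, hB hd.2.2⟩
    have := card_le_card hsub
    rw [card_erase_eq_ite] at this
    split_ifs at this ⊢ <;> first | omega | tauto
  · have hA : availColors G L (Function.update Z f (some c)) g = availColors G L Z g := by
      rw [availColors, seenColors_update hf, if_neg fun h => hfg h.symm, availColors]
    rw [if_neg (fun h : G.Adj f g ∧ _ => hfg h.1), hA]
    split_ifs with h
    · rw [seenColors_update hf, if_pos h.1, inter_insert_of_mem h.2.2.2, card_insert_of_notMem]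
      exact fun h' => h.2.1 (mem_inter.1 h').2
    · exact card_le_card (inter_subset_inter_left hB)

theorem repeatPairs_le_update (hf : Z f = none) (e : W) :
    repeatPairs G L Z e + (if G.Adj e f ∧ c ∉ seenColors G Z e then
      ((openNbrs G Z e).filter fun g => g ≠ f ∧ ¬G.Adj f g ∧ c ∈ availColors G L Z g).card
        else 0) ≤
    repeatPairs G L (Function.update Z f (some c)) e +
      (if G.Adj e f then (availColors G L Z f ∩ seenColors G Z e).card else 0) +
      ((openNbrs G Z e).filter fun g =>
        G.Adj f g ∧ c ∈ availColors G L Z g ∩ seenColors G Z e).card := by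
  have h1 : repeatPairs G L Z e ≤ ∑ g ∈ (openNbrs G Z e).erase f,
      (availColors G L Z g ∩ seenColors G Z e).card +
      (if G.Adj e f then (availColors G L Z f ∩ seenColors G Z e).card else 0) := by
    rw [repeatPairs]
    split_ifs with h
    · rw [sum_erase_add _ _ (mem_openNbrs.2 ⟨h, hf⟩)]
    · rw [erase_eq_of_notMem fun h' => h (mem_openNbrs.1 h').1, add_zero]
  have h2 := sum_le_sum fun g (_ : g ∈ (openNbrs G Z e).erase f) =>
    card_inter_le_update (G := G) (L := L) (c := c) hf e g
  rw [sum_add_distrib, sum_add_distrib, ← card_filter, ← card_filter] at h2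
  have h3 : repeatPairs G L (Function.update Z f (some c)) e = ∑ g ∈ (openNbrs G Z e).erase f,
      (availColors G L (Function.update Z f (some c)) g ∩
      seenColors G (Function.update Z f (some c)) e).card := by
    rw [repeatPairs, openNbrs_update]
  have h4 : (((openNbrs G Z e).erase f).filter fun g =>
      G.Adj f g ∧ c ∈ availColors G L Z g ∩ seenColors G Z e).card ≤
      ((openNbrs G Z e).filter fun g =>
        G.Adj f g ∧ c ∈ availColors G L Z g ∩ seenColors G Z e).card :=
    card_le_card (filter_subset_filter _ (erase_subset _ _))
  have h5 : (if G.Adj e f ∧ c ∉ seenColors G Z e then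
      ((openNbrs G Z e).filter fun g => g ≠ f ∧ ¬G.Adj f g ∧ c ∈ availColors G L Z g).card
        else 0) ≤ (((openNbrs G Z e).erase f).filter fun g =>
      G.Adj e f ∧ c ∉ seenColors G Z e ∧ ¬G.Adj f g ∧ c ∈ availColors G L Z g).card := by
    split_ifs with h
    · refine card_le_card fun g hg => ?_
      rw [mem_filter] at hg
      rw [mem_filter, mem_erase]
      exact ⟨⟨hg.2.1, hg.1⟩, h.1, h.2, hg.2.2⟩
    · exact Nat.zero_le _
  omega

end PartialColoring

section Drift

variable {W : Type*} [Fintype W] (G : SimpleGraph W) (L : W → Finset ℕ) (Z : W → Option ℕ)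

/-- The new repeated pairs created around `e` when `f` receives the colour `c`. -/
noncomputable def newPairs (e f : W) (c : ℕ) : ℕ := if G.Adj e f ∧ c ∉ seenColors G Z e then
  ((openNbrs G Z e).filter fun g => g ≠ f ∧ ¬G.Adj f g ∧ c ∈ availColors G L Z g).card else 0

/-- The repeated pairs around `e` that involve `f`. -/
noncomputable def ownPairs (e f : W) : ℕ :=
  if G.Adj e f then (availColors G L Z f ∩ seenColors G Z e).card else 0

/-- The repeated pairs around `e` destroyed at the neighbours of `f` when `f` receives the
colour `c`. -/
noncomputable def lostPairs (e f : W) (c : ℕ) : ℕ := ((openNbrs G Z e).filter fun g =>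
  G.Adj f g ∧ c ∈ availColors G L Z g ∩ seenColors G Z e).card

/-- A lower bound for the increase of the potential of `e` when `f` receives the colour `c`. -/
noncomputable def stepBound (θ : ℝ) (e f : W) (c : ℕ) : ℝ :=
  (if G.Adj e f ∧ c ∈ seenColors G Z e then 1 else 0) +
    θ * (newPairs G L Z e f c - ownPairs G L Z e f - lostPairs G L Z e f c)

variable {G L Z} {C : ℕ} {n T δ θ : ℝ} {e : W}

theorem sum_adj_sum_eq (e : W) (F : W → ℝ) :
    ∑ f with Z f = none, (if G.Adj e f then F f else 0) = ∑ f ∈ openNbrs G Z e, F f := by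
  rw [← sum_filter, filter_filter]
  refine sum_congr ?_ fun _ _ => rfl
  ext f
  rw [mem_openNbrs, mem_filter]
  simp [and_comm]

theorem sum_first_repeat (e : W) :
    ∑ f with Z f = none, ∑ c ∈ availColors G L Z f,
      (if G.Adj e f ∧ c ∈ seenColors G Z e then (1 : ℝ) else 0) = repeatPairs G L Z e := by
  rw [repeatPairs, Nat.cast_sum, ← sum_adj_sum_eq]
  refine sum_congr rfl fun f _ => ?_
  split_ifs with h
  · simp [h, ← filter_mem_eq_inter]
  · simp [h]

theorem card_availColors_le (hL : ∀ f, L f ⊆ range C) (hC : (C : ℝ) ≤ n) (f : W) :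
    ((availColors G L Z f).card : ℝ) ≤ n := by
  have : availColors G L Z f ⊆ range C := sdiff_subset.trans (hL f)
  have := card_le_card this
  rw [card_range] at this
  exact le_trans (Nat.cast_le.2 this) hC

theorem sum_adj_le (hL : ∀ f, L f ⊆ range C) (hC : (C : ℝ) ≤ n)
    (hdeg : ∀ f, ((nbrs G f).card : ℝ) ≤ 2 * n) (e : W) :
    ∑ f with Z f = none, ∑ _c ∈ availColors G L Z f, (if G.Adj e f then (1 : ℝ) else 0) ≤
      2 * n ^ 2 := by
  have h1 : ∀ f, ∑ _c ∈ availColors G L Z f, (if G.Adj e f then (1 : ℝ) else 0) ≤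
      if G.Adj e f then n else 0 := by
    intro f
    split_ifs
    · simpa using card_availColors_le hL hC f
    · simp
  refine (sum_le_sum fun f _ => h1 f).trans ?_
  rw [sum_adj_sum_eq e fun _ => n, sum_const, nsmul_eq_mul]
  have h2 : ((openNbrs G Z e).card : ℝ) ≤ (nbrs G e).card :=
    Nat.cast_le.2 (card_le_card (filter_subset _ _))
  nlinarith [hdeg e]

theorem sum_ownPairs_le (hL : ∀ f, L f ⊆ range C) (hC : (C : ℝ) ≤ n) (hn : 0 < n) (hT : 0 < T)
    (hdeg : ∀ f, ((nbrs G f).card : ℝ) ≤ 2 * n)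
    (hdone : ((doneNbrs G Z e).card : ℝ) ≤ 5 * T * n) :
    ∑ f with Z f = none, ∑ _c ∈ availColors G L Z f, (ownPairs G L Z e f : ℝ) ≤
      10 * T * n ^ 3 := by
  have hseen : ((seenColors G Z e).card : ℝ) ≤ 5 * T * n :=
    le_trans (Nat.cast_le.2 (card_seenColors_le e)) hdone
  have h1 : ∀ f, ∑ _c ∈ availColors G L Z f, (ownPairs G L Z e f : ℝ) ≤
      5 * T * n * ∑ _c ∈ availColors G L Z f, (if G.Adj e f then (1 : ℝ) else 0) := by
    intro f
    rw [mul_sum]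
    refine sum_le_sum fun c _ => ?_
    rw [ownPairs]
    split_ifs
    · rw [mul_one]
      exact le_trans (Nat.cast_le.2 (card_le_card inter_subset_right)) hseen
    · simp
  refine (sum_le_sum fun f _ => h1 f).trans ?_
  rw [← mul_sum]
  have := mul_le_mul_of_nonneg_left (sum_adj_le (Z := Z) hL hC hdeg e)
    (by positivity : 0 ≤ 5 * T * n)
  nlinarith

theorem sum_lostPairs_le (hn : 0 < n) (hT : 0 < T)
    (hdeg : ∀ f, ((nbrs G f).card : ℝ) ≤ 2 * n)
    (hdone : ((doneNbrs G Z e).card : ℝ) ≤ 5 * T * n) :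
    ∑ f with Z f = none, ∑ c ∈ availColors G L Z f, (lostPairs G L Z e f c : ℝ) ≤
      20 * T * n ^ 3 := by
  have hseen : ((seenColors G Z e).card : ℝ) ≤ 5 * T * n :=
    le_trans (Nat.cast_le.2 (card_seenColors_le e)) hdone
  have h1 : ∀ f, ∑ c ∈ availColors G L Z f, (lostPairs G L Z e f c : ℝ) ≤
      ∑ g ∈ openNbrs G Z e, (if G.Adj g f then 5 * T * n else 0) := by
    intro f
    simp only [lostPairs, card_filter, Nat.cast_sum]
    rw [sum_comm]
    refine sum_le_sum fun g _ => ?_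
    split_ifs with h
    · refine le_trans ?_ hseen
      push_cast
      rw [← sum_filter, sum_const, nsmul_eq_mul, mul_one]
      refine Nat.cast_le.2 (card_le_card fun c hc => ?_)
      exact (mem_inter.1 (mem_filter.1 hc).2.2).2
    · have h' : ¬G.Adj f g := fun h' => h h'.symm
      simp [h']
  refine (sum_le_sum fun f _ => h1 f).trans ?_
  rw [sum_comm]
  have h2 : ∀ g, ∑ f with Z f = none, (if G.Adj g f then 5 * T * n else 0) ≤ 10 * T * n ^ 2 := by
    intro g
    rw [sum_adj_sum_eq g fun _ => 5 * T * n, sum_const, nsmul_eq_mul]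
    have h3 : ((openNbrs G Z g).card : ℝ) ≤ (nbrs G g).card :=
      Nat.cast_le.2 (card_le_card (filter_subset _ _))
    have := mul_le_mul_of_nonneg_right (h3.trans (hdeg g)) (by positivity : 0 ≤ 5 * T * n)
    nlinarith
  refine (sum_le_sum fun g _ => h2 g).trans ?_
  rw [sum_const, nsmul_eq_mul]
  have h3 : ((openNbrs G Z e).card : ℝ) ≤ (nbrs G e).card :=
    Nat.cast_le.2 (card_le_card (filter_subset _ _))
  have := mul_le_mul_of_nonneg_right (h3.trans (hdeg e)) (by positivity : 0 ≤ 10 * T * n ^ 2)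
  nlinarith

theorem le_sum_newPairs (hL : ∀ f, L f ⊆ range C) (hC : (C : ℝ) ≤ n) (hn : 0 < n)
    (hδ : 0 < δ) (hδ1 : δ ≤ 1) (hTδ : T ≤ δ / 480) (hLc : ∀ f, 15 / 16 * n ≤ (L f).card)
    (hdone : ∀ f, Z f = none → ((doneNbrs G Z f).card : ℝ) ≤ 5 * T * n)
    (he : Z e = none) (hdense : 15 / 16 * n ≤ (nbrs G e).card)
    (hsparse : ∀ f ∈ nbrs G e,
      δ * n ≤ ((nbrs G e).filter fun g => g ≠ f ∧ ¬G.Adj f g).card) :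
    δ / 8 * n ^ 3 ≤
      ∑ f with Z f = none, ∑ c ∈ availColors G L Z f, (newPairs G L Z e f c : ℝ) := by
  have hseen : ∀ f, Z f = none → ((seenColors G Z f).card : ℝ) ≤ 5 * T * n := fun f hf =>
    le_trans (Nat.cast_le.2 (card_seenColors_le f)) (hdone f hf)
  have havail : ∀ f, Z f = none → 15 / 16 * n - 5 * T * n ≤ (availColors G L Z f).card := by
    intro f hf
    have h1 : (L f).card ≤ (availColors G L Z f).card + (seenColors G Z f).card := by
      have := le_card_sdiff (seenColors G Z f) (L f)
      rw [availColors]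
      omega
    have h2 : ((L f).card : ℝ) ≤ (availColors G L Z f).card + (seenColors G Z f).card := by
      exact_mod_cast h1
    linarith [hLc f, hseen f hf]
  have hpair : ∀ f g, Z f = none → Z g = none → n / 2 ≤
      (((availColors G L Z f \ seenColors G Z e).filter (· ∈ availColors G L Z g)).card : ℝ) := by
    intro f g hf hg
    have h1 : (availColors G L Z f ∩ availColors G L Z g).card ≤
        ((availColors G L Z f \ seenColors G Z e).filter (· ∈ availColors G L Z g)).card +
          (seenColors G Z e).card := by
      refine (card_le_card fun c hc => ?_).trans (card_union_le _ _)
      rw [mem_inter] at hc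
      rw [mem_union, mem_filter, mem_sdiff]
      tauto
    have h2 : (availColors G L Z f ∪ availColors G L Z g).card ≤ C := by
      rw [← card_range C]
      exact card_le_card (union_subset (sdiff_subset.trans (hL f)) (sdiff_subset.trans (hL g)))
    have h3 := card_union_add_card_inter (availColors G L Z f) (availColors G L Z g)
    have h4 : ((availColors G L Z f).card : ℝ) + (availColors G L Z g).card ≤ C +
        (((availColors G L Z f \ seenColors G Z e).filter (· ∈ availColors G L Z g)).card +
          (seenColors G Z e).card) := by exact_mod_cast (by omega)
    have := havail f hf
    have := havail g hg
    have := hseen e he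
    nlinarith
  have hopen : (nbrs G e).card ≤ (openNbrs G Z e).card + (5 * T * n) := by
    rw [← card_openNbrs_add_card_doneNbrs (Z := Z) e]
    push_cast
    linarith [hdone e he]
  have hopen' : ∀ f ∈ nbrs G e, δ * n / 2 ≤
      ((openNbrs G Z e).filter fun g => g ≠ f ∧ ¬G.Adj f g).card := by
    intro f hf
    have h1 : ((nbrs G e).filter fun g => g ≠ f ∧ ¬G.Adj f g).card ≤
        ((openNbrs G Z e).filter fun g => g ≠ f ∧ ¬G.Adj f g).card + (doneNbrs G Z e).card := by
      refine (card_le_card fun g hg => ?_).trans (card_union_le _ _)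
      rw [mem_filter] at hg
      rw [mem_union, mem_filter, openNbrs, doneNbrs, mem_filter, mem_filter]
      tauto
    have h2 : ((((nbrs G e).filter fun g => g ≠ f ∧ ¬G.Adj f g).card : ℕ) : ℝ) ≤
        ((openNbrs G Z e).filter fun g => g ≠ f ∧ ¬G.Adj f g).card + (doneNbrs G Z e).card := by
      exact_mod_cast h1
    have := hsparse f hf
    have := hdone e he
    nlinarith
  have h1 : ∀ f ∈ openNbrs G Z e, δ * n / 2 * (n / 2) ≤
      ∑ c ∈ availColors G L Z f, (newPairs G L Z e f c : ℝ) := by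
    intro f hf
    obtain ⟨hef, hf0⟩ := mem_openNbrs.1 hf
    have h2 : ∑ c ∈ availColors G L Z f, (newPairs G L Z e f c : ℝ) =
        ∑ g ∈ (openNbrs G Z e).filter (fun g => g ≠ f ∧ ¬G.Adj f g),
          (((availColors G L Z f \ seenColors G Z e).filter
            (· ∈ availColors G L Z g)).card : ℝ) := by
      simp only [newPairs, hef, true_and]
      rw [← Nat.cast_sum, ← sum_filter, ← Nat.cast_sum, ← sdiff_eq_filter]
      have h3 := sum_card_bipartiteAbove_eq_sum_card_bipartiteBelow
        (s := availColors G L Z f \ seenColors G Z e)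
        (t := (openNbrs G Z e).filter fun g => g ≠ f ∧ ¬G.Adj f g)
        fun c g => c ∈ availColors G L Z g
      simp only [bipartiteAbove, bipartiteBelow, filter_filter, and_assoc] at h3
      exact_mod_cast h3
    rw [h2]
    refine le_trans ?_ (card_nsmul_le_sum _ _ (n / 2) fun g hg =>
      hpair f g hf0 (mem_openNbrs.1 (mem_filter.1 hg).1).2)
    rw [nsmul_eq_mul]
    exact mul_le_mul_of_nonneg_right (hopen' f (mem_nbrs.2 hef)) (by positivity)
  have h2 : ∑ f ∈ openNbrs G Z e, ∑ c ∈ availColors G L Z f, (newPairs G L Z e f c : ℝ) ≤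
      ∑ f with Z f = none, ∑ c ∈ availColors G L Z f, (newPairs G L Z e f c : ℝ) :=
    sum_le_sum_of_subset_of_nonneg (fun f hf => mem_filter.2 ⟨mem_univ _, (mem_openNbrs.1 hf).2⟩)
      fun f _ _ => sum_nonneg fun c _ => Nat.cast_nonneg _
  refine le_trans ?_ h2
  refine le_trans ?_ (card_nsmul_le_sum _ _ _ h1)
  rw [nsmul_eq_mul]
  have h3 : n / 2 ≤ (openNbrs G Z e).card := by nlinarith
  have := mul_le_mul_of_nonneg_right h3 (by positivity : 0 ≤ δ * n / 2 * (n / 2))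
  nlinarith

theorem le_sum_stepBound (hL : ∀ f, L f ⊆ range C) (hC : (C : ℝ) ≤ n) (hn : 0 < n) (hT : 0 < T)
    (hδ : 0 < δ) (hδ1 : δ ≤ 1) (hTδ : T ≤ δ / 480) (hLc : ∀ f, 15 / 16 * n ≤ (L f).card)
    (hdeg : ∀ f, ((nbrs G f).card : ℝ) ≤ 2 * n)
    (hdone : ∀ f, Z f = none → ((doneNbrs G Z f).card : ℝ) ≤ 5 * T * n)
    (he : Z e = none) (hdense : 15 / 16 * n ≤ (nbrs G e).card)
    (hsparse : ∀ f ∈ nbrs G e,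
      δ * n ≤ ((nbrs G e).filter fun g => g ≠ f ∧ ¬G.Adj f g).card) (hθ : 0 ≤ θ) :
    repeatPairs G L Z e + θ * (δ / 16 * n ^ 3) ≤
      ∑ f with Z f = none, ∑ c ∈ availColors G L Z f, stepBound G L Z θ e f c := by
  simp only [stepBound, sum_add_distrib, ← mul_sum, sum_sub_distrib, sum_first_repeat]
  have h1 := le_sum_newPairs hL hC hn hδ hδ1 hTδ hLc hdone he hdense hsparse
  have h2 := sum_ownPairs_le (L := L) hL hC hn hT hdeg (hdone e he)
  have h3 := sum_lostPairs_le (L := L) hn hT hdeg (hdone e he)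
  have h4 : T * n ^ 3 ≤ δ / 480 * n ^ 3 := by gcongr
  gcongr
  linarith

theorem abs_stepBound_le (hL : ∀ f, L f ⊆ range C) (hC : (C : ℝ) ≤ n) (hn : 0 < n)
    (hT : T ≤ 1 / 480) (hdeg : ∀ f, ((nbrs G f).card : ℝ) ≤ 2 * n) (hθ : 0 ≤ θ) (hθn : θ * n ≤ T)
    (f : W) (c : ℕ) :
    |stepBound G L Z θ e f c| ≤ 2 ∧
    stepBound G L Z θ e f c ^ 2 ≤
      8 * (if G.Adj e f then 1 else 0) + 4 * θ * lostPairs G L Z e f c := by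
  have hcard : ((openNbrs G Z e).card : ℝ) ≤ 2 * n :=
    le_trans (Nat.cast_le.2 (card_le_card (filter_subset _ _))) (hdeg e)
  have hx0 : (0 : ℝ) ≤ lostPairs G L Z e f c := Nat.cast_nonneg _
  have hx : (lostPairs G L Z e f c : ℝ) ≤ 2 * n :=
    le_trans (Nat.cast_le.2 (card_le_card (filter_subset _ _))) hcard
  have hy0 : (0 : ℝ) ≤ newPairs G L Z e f c := Nat.cast_nonneg _
  have ha0 : (0 : ℝ) ≤ ownPairs G L Z e f := Nat.cast_nonneg _
  have hθx0 : 0 ≤ θ * lostPairs G L Z e f c := by positivity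
  have hθx : θ * lostPairs G L Z e f c ≤ 2 * T := by
    nlinarith [mul_le_mul_of_nonneg_left hx hθ]
  have hθy0 : 0 ≤ θ * newPairs G L Z e f c := by positivity
  have hθa0 : 0 ≤ θ * ownPairs G L Z e f := by positivity
  rw [stepBound, mul_sub, mul_sub]
  by_cases h : G.Adj e f
  · have hy : (newPairs G L Z e f c : ℝ) ≤ 2 * n := by
      rw [newPairs]
      split_ifs
      · exact le_trans (Nat.cast_le.2 (card_le_card (filter_subset _ _))) hcard
      · simpa using hn.le
    have ha : (ownPairs G L Z e f : ℝ) ≤ n := by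
      rw [ownPairs, if_pos h]
      exact le_trans (Nat.cast_le.2 (card_le_card inter_subset_left)) (card_availColors_le hL hC f)
    have hθy : θ * newPairs G L Z e f c ≤ 2 * T := by
      nlinarith [mul_le_mul_of_nonneg_left hy hθ]
    have hθa : θ * ownPairs G L Z e f ≤ T := by
      nlinarith [mul_le_mul_of_nonneg_left ha hθ]
    set i : ℝ := if G.Adj e f ∧ c ∈ seenColors G Z e then 1 else 0 with hi
    have hi0 : 0 ≤ i := by rw [hi]; split_ifs <;> norm_num
    have hi1 : i ≤ 1 := by rw [hi]; split_ifs <;> norm_num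
    rw [if_pos h]
    refine ⟨abs_le.2 ⟨by linarith, by linarith⟩, ?_⟩
    refine (sq_le_sq' (b := 2) (by linarith) (by linarith)).trans ?_
    linarith
  · have hy : newPairs G L Z e f c = 0 := if_neg fun h' => h h'.1
    have ha : ownPairs G L Z e f = 0 := if_neg h
    rw [if_neg fun h' => h h'.1, if_neg h, hy, ha]
    push_cast
    refine ⟨abs_le.2 ⟨by linarith, by linarith⟩, by nlinarith⟩

theorem sum_stepBound_sq_le (hL : ∀ f, L f ⊆ range C) (hC : (C : ℝ) ≤ n) (hn : 0 < n)
    (hT0 : 0 < T) (hT : T ≤ 1 / 480) (hdeg : ∀ f, ((nbrs G f).card : ℝ) ≤ 2 * n)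
    (hdone : ((doneNbrs G Z e).card : ℝ) ≤ 5 * T * n) (hθ : 0 ≤ θ) (hθn : θ * n ≤ T) :
    ∑ f with Z f = none, ∑ c ∈ availColors G L Z f, stepBound G L Z θ e f c ^ 2 ≤ 20 * n ^ 2 := by
  have h := sum_le_sum fun f (_ : f ∈ univ.filter (Z · = none)) =>
    sum_le_sum fun c (_ : c ∈ availColors G L Z f) =>
      (abs_stepBound_le (Z := Z) (e := e) hL hC hn hT hdeg hθ hθn f c).2
  refine h.trans ?_
  simp only [sum_add_distrib, ← mul_sum]
  have h1 := sum_adj_le (Z := Z) hL hC hdeg e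
  have h2 := sum_lostPairs_le (L := L) hn hT0 hdeg hdone
  have h3 := mul_le_mul_of_nonneg_left h2 (by positivity : 0 ≤ 4 * θ)
  have h4 : 4 * θ * (20 * T * n ^ 3) ≤ n ^ 2 := by
    have : 4 * θ * (20 * T * n ^ 3) = 80 * T * n ^ 2 * (θ * n) := by ring
    rw [this]
    have h5 : 80 * T * n ^ 2 * (θ * n) ≤ 80 * T * n ^ 2 * T := by gcongr
    have h6 : 0 < n ^ 2 := by positivity
    have h7 : T * T ≤ 1 / 480 * (1 / 480) := by gcongr
    nlinarith
  nlinarith [sq_nonneg n]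

theorem sum_exp_stepBound_le {s : ℝ} (hL : ∀ f, L f ⊆ range C) (hC : (C : ℝ) ≤ n) (hn : 0 < n)
    (hT : 0 < T) (hδ : 0 < δ) (hδ1 : δ ≤ 1) (hTδ : T ≤ δ / 480)
    (hLc : ∀ f, 15 / 16 * n ≤ (L f).card) (hdeg : ∀ f, ((nbrs G f).card : ℝ) ≤ 2 * n)
    (hdone : ∀ f, Z f = none → ((doneNbrs G Z f).card : ℝ) ≤ 5 * T * n)
    (he : Z e = none) (hdense : 15 / 16 * n ≤ (nbrs G e).card)
    (hsparse : ∀ f ∈ nbrs G e,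
      δ * n ≤ ((nbrs G e).filter fun g => g ≠ f ∧ ¬G.Adj f g).card) (hθ : 0 ≤ θ)
    (hθn : θ * n ≤ T) (hs : 0 ≤ s) (hs1 : s ≤ 1 / 2) :
    ∑ f with Z f = none, ∑ c ∈ availColors G L Z f,
      (Real.exp (-(s * stepBound G L Z θ e f c)) - 1) ≤
      -(s * (repeatPairs G L Z e + θ * (δ / 16 * n ^ 3))) + 20 * s ^ 2 * n ^ 2 := by
  have hT' : T ≤ 1 / 480 := by linarith
  have h : ∀ f c, Real.exp (-(s * stepBound G L Z θ e f c)) - 1 ≤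
      -(s * stepBound G L Z θ e f c) + s ^ 2 * stepBound G L Z θ e f c ^ 2 := by
    intro f c
    have h1 := (abs_stepBound_le (Z := Z) (e := e) hL hC hn hT' hdeg hθ hθn f c).1
    have h2 : |-(s * stepBound G L Z θ e f c)| ≤ 1 := by
      rw [abs_neg, abs_mul, abs_of_nonneg hs]
      nlinarith [abs_nonneg (stepBound G L Z θ e f c)]
    have h3 := exp_sub_one_le_add_sq h2
    nlinarith
  refine (sum_le_sum fun f _ => sum_le_sum fun c _ => h f c).trans ?_
  simp only [sum_add_distrib, sum_neg_distrib, ← mul_sum]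
  have h1 := le_sum_stepBound hL hC hn hT hδ hδ1 hTδ hLc hdeg hdone he hdense hsparse hθ
  have h2 := sum_stepBound_sq_le hL hC hn hT hT' hdeg (hdone e he) hθ hθn
  have h3 := mul_le_mul_of_nonneg_left h1 hs
  have h4 := mul_le_mul_of_nonneg_left h2 (sq_nonneg s)
  linarith

end Drift

section RandomGreedy

variable {W : Type*} [Fintype W] (G : SimpleGraph W) (L : W → Finset ℕ)

/-- The number of colours saved at `e`, together with the saving expected until time `T`. -/
noncomputable def gainPotential (T β n : ℝ) (Z : W → Option ℕ) (t : ℝ) (e : W) : ℝ :=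
  (doneNbrs G Z e).card - (seenColors G Z e).card + (T - t) / n * repeatPairs G L Z e +
    (T - t) ^ 2 * (β * n / 2)

variable {G L}

theorem hasDerivAt_gainPotential (T β n : ℝ) (Z : W → Option ℕ) (t : ℝ) (e : W) :
    HasDerivAt (fun t => gainPotential G L T β n Z t e)
      (-(repeatPairs G L Z e / n + (T - t) * (β * n))) t := by
  have h1 : HasDerivAt (fun t => T - t) (-1) t := by
    simpa using (hasDerivAt_id t).const_sub T
  have h2 := (((h1.div_const n).mul_const (repeatPairs G L Z e : ℝ)).const_add
    ((doneNbrs G Z e).card - (seenColors G Z e).card : ℝ)).add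
      ((h1.fun_pow 2).mul_const (β * n / 2))
  refine h2.congr_deriv ?_
  push_cast
  ring

theorem gainPotential_update_ge {T β n : ℝ} {Z : W → Option ℕ} {t : ℝ} {f : W} {c : ℕ}
    (hf : Z f = none) (hθ : 0 ≤ (T - t) / n) (e : W) :
    gainPotential G L T β n Z t e + stepBound G L Z ((T - t) / n) e f c ≤
      gainPotential G L T β n (Function.update Z f (some c)) t e := by
  have h1 : ((repeatPairs G L Z e + newPairs G L Z e f c : ℕ) : ℝ) ≤
      (repeatPairs G L (Function.update Z f (some c)) e + ownPairs G L Z e f +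
        lostPairs G L Z e f c : ℕ) := Nat.cast_le.2 (repeatPairs_le_update hf e)
  push_cast at h1
  have h2 : ((seenColors G (Function.update Z f (some c)) e).card : ℝ) +
      (if G.Adj e f ∧ c ∈ seenColors G Z e then 1 else 0) ≤
      (seenColors G Z e).card + (if G.Adj e f then 1 else 0) := by
    rw [seenColors_update hf]
    by_cases h : G.Adj e f
    · rw [if_pos h, if_pos h]
      by_cases hc : c ∈ seenColors G Z e
      · rw [if_pos ⟨h, hc⟩, insert_eq_of_mem hc]
      · rw [if_neg fun h => hc h.2, card_insert_of_notMem hc]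
        push_cast
        linarith
    · simp [h]
  have h3 : ((doneNbrs G (Function.update Z f (some c)) e).card : ℝ) =
      (doneNbrs G Z e).card + (if G.Adj e f then 1 else 0) := by
    rw [card_doneNbrs_update hf]
    push_cast
    rfl
  have h4 := mul_le_mul_of_nonneg_left h1 hθ
  rw [gainPotential, gainPotential, stepBound, h3]
  linarith

/-- The random greedy colouring process reaches a partial colouring in which every dense uncoloured
element has saved many colours. -/
theorem exists_partial_coloring {C : ℕ} {n T δ s ζ : ℝ} {dense : W → Prop}
    (hL : ∀ f, L f ⊆ range C) (hC : (C : ℝ) ≤ n) (hn : 0 < n) (hT : 0 < T) (hδ : 0 < δ)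
    (hδ1 : δ ≤ 1) (hTδ : T ≤ δ / 480) (hLc : ∀ f, 15 / 16 * n ≤ (L f).card)
    (hdeg : ∀ f, ((nbrs G f).card : ℝ) ≤ 2 * n)
    (hdense : ∀ e, dense e → 15 / 16 * n ≤ (nbrs G e).card)
    (hsparse : ∀ e, dense e → ∀ f ∈ nbrs G e,
      δ * n ≤ ((nbrs G e).filter fun g => g ≠ f ∧ ¬G.Adj f g).card)
    (hs : 0 < s) (hs1 : s ≤ 1 / 2) (hsζ : s ≤ ζ / 40) (hsn : 1 ≤ s * n) (hsζn : 2 ≤ s * ζ * n)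
    (hinit : Fintype.card W * Real.exp (-(s * T * n)) +
      Fintype.card W * Real.exp (-(s * (δ / 16 * T ^ 2 * n / 4))) ≤ 1) :
    ∃ Z : W → Option ℕ,
      Relation.ReflTransGen (fun Z Z' => ∃ i ∈ (univ.filter fun f => Z f = none).sigma
        (availColors G L Z), Z' = Function.update Z i.1 (some i.2)) (fun _ => none) Z ∧
      ∀ e, dense e → Z e = none → δ / 16 * T ^ 2 * n / 4 - ζ * n * T ≤
        (doneNbrs G Z e).card - (seenColors G Z e).card := by
  have hζ : 0 < ζ := by linarith
  let g : W ⊕ W → (W → Option ℕ) → ℝ → ℝ := fun j Z t => Sum.elim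
    (fun e => if Z e = none then
      Real.exp (s * ((doneNbrs G Z e).card - 4 * n * t - T * n)) else 0)
    (fun e => if Z e = none ∧ dense e then Real.exp
      (-(s * (gainPotential G L T (δ / 16) n Z t e + ζ * n * t - δ / 16 * T ^ 2 * n / 4))) else 0) j
  let g' : W ⊕ W → (W → Option ℕ) → ℝ → ℝ := fun j Z t => g j Z t * Sum.elim
    (fun _ => s * -(4 * n))
    (fun e => -(s * (-(repeatPairs G L Z e / n + (T - t) * (δ / 16 * n)) + ζ * n))) j
  obtain ⟨Z, hZ, hZg⟩ := exists_reachable_observables_le (J := W ⊕ W)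
    (fun Z : W → Option ℕ => (univ.filter fun f => Z f = none).card)
    (fun Z => (univ.filter fun f => Z f = none).sigma (availColors G L Z))
    (fun Z i => Function.update Z i.1 (some i.2)) (by
      rintro Z ⟨f, c⟩ hi
      have hf := (mem_filter.1 (mem_sigma.1 hi).1).2
      refine card_lt_card ⟨fun e he => ?_, fun h => ?_⟩
      · have he := (mem_filter.1 he).2
        rcases eq_or_ne e f with rfl | hef
        · simp at he
        · simpa [hef] using he
      · have := h (mem_filter.2 ⟨mem_univ f, hf⟩)
        simp at this)
    (fun _ _ _ => 1 / n) (fun _ _ _ _ => by positivity) g g'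
    (by
      rintro (e | e) Z t <;> simp only [g, Sum.elim_inl, Sum.elim_inr] <;> split_ifs <;>
        first | exact (Real.exp_pos _).le | exact le_rfl)
    (by
      rintro (e | e) Z t
      · simp only [g, g', Sum.elim_inl]
        split_ifs
        · refine HasDerivAt.exp (HasDerivAt.const_mul _ (HasDerivAt.sub_const _ ?_))
          simpa using ((hasDerivAt_id t).const_mul (4 * n)).const_sub ((doneNbrs G Z e).card : ℝ)
        · rw [zero_mul]
          exact hasDerivAt_const _ _
      · simp only [g, g', Sum.elim_inr]
        split_ifs
        · refine HasDerivAt.exp (HasDerivAt.fun_neg (HasDerivAt.const_mul _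
            (HasDerivAt.sub_const _ (HasDerivAt.add (hasDerivAt_gainPotential _ _ _ _ _ _) ?_))))
          simpa using (hasDerivAt_id t).const_mul (ζ * n)
        · rw [zero_mul]
          exact hasDerivAt_const _ _) T
    (by
      intro Z t ht htT hle
      have hdone : ∀ f, Z f = none → ((doneNbrs G Z f).card : ℝ) ≤ 5 * T * n := by
        intro f hf
        have h := hle (Sum.inl f)
        simp only [g, Sum.elim_inl, if_pos hf, Real.exp_le_one_iff] at h
        have h1 : ((doneNbrs G Z f).card : ℝ) - 4 * n * t - T * n ≤ 0 := by
          by_contra! h2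
          exact absurd h (not_le.2 (mul_pos hs h2))
        nlinarith [mul_le_mul_of_nonneg_left htT.le hn.le]
      have hzero : ∀ j, Z (Sum.elim id id j) ≠ none → ∀ i ∈ (univ.filter fun f => Z f = none).sigma
          (availColors G L Z), g j (Function.update Z i.1 (some i.2)) t = 0 ∧ g j Z t = 0 := by
        rintro j hj ⟨f, c⟩ hi
        have hf := (mem_filter.1 (mem_sigma.1 hi).1).2
        have hjf : Sum.elim id id j ≠ f := fun h => hj (h ▸ hf)
        rcases j with e | e <;> simp only [Sum.elim_inl, Sum.elim_inr, id] at hj hjf <;>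
          simp [g, hj, hjf]
      intro j
      by_cases hj : Z (Sum.elim id id j) = none
      swap
      · rw [sum_eq_zero fun i hi => by rw [(hzero j hj i hi).1, (hzero j hj i hi).2]; ring]
        rcases j with e | e <;> simp only [Sum.elim_inl, Sum.elim_inr, id] at hj <;>
          simp [g, g', hj]
      rcases j with e | e <;> simp only [Sum.elim_inl, Sum.elim_inr, id] at hj
      · have hg0 : 0 ≤ g (Sum.inl e) Z t := by
          simp only [g, Sum.elim_inl, if_pos hj]; exact (Real.exp_pos _).le
        have hmove : ∀ f ∈ univ.filter (fun f => Z f = none), ∀ c ∈ availColors G L Z f,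
            1 / n * (g (Sum.inl e) (Function.update Z f (some c)) t - g (Sum.inl e) Z t) ≤
            g (Sum.inl e) Z t * (1 / n * (s + s ^ 2)) * (if G.Adj e f then 1 else 0) := by
          intro f hf c _
          rcases eq_or_ne e f with rfl | hef
          · have : g (Sum.inl e) (Function.update Z e (some c)) t = 0 := by simp [g]
            rw [this, if_neg G.irrefl, mul_zero, zero_sub]
            have : 0 < 1 / n := by positivity
            nlinarith
          · have h1 : g (Sum.inl e) (Function.update Z f (some c)) t =
                g (Sum.inl e) Z t * Real.exp (s * if G.Adj e f then 1 else 0) := by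
              simp only [g, Sum.elim_inl, Function.update_of_ne hef, if_pos hj]
              rw [← Real.exp_add, card_doneNbrs_update (mem_filter.1 hf).2]
              congr 1
              push_cast
              ring
            rw [h1]
            split_ifs
            · have h2 := exp_sub_one_le_add_sq (u := s) (by rw [abs_of_pos hs]; linarith)
              have h3 := mul_le_mul_of_nonneg_left h2 (by positivity :
                0 ≤ 1 / n * g (Sum.inl e) Z t)
              rw [mul_one]
              linarith
            · simp
        rw [sum_sigma]
        have hsum := sum_le_sum fun f hf => sum_le_sum (hmove f hf)
        simp only [← mul_sum] at hsum
        have h1 := sum_adj_le (Z := Z) (L := L) hL hC hdeg e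
        have h2 := mul_le_mul_of_nonneg_left h1 (by positivity :
          0 ≤ g (Sum.inl e) Z t * (1 / n * (s + s ^ 2)))
        have h3 : g (Sum.inl e) Z t * (1 / n * (s + s ^ 2)) * (2 * n ^ 2) =
            g (Sum.inl e) Z t * ((s + s ^ 2) * (2 * n)) := by field_simp
        have h4 : s * -(4 * n) + (s + s ^ 2) * (2 * n) ≤ -1 := by nlinarith
        have h5 := mul_le_mul_of_nonneg_left h4 hg0
        simp only [g', Sum.elim_inl]
        simp only [← mul_sum]
        linarith
      · by_cases hd : dense e
        swap
        · simp [g, g', hd]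
        have hg0 : 0 ≤ g (Sum.inr e) Z t := by
          simp only [g, Sum.elim_inr, if_pos (And.intro hj hd)]; exact (Real.exp_pos _).le
        have hθ : 0 ≤ (T - t) / n := div_nonneg (by linarith) hn.le
        have hθn : (T - t) / n * n ≤ T := by
          rw [div_mul_cancel₀ _ hn.ne']; linarith
        have hmove : ∀ f ∈ univ.filter (fun f => Z f = none), ∀ c ∈ availColors G L Z f,
            1 / n * (g (Sum.inr e) (Function.update Z f (some c)) t - g (Sum.inr e) Z t) ≤
            g (Sum.inr e) Z t / n *
              (Real.exp (-(s * stepBound G L Z ((T - t) / n) e f c)) - 1) := by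
          intro f hf c _
          have h0 : g (Sum.inr e) (Function.update Z f (some c)) t ≤
              g (Sum.inr e) Z t * Real.exp (-(s * stepBound G L Z ((T - t) / n) e f c)) := by
            rcases eq_or_ne e f with rfl | hef
            · have : g (Sum.inr e) (Function.update Z e (some c)) t = 0 := by simp [g]
              rw [this]
              exact mul_nonneg hg0 (Real.exp_pos _).le
            · simp only [g, Sum.elim_inr, Function.update_of_ne hef, if_pos (And.intro hj hd)]
              rw [← Real.exp_add]
              refine Real.exp_le_exp.2 ?_
              have := mul_le_mul_of_nonneg_left (gainPotential_update_ge (G := G) (L := L) (c := c)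
                (β := δ / 16) (mem_filter.1 hf).2 hθ e) hs.le
              linarith
          have h1 := mul_le_mul_of_nonneg_left h0 (by positivity : 0 ≤ 1 / n)
          calc _ = 1 / n * g (Sum.inr e) (Function.update Z f (some c)) t -
                1 / n * g (Sum.inr e) Z t := by ring
            _ ≤ _ := sub_le_sub_right h1 _
            _ = _ := by ring
        rw [sum_sigma]
        have hsum := sum_le_sum fun f hf => sum_le_sum (hmove f hf)
        simp only [← mul_sum] at hsum
        have h1 := sum_exp_stepBound_le (s := s) hL hC hn hT hδ hδ1 hTδ hLc hdeg hdone hj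
          (hdense e hd) (hsparse e hd) hθ hθn hs.le hs1
        have h2 := mul_le_mul_of_nonneg_left h1 (by positivity : 0 ≤ g (Sum.inr e) Z t / n)
        have h3 : g (Sum.inr e) Z t / n * (-(s * (repeatPairs G L Z e + (T - t) / n *
            (δ / 16 * n ^ 3))) + 20 * s ^ 2 * n ^ 2) = g (Sum.inr e) Z t *
            (-(s * (repeatPairs G L Z e / n + (T - t) * (δ / 16 * n))) + 20 * s ^ 2 * n) := by
          field_simp
        have h4 : -(s * (-(repeatPairs G L Z e / n + (T - t) * (δ / 16 * n)) + ζ * n)) +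
            (-(s * (repeatPairs G L Z e / n + (T - t) * (δ / 16 * n))) + 20 * s ^ 2 * n) ≤ -1 := by
          have h5 : 20 * s ^ 2 * n ≤ s * ζ * n / 2 := by
            have := mul_le_mul_of_nonneg_left hsζ (by positivity : 0 ≤ 20 * s * n)
            nlinarith
          linarith
        have h5 := mul_le_mul_of_nonneg_left h4 hg0
        simp only [g', Sum.elim_inr]
        simp only [← mul_sum]
        linarith)
    (fun _ => none) hT.le (by
      rw [Fintype.sum_sum_type]
      have hdone : ∀ e, (doneNbrs G (fun _ => none) e).card = 0 := by simp [doneNbrs]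
      refine le_trans (add_le_add (le_trans (sum_le_card_nsmul _ _ (Real.exp (-(s * T * n)))
        fun e _ => ?_) ?_) (le_trans (sum_le_card_nsmul _ _
        (Real.exp (-(s * (δ / 16 * T ^ 2 * n / 4)))) fun e _ => ?_) ?_)) hinit
      · simp only [g, Sum.elim_inl, hdone, if_pos]
        refine Real.exp_le_exp.2 (le_of_eq ?_)
        push_cast
        ring
      · simp
      · simp only [g, Sum.elim_inr]
        split_ifs
        · refine Real.exp_le_exp.2 (neg_le_neg (mul_le_mul_of_nonneg_left ?_ hs.le))
          have h1 : ((seenColors G (fun _ => none) e).card : ℝ) = 0 := by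
            have := card_seenColors_le (G := G) (Z := fun _ => none) e
            rw [hdone] at this
            exact_mod_cast Nat.le_zero.1 this
          rw [gainPotential, hdone, h1]
          have h2 : 0 ≤ (T - 0) / n * (repeatPairs G L (fun _ => none) e : ℝ) :=
            mul_nonneg (div_nonneg (by linarith) hn.le) (Nat.cast_nonneg _)
          push_cast
          nlinarith [mul_pos (mul_pos hδ (pow_pos hT 2)) hn]
        · exact (Real.exp_pos _).le
      · simp)
  refine ⟨Z, hZ, fun e he hZe => ?_⟩
  have h := hZg (Sum.inr e)
  simp only [g, Sum.elim_inr, if_pos (And.intro hZe he), Real.exp_le_one_iff] at h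
  have h1 : 0 ≤ gainPotential G L T (δ / 16) n Z T e + ζ * n * T - δ / 16 * T ^ 2 * n / 4 := by
    by_contra! h2
    nlinarith
  rw [gainPotential, sub_self] at h1
  simp only [zero_div, zero_mul, ne_eq, OfNat.ofNat_ne_zero, not_false_eq_true, zero_pow,
    add_zero] at h1
  linarith

end RandomGreedy

theorem tendsto_pow_four_mul_exp_neg {a : ℝ} (ha : 0 < a) :
    Filter.Tendsto (fun n : ℝ => n ^ 4 * Real.exp (-(a * n))) Filter.atTop (nhds 0) := by
  have h1 : Filter.Tendsto (fun n : ℝ => a * n) Filter.atTop Filter.atTop :=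
    Filter.Tendsto.const_mul_atTop ha Filter.tendsto_id
  have h2 := ((Real.tendsto_pow_mul_exp_neg_atTop_nhds_zero 4).comp h1).const_mul (1 / a ^ 4)
  rw [mul_zero] at h2
  refine h2.congr fun n => ?_
  simp only [Function.comp]
  field_simp

theorem exists_isListColoring_of_partial {W : Type*} [Fintype W] {G : SimpleGraph W}
    {L : W → Finset ℕ} {Z : W → Option ℕ}
    (hZ : Relation.ReflTransGen (fun Z Z' => ∃ i ∈ (univ.filter fun f => Z f = none).sigma
      (availColors G L Z), Z' = Function.update Z i.1 (some i.2)) (fun _ => none) Z)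
    (h : ∀ e, Z e = none → (openNbrs G Z e).card + (seenColors G Z e).card < (L e).card) :
    ∃ φ, IsListColoring G.Adj L univ φ := by
  have hinv : (∀ f c, Z f = some c → c ∈ L f) ∧
      ∀ f g c, G.Adj f g → Z f = some c → Z g ≠ some c := by
    clear h
    induction hZ with
    | refl => simp
    | @tail Z _ _ hstep ih =>
      obtain ⟨⟨f, c⟩, hi, rfl⟩ := hstep
      obtain ⟨hf, hc⟩ := mem_sigma.1 hi
      obtain ⟨hcL, hcs⟩ := mem_sdiff.1 hc
      simp only at hcL hcs ⊢
      refine ⟨fun e d hd => ?_, fun e g d heg hd hg => ?_⟩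
      · rcases eq_or_ne e f with rfl | hef
        · rw [Function.update_self] at hd
          exact Option.some.inj hd ▸ hcL
        · rw [Function.update_of_ne hef] at hd
          exact ih.1 e d hd
      · rcases eq_or_ne e f with rfl | hef
        · rw [Function.update_self] at hd
          rw [Function.update_of_ne heg.ne'] at hg
          exact hcs (mem_seenColors.2 ⟨g, heg, hg.trans hd.symm⟩)
        · rw [Function.update_of_ne hef] at hd
          rcases eq_or_ne g f with rfl | hgf
          · rw [Function.update_self] at hg
            exact hcs (mem_seenColors.2 ⟨e, heg.symm, hd.trans hg.symm⟩)
          · rw [Function.update_of_ne hgf] at hg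
            exact ih.2 e g d heg hd hg
  obtain ⟨χ, hχL, hχ⟩ := exists_isListColoring_of_card_lt (adj := G.Adj) (fun _ _ h => h.symm)
    (availColors G L Z) (univ.filter fun f => Z f = none) (by
      intro e he
      have h1 := h e (mem_filter.1 he).2
      have h2 := le_card_sdiff (seenColors G Z e) (L e)
      have h3 : ((univ.filter fun f => Z f = none).filter fun u => u ≠ e ∧ G.Adj e u).card ≤
          (openNbrs G Z e).card := by
        refine card_le_card fun u hu => ?_
        rw [mem_filter] at hu
        exact mem_openNbrs.2 ⟨hu.2.2, (mem_filter.1 hu.1).2⟩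
      rw [availColors]
      omega)
  have hU : ∀ {f}, Z f = none → f ∈ univ.filter fun f => Z f = none := fun h =>
    mem_filter.2 ⟨mem_univ _, h⟩
  refine ⟨fun f => (Z f).getD (χ f), fun f _ => ?_, fun f _ g _ hfg hadj h => ?_⟩
  · simp only
    rcases hf : Z f with _ | c
    · exact (mem_sdiff.1 (hχL f (hU hf))).1
    · exact hinv.1 f c hf
  · simp only at h
    rcases hf : Z f with _ | c <;> rcases hg : Z g with _ | d <;>
      simp only [hf, hg, Option.getD_none, Option.getD_some] at h
    · exact hχ f (hU hf) g (hU hg) hfg hadj h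
    · exact (mem_sdiff.1 (hχL f (hU hf))).2 (mem_seenColors.2 ⟨g, hadj, by rw [hg, h]⟩)
    · exact (mem_sdiff.1 (hχL g (hU hg))).2 (mem_seenColors.2 ⟨f, hadj.symm, by rw [hf, h]⟩)
    · exact hinv.2 f g c hadj hf (by rw [hg, h])

/-- List colouring of locally sparse graphs: if no edge has an almost complete joint neighbourhood
with one of its ends then lists slightly smaller than the degree suffice. -/
theorem eventually_exists_isListColoring_of_sparse (δ : ℝ) (hδ : 0 < δ) :
    ∃ ε > 0, ∀ᶠ n : ℝ in Filter.atTop, ∀ {W : Type} [Fintype W] (G : SimpleGraph W)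
      (L : W → Finset ℕ) (C : ℕ), (∀ f, L f ⊆ range C) → (C : ℝ) ≤ n →
      (∀ f, (1 - ε) * n ≤ (L f).card) → (∀ f, ((nbrs G f).card : ℝ) ≤ (1 + ε) * n) →
      (∀ e, (L e).card ≤ (nbrs G e).card → ∀ f ∈ nbrs G e,
        δ * n ≤ ((nbrs G e).filter fun g => g ≠ f ∧ ¬G.Adj f g).card) →
      (Fintype.card W : ℝ) ≤ n ^ 4 → ∃ φ, IsListColoring G.Adj L univ φ := by
  obtain ⟨δ₁, hδ₁, hδ₁1, hδ₁δ⟩ : ∃ δ₁ : ℝ, 0 < δ₁ ∧ δ₁ ≤ 1 ∧ δ₁ ≤ δ :=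
    ⟨min δ 1, by positivity, min_le_right _ _, min_le_left _ _⟩
  obtain ⟨T, hT, hTδ⟩ : ∃ T : ℝ, 0 < T ∧ T ≤ δ₁ / 480 := ⟨δ₁ / 480, by positivity, le_rfl⟩
  obtain ⟨ζ, hζ, hζT⟩ : ∃ ζ : ℝ, 0 < ζ ∧ ζ * T = δ₁ / 16 * T ^ 2 / 8 :=
    ⟨δ₁ / 16 * T / 8, by positivity, by ring⟩
  obtain ⟨s, hs, hs1, hsζ⟩ : ∃ s : ℝ, 0 < s ∧ s ≤ 1 / 2 ∧ s ≤ ζ / 40 :=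
    ⟨min (1 / 2) (ζ / 40), by positivity, min_le_left _ _, min_le_right _ _⟩
  obtain ⟨ε, hε, hε1, hεT⟩ : ∃ ε : ℝ, 0 < ε ∧ ε ≤ 1 / 16 ∧ ε ≤ δ₁ / 16 * T ^ 2 / 32 :=
    ⟨min (1 / 16) (δ₁ / 16 * T ^ 2 / 32), by positivity, min_le_left _ _, min_le_right _ _⟩
  refine ⟨ε, hε, ?_⟩
  have hlim := (tendsto_pow_four_mul_exp_neg (mul_pos hs hT)).add
    (tendsto_pow_four_mul_exp_neg (a := s * (δ₁ / 16 * T ^ 2 / 4)) (by positivity))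
  rw [add_zero] at hlim
  filter_upwards [Filter.eventually_ge_atTop (1 / s), Filter.eventually_ge_atTop (2 / (s * ζ)),
    Filter.eventually_gt_atTop 0, hlim.eventually_le_const one_pos] with n h1 h2 hn h4
  intro W _ G L C hL hC hLc hdeg hsparse hW
  rw [div_le_iff₀ (by positivity)] at h1 h2
  obtain ⟨Z, hZ, hgain⟩ := exists_partial_coloring (G := G) (L := L) (s := s) (ζ := ζ)
    (dense := fun e => (L e).card ≤ (nbrs G e).card) hL hC hn hT hδ₁ hδ₁1 hTδ
    (fun f => le_trans (by gcongr; linarith) (hLc f))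
    (fun f => (hdeg f).trans (by gcongr; linarith))
    (fun e he => le_trans (by gcongr; linarith) ((hLc e).trans (Nat.cast_le.2 he)))
    (fun e he f hf => le_trans (by gcongr) (hsparse e he f hf)) hs hs1 hsζ (by linarith)
    (by linarith) (by
      refine le_trans (add_le_add (mul_le_mul_of_nonneg_right hW (Real.exp_pos _).le)
        (mul_le_mul_of_nonneg_right hW (Real.exp_pos _).le)) (le_of_eq_of_le ?_ h4)
      congr 4
      ring)
  refine exists_isListColoring_of_partial hZ fun e he => ?_
  have h5 := card_openNbrs_add_card_doneNbrs (G := G) (Z := Z) e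
  by_cases hd : (L e).card ≤ (nbrs G e).card
  · have h6 := hgain e hd he
    have h7 : ((openNbrs G Z e).card : ℝ) + (doneNbrs G Z e).card = (nbrs G e).card := by
      exact_mod_cast h5
    have h8 : ζ * n * T = δ₁ / 16 * T ^ 2 / 8 * n := by rw [← hζT]; ring
    have h9 := mul_le_mul_of_nonneg_right hεT hn.le
    have h10 : 0 < δ₁ / 16 * T ^ 2 * n := by positivity
    have h11 : ((openNbrs G Z e).card : ℝ) + (seenColors G Z e).card < (L e).card := by
      nlinarith [hLc e, hdeg e]
    exact_mod_cast h11
  · have := card_seenColors_le (G := G) (Z := Z) e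
    omega

theorem sum_sum_erase_le {n : ℕ} {H : Finset (Finset (Fin n))} (hH : LinearHG H)
    {w : Fin n → ℝ} (hw : ∀ v, 0 ≤ w v) (v : Fin n) :
    ∑ f ∈ H.filter (fun f => v ∈ f), ∑ u ∈ f.erase v, w u ≤ ∑ u, w u := by
  rw [← sum_biUnion]
  · exact sum_le_sum_of_subset_of_nonneg (subset_univ _) fun u _ _ => hw u
  · intro e he f hf hef
    rw [Function.onFun, disjoint_left]
    intro u hue huf
    obtain ⟨heH, hve⟩ := mem_filter.1 he
    obtain ⟨hfH, hvf⟩ := mem_filter.1 hf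
    rw [mem_erase] at hue huf
    have := card_le_one.1 (hH e heH f hfH hef) u (mem_inter.2 ⟨hue.2, huf.2⟩) v
      (mem_inter.2 ⟨hve, hvf⟩)
    exact hue.1 this

theorem sum_card_sub_one_le {n : ℕ} {H : Finset (Finset (Fin n))} (hH : LinearHG H) (v : Fin n) :
    ∑ f ∈ H.filter (fun f => v ∈ f), ((f.card : ℝ) - 1) ≤ n := by
  have h := sum_sum_erase_le hH (w := fun _ => 1) (fun _ => zero_le_one) v
  simp only [sum_const, card_univ, Fintype.card_fin, nsmul_eq_mul, mul_one] at h
  refine le_trans (le_of_eq (sum_congr rfl fun f hf => ?_)) h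
  have hv := (mem_filter.1 hf).2
  rw [card_erase_of_mem hv, Nat.cast_sub (card_pos.2 ⟨v, hv⟩), Nat.cast_one]

theorem sum_sum_filter_mem {n : ℕ} (H : Finset (Finset (Fin n)))
    (w : Finset (Fin n) → Fin n → ℝ) :
    ∑ v, ∑ f ∈ H.filter (fun f => v ∈ f), w f v = ∑ f ∈ H, ∑ v ∈ f, w f v := by
  refine sum_comm' fun v f => ?_
  simp only [mem_univ, true_and, mem_filter]
  tauto

theorem sum_card_mul_card_sub_one_le {n : ℕ} {H : Finset (Finset (Fin n))} (hH : LinearHG H) :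
    ∑ f ∈ H, (f.card : ℝ) * (f.card - 1) ≤ (n : ℝ) ^ 2 := by
  have h : ∑ v : Fin n, ∑ f ∈ H.filter (fun f => v ∈ f), ((f.card : ℝ) - 1) ≤
      ∑ _v : Fin n, (n : ℝ) :=
    sum_le_sum fun v _ => sum_card_sub_one_le hH v
  rw [sum_sum_filter_mem H fun f _ => (f.card : ℝ) - 1] at h
  simpa only [sum_const, card_univ, Fintype.card_fin, nsmul_eq_mul, ← sq] using h

theorem sum_filter_meets_le {n : ℕ} {H : Finset (Finset (Fin n))} {w : Finset (Fin n) → ℝ}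
    (hw : ∀ f ∈ H, 0 ≤ w f) (e : Finset (Fin n)) :
    ∑ f ∈ H.filter (fun f => Meets e f), w f ≤
      ∑ v ∈ e, ∑ f ∈ H.filter (fun f => v ∈ f), w f := by
  have h : ∑ v ∈ e, ∑ f ∈ H.filter (fun f => v ∈ f), w f = ∑ f ∈ H, ∑ v ∈ e ∩ f, w f := by
    refine sum_comm' fun v f => ?_
    simp only [mem_inter, mem_filter]
    tauto
  rw [h, sum_filter]
  refine sum_le_sum fun f hf => ?_
  rw [sum_const, nsmul_eq_mul]
  split_ifs with hef
  · exact le_mul_of_one_le_left (hw f hf) (by exact_mod_cast card_pos.2 hef)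
  · exact mul_nonneg (Nat.cast_nonneg _) (hw f hf)

theorem card_filter_meets_le_sum {n : ℕ} (H : Finset (Finset (Fin n))) (e : Finset (Fin n)) :
    ((H.filter fun f => Meets e f).card : ℝ) ≤ ∑ v ∈ e, (degHG H v : ℝ) := by
  simpa [degHG] using sum_filter_meets_le (H := H) (fun _ _ => zero_le_one) e

theorem degHG_le_card_of_meets {n : ℕ} {H : Finset (Finset (Fin n))} (hH : LinearHG H)
    {e : Finset (Fin n)} (he : ∀ f ∈ H, Meets e f) {v : Fin n} (hv : v ∉ e) :
    degHG H v ≤ e.card := by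
  have : Nonempty (Fin n) := ⟨v⟩
  choose! g hg using he
  refine card_le_card_of_injOn g (fun f hf => ?_) fun f hf f' hf' hff' => ?_
  · exact (mem_inter.1 (hg f (mem_filter.1 hf).1)).1
  · obtain ⟨hfH, hvf⟩ := mem_filter.1 hf
    obtain ⟨hfH', hvf'⟩ := mem_filter.1 hf'
    by_contra hne
    have h1 := mem_inter.1 (hg f hfH)
    have h2 := mem_inter.1 (hg f' hfH')
    have := card_le_one.1 (hH f hfH f' hfH' hne) v (mem_inter.2 ⟨hvf, hvf'⟩) (g f)
      (mem_inter.2 ⟨h1.2, hff' ▸ h2.2⟩)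
    exact hv (this ▸ h1.1)

theorem LinearHG.mono {n : ℕ} {H K : Finset (Finset (Fin n))} (hH : LinearHG H) (h : K ⊆ H) :
    LinearHG K :=
  fun e he f hf => hH e (h he) f (h hf)

theorem degHG_mono {n : ℕ} {H K : Finset (Finset (Fin n))} (h : K ⊆ H) (v : Fin n) :
    degHG K v ≤ degHG H v :=
  card_le_card (filter_subset_filter _ h)

/-- The amount by which the degree of `v` falls short of the maximum possible in a linear
hypergraph all of whose edges have size at least `r`. -/
noncomputable def degDefect {n : ℕ} (H : Finset (Finset (Fin n))) (r : ℕ) (v : Fin n) : ℝ :=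
  n - ((r : ℝ) - 1) * degHG H v

theorem sum_card_sub_le_degDefect {n : ℕ} {H : Finset (Finset (Fin n))} (hH : LinearHG H) (r : ℕ)
    (v : Fin n) : ∑ f ∈ H.filter (fun f => v ∈ f), ((f.card : ℝ) - r) ≤ degDefect H r v := by
  have h := sum_card_sub_one_le hH v
  have h2 : ∑ f ∈ H.filter (fun f => v ∈ f), ((f.card : ℝ) - r) =
      ∑ f ∈ H.filter (fun f => v ∈ f), ((f.card : ℝ) - 1) - ((r : ℝ) - 1) * degHG H v := by
    rw [degHG, mul_comm, ← nsmul_eq_mul, ← sum_const, ← sum_sub_distrib]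
    exact sum_congr rfl fun _ _ => by ring
  rw [h2, degDefect]
  linarith

theorem degDefect_nonneg {n : ℕ} {H : Finset (Finset (Fin n))} (hH : LinearHG H) {r : ℕ}
    (hr : ∀ f ∈ H, r ≤ f.card) (v : Fin n) : 0 ≤ degDefect H r v :=
  (sum_nonneg fun f hf => sub_nonneg.2 (Nat.cast_le.2 (hr f (mem_filter.1 hf).1))).trans
    (sum_card_sub_le_degDefect hH r v)

theorem degDefect_le {n : ℕ} (H : Finset (Finset (Fin n))) {r : ℕ} (hr : 1 ≤ r) (v : Fin n) :
    degDefect H r v ≤ n := by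
  have : (0 : ℝ) ≤ ((r : ℝ) - 1) * degHG H v :=
    mul_nonneg (sub_nonneg.2 (by exact_mod_cast hr)) (Nat.cast_nonneg _)
  rw [degDefect]
  linarith

theorem sum_degDefect_le {n : ℕ} {H : Finset (Finset (Fin n))} {r : ℕ} (hr : 1 ≤ r)
    {f : Finset (Fin n)} {C : ℝ} (hC : C ≤ (H.filter fun g => g ≠ f ∧ Meets f g).card) :
    ∑ v ∈ f, degDefect H r v ≤ f.card * n - ((r : ℝ) - 1) * C := by
  have h1 : C ≤ ∑ v ∈ f, (degHG H v : ℝ) := by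
    refine hC.trans (le_trans ?_ (card_filter_meets_le_sum H f))
    refine Nat.cast_le.2 (card_le_card fun g hg => ?_)
    rw [mem_filter] at hg ⊢
    exact ⟨hg.1, hg.2.2⟩
  have h2 : (0 : ℝ) ≤ (r : ℝ) - 1 := sub_nonneg.2 (by exact_mod_cast hr)
  simp only [degDefect]
  rw [sum_sub_distrib, ← mul_sum, sum_const, nsmul_eq_mul]
  nlinarith [mul_le_mul_of_nonneg_left h1 h2]

theorem sum_mul_degHG {n : ℕ} (H : Finset (Finset (Fin n))) (w : Fin n → ℝ) :
    ∑ v, (degHG H v : ℝ) * w v = ∑ f ∈ H, ∑ v ∈ f, w v := by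
  rw [← sum_sum_filter_mem H fun _ v => w v]
  simp [degHG]

set_option maxHeartbeats 1000000 in
theorem exists_sum_degDefect_le {n r₀ : ℕ} {ε τ C : ℝ} (hε : 0 < ε) (hε1 : ε ≤ 1 / 2) (hτ : 0 ≤ τ)
    (hr₀ : 1 ≤ (ε ^ 2 - τ) * r₀) {W : Finset (Finset (Fin n))} (hW : LinearHG W)
    (hne : W.Nonempty) (hsize : ∀ f ∈ W, r₀ ≤ f.card) (hC : (1 - τ) * n ≤ C)
    (hdeg : ∀ f ∈ W, C ≤ (W.filter fun g => g ≠ f ∧ Meets f g).card) :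
    ∃ r ≥ r₀, (∀ f ∈ W, r ≤ f.card) ∧ ∑ v, degDefect W r v ≤ 8 * ε * (n : ℝ) ^ 2 ∧
      (1 - 2 * ε) * n ≤ (W.filter fun f => (f.card : ℝ) ≤ (1 + ε) * r).card := by
  obtain ⟨e, heW, hemin⟩ := exists_min_image W card hne
  obtain ⟨r, hr⟩ : ∃ r, r = e.card := ⟨_, rfl⟩
  rw [← hr] at hemin
  have hr₀r : r₀ ≤ r := hr ▸ hsize e heW
  have hn0 : (0 : ℝ) ≤ n := Nat.cast_nonneg n
  have hετ : 0 < ε ^ 2 - τ := by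
    by_contra! h
    have := mul_nonpos_of_nonpos_of_nonneg h (Nat.cast_nonneg (α := ℝ) r₀)
    linarith
  have hε2 : ε ^ 2 ≤ ε := by nlinarith
  have hrr : 1 ≤ (ε ^ 2 - τ) * r :=
    hr₀.trans (mul_le_mul_of_nonneg_left (Nat.cast_le.2 hr₀r) hετ.le)
  have hr0 : (0 : ℝ) ≤ r := Nat.cast_nonneg r
  have hr1 : 1 ≤ (r : ℝ) := by nlinarith
  have hr2 : 2 ≤ (r : ℝ) := by nlinarith
  have hr1' : 1 ≤ r := by exact_mod_cast hr1
  have hrn : (r : ℝ) ≤ n := by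
    rw [hr]
    exact_mod_cast (card_le_univ e).trans (by simp)
  have hdef0 := degDefect_nonneg hW hemin
  have hdefn := degDefect_le W hr1'
  have hsum : ∀ f ∈ W, ∑ v ∈ f, degDefect W r v ≤ f.card * n - ((r : ℝ) - 1) * ((1 - τ) * n) :=
    fun f hf => sum_degDefect_le hr1' (hC.trans (hdeg f hf))
  have hsume : ∑ v ∈ e, degDefect W r v ≤ n * (ε ^ 2 * r) := by
    refine (hsum e heW).trans ?_
    rw [← hr]
    nlinarith
  obtain ⟨N, hN⟩ : ∃ N, N = W.filter fun g => g ≠ e ∧ Meets e g := ⟨_, rfl⟩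
  obtain ⟨A, hA⟩ : ∃ A, A = N.filter fun f => (f.card : ℝ) ≤ (1 + ε) * r := ⟨_, rfl⟩
  have hNW : N ⊆ W := hN ▸ filter_subset _ _
  have hAN : A ⊆ N := hA ▸ filter_subset _ _
  have hAW := hAN.trans hNW
  have hAne : ∀ f ∈ A, f ≠ e ∧ Meets e f := fun f hf => by
    have := hAN hf
    rw [hN, mem_filter] at this
    exact this.2
  have hcardA : (1 - 2 * ε) * n ≤ A.card := by
    have h1 : ((N.filter fun f => ¬(f.card : ℝ) ≤ (1 + ε) * r).card : ℝ) * (ε * r) ≤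
        ∑ f ∈ W.filter (fun f => Meets e f), ((f.card : ℝ) - r) := by
      rw [← nsmul_eq_mul]
      refine le_trans (card_nsmul_le_sum _ (fun f => (f.card : ℝ) - r) _ fun f hf => ?_)
        (sum_le_sum_of_subset_of_nonneg (fun f hf => ?_) fun f hf _ => ?_)
      · have := (mem_filter.1 hf).2
        linarith
      · have := (mem_filter.1 hf).1
        rw [hN, mem_filter] at this
        exact mem_filter.2 ⟨this.1, this.2.2⟩
      · exact sub_nonneg.2 (Nat.cast_le.2 (hemin f (mem_filter.1 hf).1))
    have h2 := h1.trans (sum_filter_meets_le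
      (fun f hf => sub_nonneg.2 (Nat.cast_le.2 (hemin f hf))) e)
    have h3 := h2.trans (sum_le_sum fun v _ => sum_card_sub_le_degDefect hW r v)
    have h4 := h3.trans hsume
    have h5 : ((N.filter fun f => ¬(f.card : ℝ) ≤ (1 + ε) * r).card : ℝ) ≤ ε * n := by
      have : 0 < ε * r := by positivity
      refine le_of_mul_le_mul_right ?_ this
      linarith
    have h6 : (N.card : ℝ) = A.card + (N.filter fun f => ¬(f.card : ℝ) ≤ (1 + ε) * r).card := by
      rw [hA, ← Nat.cast_add, card_filter_add_card_filter_not]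
    have h7 := hdeg e heW
    rw [← hN, h6] at h7
    nlinarith
  refine ⟨r, hr₀r, hemin, ?_, hcardA.trans (Nat.cast_le.2 (card_le_card fun f hf => ?_))⟩
  · have hA2 : (A.card : ℝ) ≤ 2 * n := by
      have h1 : (A.card : ℝ) ≤ ∑ v ∈ e, (degHG W v : ℝ) :=
        le_trans (Nat.cast_le.2 (card_le_card fun f hf => mem_filter.2 ⟨hAW hf, (hAne f hf).2⟩))
          (card_filter_meets_le_sum W e)
      have h2 : ((r : ℝ) - 1) * ∑ v ∈ e, (degHG W v : ℝ) ≤ r * n := by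
        rw [mul_sum, hr, ← nsmul_eq_mul, ← hr]
        nth_rw 2 [hr]
        refine sum_le_card_nsmul _ _ _ fun v _ => ?_
        have := hdef0 v
        rw [degDefect] at this
        linarith
      have h3 := mul_le_mul_of_nonneg_left h1 (by linarith : (0 : ℝ) ≤ (r : ℝ) - 1)
      nlinarith
    have hkey : ∑ v, (degHG A v : ℝ) * degDefect W r v ≤ A.card * (n * (2 * ε * r)) := by
      rw [sum_mul_degHG, ← nsmul_eq_mul]
      refine sum_le_card_nsmul _ _ _ fun f hf => (hsum f (hAW hf)).trans ?_
      have : (f.card : ℝ) ≤ (1 + ε) * r := by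
        rw [hA, mem_filter] at hf
        exact hf.2
      have h1 := mul_le_mul_of_nonneg_right this hn0
      have h2 := mul_le_mul_of_nonneg_right hrr hn0
      have h3 := mul_le_mul_of_nonneg_right hε2 (mul_nonneg hr0 hn0)
      have h4 := mul_nonneg hτ hn0
      linarith
    have hk : (A.card : ℝ) * (r - 1) ≤ ∑ v ∈ univ \ e, (degHG A v : ℝ) := by
      have h1 := sum_mul_degHG A fun v => if v ∈ e then 0 else 1
      have h2 : ∑ v, (degHG A v : ℝ) * (if v ∈ e then 0 else 1) =
          ∑ v ∈ univ \ e, (degHG A v : ℝ) := by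
        rw [sdiff_eq_filter, sum_filter]
        exact sum_congr rfl fun v _ => by split_ifs <;> simp_all
      rw [← h2, h1, ← nsmul_eq_mul]
      refine card_nsmul_le_sum _ _ _ fun f hf => ?_
      have h3 : ∑ v ∈ f, (if v ∈ e then (0 : ℝ) else 1) = (f \ e).card := by
        rw [sdiff_eq_filter, card_eq_sum_ones, sum_filter]
        push_cast
        exact sum_congr rfl fun v _ => by split_ifs <;> simp_all
      rw [h3]
      have h4 := card_sdiff_add_card_inter f e
      have h5 := hW f (hAW hf) e heW (hAne f hf).1
      have h6 := hemin f (hAW hf)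
      have h7 : r ≤ (f \ e).card + 1 := by omega
      have : (r : ℝ) ≤ (f \ e).card + 1 := by exact_mod_cast h7
      linarith
    have hk2 : ∀ v ∈ univ \ e, (degHG A v : ℝ) ≤ r := fun v hv => by
      rw [hr]
      exact_mod_cast degHG_le_card_of_meets (hW.mono hAW) (fun f hf => (hAne f hf).2)
        (mem_sdiff.1 hv).2
    have h1 : ∑ v ∈ univ \ e, r * degDefect W r v ≤
        ∑ v ∈ univ \ e, ((degHG A v : ℝ) * degDefect W r v + (r - degHG A v) * n) :=
      sum_le_sum fun v hv => by nlinarith [hk2 v hv, hdefn v]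
    have h2 : ∑ v ∈ univ \ e, (degHG A v : ℝ) * degDefect W r v ≤ A.card * (n * (2 * ε * r)) :=
      (sum_le_sum_of_subset_of_nonneg (subset_univ _) fun v _ _ =>
        mul_nonneg (Nat.cast_nonneg _) (hdef0 v)).trans hkey
    have h3 : ∑ v ∈ univ \ e, ((r : ℝ) - degHG A v) * n ≤ (n * r - A.card * (r - 1)) * n := by
      rw [← sum_mul, sum_sub_distrib, sum_const, nsmul_eq_mul]
      refine mul_le_mul_of_nonneg_right ?_ hn0
      have : (((univ \ e).card : ℕ) : ℝ) ≤ n := by exact_mod_cast (card_le_univ _).trans (by simp)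
      nlinarith
    rw [sum_add_distrib, ← mul_sum] at h1
    have h4 : ∑ v, degDefect W r v = ∑ v ∈ univ \ e, degDefect W r v + ∑ v ∈ e, degDefect W r v :=
      (sum_sdiff (subset_univ e)).symm
    have hrpos : (0 : ℝ) < r := by linarith
    refine le_of_mul_le_mul_left ?_ hrpos
    rw [h4, mul_add]
    have hn2 : (0 : ℝ) ≤ (n : ℝ) ^ 2 := sq_nonneg _
    have h5 : (r : ℝ) * ∑ v ∈ e, degDefect W r v ≤ r * (n * (ε * n)) :=
      mul_le_mul_of_nonneg_left (hsume.trans (mul_le_mul_of_nonneg_left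
        (mul_le_mul hε2 hrn hr0 hε.le) hn0)) hr0
    have h6 : (A.card : ℝ) * (n * (2 * ε * r)) ≤ 2 * n * (n * (2 * ε * r)) :=
      mul_le_mul_of_nonneg_right hA2 (by positivity)
    have h7 : ((1 - 2 * ε) * n) * ((r : ℝ) - 1) ≤ A.card * (r - 1) :=
      mul_le_mul_of_nonneg_right hcardA (by linarith)
    have h8 := mul_le_mul_of_nonneg_right h7 hn0
    have h9 : 1 ≤ ε * r := by nlinarith
    have h10 := mul_le_mul_of_nonneg_right h9 hn2
    nlinarith [mul_nonneg hε.le hn2]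
  · rw [hA, mem_filter] at hf
    exact mem_filter.2 ⟨hNW hf.1, hf.2⟩

theorem lt_sqrt_of_card_window_le {n r : ℕ} {δ ε : ℝ} (hδ : 0 < δ) (hδ1 : δ ≤ 1) (hε : 0 < ε)
    (hεδ : ε ≤ δ / 8) (hn : 0 < n) {W : Finset (Finset (Fin n))} (hW : LinearHG W)
    (hr : ∀ f ∈ W, r ≤ f.card) (hεr : 1 ≤ ε * r)
    (hcard : (1 - 2 * ε) * n ≤ (W.filter fun f => (f.card : ℝ) ≤ (1 + ε) * r).card)
    (hwin : ((W.filter fun e => (1 - δ) * Real.sqrt n ≤ (e.card : ℝ) ∧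
      (e.card : ℝ) ≤ (1 + δ) * Real.sqrt n).card : ℝ) ≤ (1 - 3 * δ) * n) :
    (r : ℝ) < (1 - δ) * Real.sqrt n := by
  by_contra! hlow
  have hn' : (0 : ℝ) < n := by exact_mod_cast hn
  have hr1 : 1 ≤ (r : ℝ) := by nlinarith
  have h1 : ((W.filter fun f => (f.card : ℝ) ≤ (1 + ε) * r).card : ℝ) * (r * (r - 1)) ≤
      (n : ℝ) ^ 2 := by
    refine le_trans ?_ (sum_card_mul_card_sub_one_le hW)
    rw [← nsmul_eq_mul]
    refine le_trans (card_nsmul_le_sum _ (fun f => (f.card : ℝ) * (f.card - 1)) _ fun f hf => ?_)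
      (sum_le_sum_of_subset_of_nonneg (filter_subset _ _) fun f hf _ => ?_)
    · have : (r : ℝ) ≤ f.card := Nat.cast_le.2 (hr f (mem_filter.1 hf).1)
      nlinarith
    · have : (r : ℝ) ≤ f.card := Nat.cast_le.2 (hr f hf)
      nlinarith
  have h2 : (1 - 2 * ε) * (r * (r - 1)) ≤ n := by
    have := mul_le_mul_of_nonneg_right hcard (by nlinarith : (0 : ℝ) ≤ r * (r - 1))
    refine le_of_mul_le_mul_left ?_ hn'
    nlinarith
  have h3 : (1 - 3 * ε) * (r : ℝ) ^ 2 ≤ n := by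
    have h4 : (1 - ε) * (r : ℝ) ^ 2 ≤ r * (r - 1) := by nlinarith
    have h5 := mul_le_mul_of_nonneg_left h4 (by linarith : (0 : ℝ) ≤ 1 - 2 * ε)
    nlinarith [mul_nonneg (sq_nonneg ε) (sq_nonneg (r : ℝ))]
  have h4 : (1 + ε) ^ 2 ≤ (1 + δ) ^ 2 * (1 - 3 * ε) := by
    have h5 : (1 + ε) ^ 2 ≤ (1 + δ / 8) ^ 2 := by gcongr
    have h6 : (1 + δ) ^ 2 * (1 - 3 * (δ / 8)) ≤ (1 + δ) ^ 2 * (1 - 3 * ε) := by gcongr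
    nlinarith [mul_nonneg hδ.le (sub_nonneg.2 hδ1),
      mul_nonneg (mul_nonneg hδ.le hδ.le) (sub_nonneg.2 hδ1)]
  have h5 : (1 + ε) * r ≤ (1 + δ) * Real.sqrt n := by
    refine (pow_le_pow_iff_left₀ (by positivity) (by positivity) two_ne_zero).1 ?_
    rw [mul_pow, mul_pow, Real.sq_sqrt hn'.le]
    calc (1 + ε) ^ 2 * (r : ℝ) ^ 2 ≤ (1 + δ) ^ 2 * (1 - 3 * ε) * (r : ℝ) ^ 2 := by gcongr
      _ = (1 + δ) ^ 2 * ((1 - 3 * ε) * (r : ℝ) ^ 2) := by ring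
      _ ≤ _ := by gcongr
  have h6 := hcard.trans ((Nat.cast_le.2 (card_le_card fun f hf => ?_)).trans hwin)
  · nlinarith
  · rw [mem_filter] at hf ⊢
    exact ⟨hf.1, hlow.trans (Nat.cast_le.2 (hr f hf.1)), hf.2.trans h5⟩

theorem sum_degDefect_eq {n : ℕ} (H : Finset (Finset (Fin n))) (r : ℕ) :
    ∑ v, degDefect H r v = (n : ℝ) ^ 2 - ∑ f ∈ H, (f.card : ℝ) * (r - 1) := by
  have h := sum_mul_degHG H fun _ => (r : ℝ) - 1
  simp only [sum_const, nsmul_eq_mul] at h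
  rw [← h]
  simp only [degDefect, sum_sub_distrib, sum_const, card_univ, Fintype.card_fin, nsmul_eq_mul, sq,
    mul_comm]

theorem exists_isListColoring_of_sum_lt {n r₀ C : ℕ} {ε τ : ℝ} (hε : 0 < ε) (hε1 : ε ≤ 1 / 16)
    (hτ : 0 ≤ τ) (hr₀ : 1 ≤ (ε ^ 2 - τ) * r₀) {R : Finset (Finset (Fin n))} (hR : LinearHG R)
    (hsize : ∀ f ∈ R, r₀ ≤ f.card) (hC : (1 - τ) * n ≤ C)
    (hsum : ∑ f ∈ R, (f.card : ℝ) * (f.card - 1) < (n : ℝ) ^ 2 / 2) :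
    ∃ ψ, IsListColoring Meets (fun _ => range C) R ψ := by
  obtain ⟨W, hWR, hdeg, hext⟩ := exists_core (adj := Meets (n := n)) Meets.symm (fun _ => range C) R
  refine hext ?_
  rcases W.eq_empty_or_nonempty with rfl | hne
  · exact ⟨fun _ => 0, by simp [IsListColoring]⟩
  obtain ⟨r, -, hr, hdef, -⟩ := exists_sum_degDefect_le hε (by linarith) hτ hr₀ (hR.mono hWR) hne
    (fun f hf => hsize f (hWR hf)) hC (fun f hf => by
      have := hdeg f hf
      rw [card_range] at this
      exact Nat.cast_le.2 this)
  have h1 : ∑ f ∈ W, (f.card : ℝ) * (r - 1) ≤ ∑ f ∈ R, (f.card : ℝ) * (f.card - 1) := by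
    refine (sum_le_sum fun f hf => ?_).trans (sum_le_sum_of_subset_of_nonneg hWR fun f _ _ => ?_)
    · have : (r : ℝ) ≤ f.card := Nat.cast_le.2 (hr f hf)
      gcongr
    · rcases Nat.eq_zero_or_pos f.card with h | h
      · simp [h]
      · have : (1 : ℝ) ≤ f.card := by exact_mod_cast h
        exact mul_nonneg (by positivity) (by linarith)
  rw [sum_degDefect_eq] at hdef
  nlinarith [sq_nonneg (n : ℝ)]

section Defect

variable {n r : ℕ} {W : Finset (Finset (Fin n))}

theorem mul_degHG_le_degDefect (hW : LinearHG W) (hr : ∀ f ∈ W, r ≤ f.card) (β : ℝ) (v : Fin n) :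
    β * r * degHG (W.filter fun f => ¬(f.card : ℝ) ≤ (1 + β) * r) v ≤ degDefect W r v := by
  refine le_trans ?_ (sum_card_sub_le_degDefect hW r v)
  rw [degHG, mul_comm, ← nsmul_eq_mul]
  refine le_trans (card_nsmul_le_sum _ (fun f => (f.card : ℝ) - r) _ fun f hf => ?_)
    (sum_le_sum_of_subset_of_nonneg (filter_subset_filter _ (filter_subset _ _)) fun f hf _ =>
      sub_nonneg.2 (Nat.cast_le.2 (hr f (mem_filter.1 hf).1)))
  have := (mem_filter.1 (mem_filter.1 hf).1).2
  linarith

theorem mul_sum_card_le_degDefect (hW : LinearHG W) (hr : ∀ f ∈ W, r ≤ f.card) {β : ℝ}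
    (hβ : 0 < β) (hβ1 : β ≤ 1) (v : Fin n) :
    β * ∑ f ∈ (W.filter fun f => ¬(f.card : ℝ) ≤ (1 + β) * r).filter (fun f => v ∈ f),
      ((f.card : ℝ) - 1) ≤ 2 * degDefect W r v := by
  refine le_trans ?_ (mul_le_mul_of_nonneg_left (sum_card_sub_le_degDefect hW r v) zero_le_two)
  rw [mul_sum, mul_sum]
  refine (sum_le_sum fun f hf => ?_).trans
    (sum_le_sum_of_subset_of_nonneg (filter_subset_filter _ (filter_subset _ _)) fun f hf _ =>
      mul_nonneg zero_le_two (sub_nonneg.2 (Nat.cast_le.2 (hr f (mem_filter.1 hf).1))))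
  have h := (mem_filter.1 (mem_filter.1 hf).1).2
  have hr0 : (0 : ℝ) ≤ r := Nat.cast_nonneg r
  nlinarith [mul_nonneg (mul_nonneg hβ.le (sub_nonneg.2 hβ1)) hr0]

theorem mul_degHG_le_sum_degDefect (hW : LinearHG W) (hr1 : 1 ≤ r) (hr : ∀ f ∈ W, r ≤ f.card)
    {γ : ℝ} (hγ : 2 ≤ γ * r) {R : Finset (Finset (Fin n))} (hRW : R ⊆ W)
    (hR : ∀ f ∈ R, γ * r * n ≤ ∑ v ∈ f, degDefect W r v) (v : Fin n) :
    γ * r * n * degHG R v ≤ 2 * ∑ u, degDefect W r u := by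
  have h := sum_sum_erase_le (hW.mono hRW) (degDefect_nonneg hW hr) v
  have h2 : (degHG R v : ℝ) * (γ * r * n - n) ≤ ∑ u, degDefect W r u := by
    refine le_trans ?_ h
    rw [degHG, ← nsmul_eq_mul]
    refine card_nsmul_le_sum _ _ _ fun f hf => ?_
    obtain ⟨hfR, hv⟩ := mem_filter.1 hf
    have h3 := hR f hfR
    rw [← add_sum_erase f _ hv] at h3
    linarith [degDefect_le W hr1 v]
  have h3 : (n : ℝ) ≤ γ * r * n / 2 := by nlinarith [(Nat.cast_nonneg n : (0 : ℝ) ≤ n)]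
  nlinarith [(Nat.cast_nonneg (degHG R v) : (0 : ℝ) ≤ degHG R v)]

theorem exists_good_subset (hW : LinearHG W) (hr1 : 1 ≤ r) (hr : ∀ f ∈ W, r ≤ f.card)
    {β γ κ : ℝ} (hβ : 0 < β) (hβ1 : β ≤ 1) (hγ0 : 0 < γ) (hγ : 2 ≤ γ * r)
    (hdef : ∑ v, degDefect W r v ≤ κ * (n : ℝ) ^ 2) :
    ∃ G ⊆ W, (∀ f ∈ G, (f.card : ℝ) ≤ (1 + β) * r) ∧
      (∀ f ∈ G, (((W \ G).filter fun g => Meets f g).card : ℝ) ≤ (γ / β + 4 * κ / γ) * n) ∧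
      ∑ f ∈ W \ G, (f.card : ℝ) * (f.card - 1) ≤ (2 * κ / β + 4 * κ / γ) * (n : ℝ) ^ 2 := by
  rcases Nat.eq_zero_or_pos n with hn | hn
  · subst hn
    refine ⟨∅, empty_subset _, by simp, by simp, ?_⟩
    refine le_trans (le_of_eq (sum_eq_zero fun f _ => ?_)) (by simp)
    have : f.card = 0 := by simpa using card_le_univ f
    simp [this]
  have hn' : (0 : ℝ) < n := by exact_mod_cast hn
  have hr' : (0 : ℝ) < r := by exact_mod_cast hr1
  obtain ⟨R₁, hR₁⟩ : ∃ R, R = W.filter fun f => ¬(f.card : ℝ) ≤ (1 + β) * r := ⟨_, rfl⟩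
  obtain ⟨R₂, hR₂⟩ : ∃ R, R = W.filter fun f => (f.card : ℝ) ≤ (1 + β) * r ∧
    γ * r * n ≤ ∑ v ∈ f, degDefect W r v := ⟨_, rfl⟩
  obtain ⟨G, hG⟩ : ∃ G, G = W.filter fun f => (f.card : ℝ) ≤ (1 + β) * r ∧
    ∑ v ∈ f, degDefect W r v < γ * r * n := ⟨_, rfl⟩
  have hsplit : W \ G ⊆ R₁ ∪ R₂ := by
    intro f hf
    rw [hG, mem_sdiff, mem_filter, not_and, not_and, not_lt] at hf
    rw [hR₁, hR₂, mem_union, mem_filter, mem_filter]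
    by_cases h : (f.card : ℝ) ≤ (1 + β) * r
    · exact Or.inr ⟨hf.1, h, hf.2 hf.1 h⟩
    · exact Or.inl ⟨hf.1, h⟩
  have hd₁ : ∀ v, (degHG R₁ v : ℝ) ≤ degDefect W r v / (β * r) := fun v => by
    rw [le_div_iff₀ (by positivity), mul_comm]
    exact hR₁ ▸ mul_degHG_le_degDefect hW hr β v
  have hd₂ : ∀ v, (degHG R₂ v : ℝ) ≤ 2 * κ / γ * n / r := fun v => by
    have h := mul_degHG_le_sum_degDefect hW hr1 hr hγ (R := R₂) (hR₂ ▸ filter_subset _ _)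
      (fun f hf => by rw [hR₂, mem_filter] at hf; exact hf.2.2) v
    rw [le_div_iff₀ hr', div_mul_eq_mul_div, le_div_iff₀ hγ0]
    refine le_of_mul_le_mul_right ?_ hn'
    nlinarith
  have hP₁ : ∑ f ∈ R₁, (f.card : ℝ) * (f.card - 1) ≤ 2 * κ / β * (n : ℝ) ^ 2 := by
    have h : ∑ v, β * ∑ f ∈ R₁.filter (fun f => v ∈ f), ((f.card : ℝ) - 1) ≤
        ∑ v, 2 * degDefect W r v :=
      sum_le_sum fun v _ => hR₁ ▸ mul_sum_card_le_degDefect hW hr hβ hβ1 v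
    rw [← mul_sum, ← mul_sum, sum_sum_filter_mem R₁ fun f _ => (f.card : ℝ) - 1] at h
    simp only [sum_const, nsmul_eq_mul] at h
    rw [div_mul_eq_mul_div, le_div_iff₀ hβ]
    linarith
  have hP₂ : ∑ f ∈ R₂, (f.card : ℝ) * (f.card - 1) ≤ 4 * κ / γ * (n : ℝ) ^ 2 := by
    have h : ∑ f ∈ R₂, (f.card : ℝ) * (f.card - 1) ≤ ∑ f ∈ R₂, (f.card : ℝ) * (2 * r) := by
      refine sum_le_sum fun f hf => ?_
      have : (f.card : ℝ) ≤ (1 + β) * r := by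
        rw [hR₂, mem_filter] at hf
        exact hf.2.1
      gcongr
      nlinarith
    refine h.trans ?_
    have h2 := sum_mul_degHG R₂ fun _ => 2 * (r : ℝ)
    simp only [sum_const, nsmul_eq_mul] at h2
    rw [← h2]
    have h3 : ∑ v, (degHG R₂ v : ℝ) * (2 * r) ≤ ∑ _v : Fin n, 4 * κ / γ * n := by
      refine sum_le_sum fun v _ => ?_
      have := mul_le_mul_of_nonneg_right (hd₂ v) (by positivity : (0 : ℝ) ≤ 2 * r)
      refine this.trans (le_of_eq ?_)
      field_simp
      ring
    refine h3.trans (le_of_eq ?_)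
    rw [sum_const, card_univ, Fintype.card_fin, nsmul_eq_mul]
    ring
  have hκ : 0 ≤ κ := by
    have := (sum_nonneg fun v _ => degDefect_nonneg hW hr v).trans hdef
    exact nonneg_of_mul_nonneg_left this (by positivity)
  have hpair : ∀ f : Finset (Fin n), 0 ≤ (f.card : ℝ) * (f.card - 1) := fun f => by
    rcases Nat.eq_zero_or_pos f.card with h | h
    · simp [h]
    · have : (1 : ℝ) ≤ f.card := by exact_mod_cast h
      exact mul_nonneg (by positivity) (by linarith)
  refine ⟨G, hG ▸ filter_subset _ _, fun f hf => ?_, fun f hf => ?_, ?_⟩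
  · rw [hG, mem_filter] at hf
    exact hf.2.1
  · rw [hG, mem_filter] at hf
    have h1 : (((W \ G).filter fun g => Meets f g).card : ℝ) ≤
        (R₁.filter fun g => Meets f g).card + (R₂.filter fun g => Meets f g).card := by
      rw [← Nat.cast_add, Nat.cast_le]
      refine (card_le_card (filter_subset_filter _ hsplit)).trans ?_
      rw [filter_union]
      exact card_union_le _ _
    have h2 : ∑ v ∈ f, (degHG R₁ v : ℝ) ≤ γ / β * n := by
      refine (sum_le_sum fun v _ => hd₁ v).trans ?_
      rw [← sum_div, div_le_iff₀ (by positivity)]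
      refine hf.2.2.le.trans (le_of_eq ?_)
      field_simp
    have h3 : ∑ v ∈ f, (degHG R₂ v : ℝ) ≤ 4 * κ / γ * n := by
      refine (sum_le_card_nsmul _ _ _ fun v _ => hd₂ v).trans ?_
      rw [nsmul_eq_mul]
      calc (f.card : ℝ) * (2 * κ / γ * n / r) ≤ (2 * r) * (2 * κ / γ * n / r) := by
            gcongr
            nlinarith [hf.2.1]
        _ = _ := by
            field_simp
            ring
    rw [add_mul]
    linarith [card_filter_meets_le_sum R₁ f, card_filter_meets_le_sum R₂ f]
  · rw [add_mul]
    refine (sum_le_sum_of_subset_of_nonneg hsplit fun f _ _ => hpair f).trans ?_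
    have := sum_union_inter (s₁ := R₁) (s₂ := R₂) (f := fun f => (f.card : ℝ) * (f.card - 1))
    have h2 : 0 ≤ ∑ f ∈ R₁ ∩ R₂, (f.card : ℝ) * (f.card - 1) := sum_nonneg fun f _ => hpair f
    linarith

end Defect

theorem card_filter_meets_meets_le {n : ℕ} {H : Finset (Finset (Fin n))} (hH : LinearHG H)
    {e f : Finset (Fin n)} (he : e ∈ H) (hf : f ∈ H) (hef : e ≠ f) {x : Fin n} (hxe : x ∈ e)
    (hxf : x ∈ f) : (H.filter fun g => Meets e g ∧ Meets f g).card ≤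
      degHG H x + e.card * f.card := by
  have hsub : (H.filter fun g => Meets e g ∧ Meets f g) ⊆
      (H.filter fun g => x ∈ g) ∪ H.filter fun g => x ∉ g ∧ Meets e g ∧ Meets f g := by
    intro g hg
    rw [mem_union, mem_filter, mem_filter]
    rw [mem_filter] at hg
    tauto
  refine (card_le_card hsub).trans ((card_union_le _ _).trans (Nat.add_le_add_left ?_ _))
  rw [← card_product]
  have hu : ∀ g ∈ H.filter fun g => x ∉ g ∧ Meets e g ∧ Meets f g,
      ∃ p : Fin n × Fin n, p ∈ e ×ˢ f ∧ p.1 ≠ p.2 ∧ p.1 ∈ g ∧ p.2 ∈ g := by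
    intro g hg
    obtain ⟨-, hxg, ⟨u, hu⟩, w, hw⟩ := mem_filter.1 hg
    rw [mem_inter] at hu hw
    refine ⟨(u, w), mem_product.2 ⟨hu.1, hw.1⟩, fun huw => hxg ?_, hu.2, hw.2⟩
    simp only at huw
    subst huw
    exact card_le_one.1 (hH e he f hf hef) u (mem_inter.2 ⟨hu.1, hw.1⟩) x
      (mem_inter.2 ⟨hxe, hxf⟩) ▸ hu.2
  have : Nonempty (Fin n × Fin n) := ⟨(x, x)⟩
  choose! p hp using hu
  refine card_le_card_of_injOn p (fun g hg => (hp g hg).1) fun g hg g' hg' h => ?_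
  by_contra hne
  have h1 := hp g hg
  have h2 := hp g' hg'
  rw [← h] at h2
  exact h1.2.1 (card_le_one.1 (hH g (mem_filter.1 hg).1 g' (mem_filter.1 hg').1 hne) _
    (mem_inter.2 ⟨h1.2.2.1, h2.2.2.1⟩) _ (mem_inter.2 ⟨h1.2.2.2, h2.2.2.2⟩))

/-- The graph whose vertices are the edges of `H`, adjacent when they share a vertex. -/
def meetGraph {n : ℕ} (H : Finset (Finset (Fin n))) : SimpleGraph H where
  Adj e f := e ≠ f ∧ Meets e.1 f.1
  symm := ⟨fun _ _ h => ⟨h.1.symm, Meets.symm _ _ h.2⟩⟩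
  loopless := ⟨fun _ h => h.1 rfl⟩

theorem card_nbrs_meetGraph {n : ℕ} (H : Finset (Finset (Fin n))) (e : H) :
    (nbrs (meetGraph H) e).card = (H.filter fun f => f ≠ e.1 ∧ Meets e.1 f).card := by
  rw [← card_image_of_injective _ Subtype.val_injective]
  congr 1
  ext f
  simp only [mem_image, mem_nbrs, meetGraph, mem_filter]
  constructor
  · rintro ⟨g, ⟨h1, h2⟩, rfl⟩
    exact ⟨g.2, fun h => h1 (Subtype.ext h.symm), h2⟩
  · rintro ⟨h1, h2, h3⟩
    exact ⟨⟨f, h1⟩, ⟨fun h => h2 (congrArg Subtype.val h).symm, h3⟩, rfl⟩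

theorem card_nbrs_meetGraph_le {n : ℕ} {H : Finset (Finset (Fin n))} (hH : LinearHG H) {e f : H}
    (hef : e ≠ f) {x : Fin n} (hxe : x ∈ e.1) (hxf : x ∈ f.1) :
    (nbrs (meetGraph H) e).card ≤
      ((nbrs (meetGraph H) e).filter fun g => g ≠ f ∧ ¬(meetGraph H).Adj f g).card +
        (degHG H x + e.1.card * f.1.card) + 1 := by
  have h1 := card_filter_meets_meets_le hH e.2 f.2 (fun h => hef (Subtype.ext h)) hxe hxf
  have h2 : nbrs (meetGraph H) e ⊆
      ((nbrs (meetGraph H) e).filter fun g => g ≠ f ∧ ¬(meetGraph H).Adj f g) ∪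
        (univ.filter fun g : H => Meets e.1 g.1 ∧ Meets f.1 g.1) ∪ {f} := by
    intro g hg
    simp only [mem_union, mem_filter, hg, mem_univ, true_and, mem_singleton]
    have h3 := (mem_nbrs.1 hg).2
    by_cases hgf : g = f
    · exact Or.inr hgf
    · by_cases ha : (meetGraph H).Adj f g
      · exact Or.inl (Or.inr ⟨h3, ha.2⟩)
      · exact Or.inl (Or.inl ⟨hgf, ha⟩)
  have h4 : (univ.filter fun g : H => Meets e.1 g.1 ∧ Meets f.1 g.1).card ≤
      (H.filter fun g => Meets e.1 g ∧ Meets f.1 g).card :=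
    card_le_card_of_injOn Subtype.val (fun g hg => mem_filter.2 ⟨g.2, (mem_filter.1 hg).2⟩)
      Subtype.val_injective.injOn
  have h5 := card_le_card h2
  have h6 := card_union_le ((nbrs (meetGraph H) e).filter
    fun g => g ≠ f ∧ ¬(meetGraph H).Adj f g)
    (univ.filter fun g : H => Meets e.1 g.1 ∧ Meets f.1 g.1)
  have h7 := card_union_le (((nbrs (meetGraph H) e).filter
    fun g => g ≠ f ∧ ¬(meetGraph H).Adj f g) ∪
      (univ.filter fun g : H => Meets e.1 g.1 ∧ Meets f.1 g.1)) {f}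
  rw [card_singleton] at h7
  omega

theorem exists_isListColoring_union {n C : ℕ} {G R : Finset (Finset (Fin n))}
    {ψ : Finset (Fin n) → ℕ} (hψ : IsListColoring Meets (fun _ => range C) R ψ)
    (h : ∃ φ, IsListColoring (meetGraph G).Adj
      (fun e => range C \ (R.filter fun g => Meets e.1 g).image ψ) univ φ) :
    ∃ φ, IsListColoring Meets (fun _ => range C) (G ∪ R) φ := by
  obtain ⟨φ, hφL, hφ⟩ := h
  have hne : ∀ (e : G) (f : Finset (Fin n)), f ∈ R → Meets e.1 f → φ e ≠ ψ f := fun e f hf hef h =>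
    (mem_sdiff.1 (hφL e (mem_univ _))).2 (mem_image.2 ⟨f, mem_filter.2 ⟨hf, hef⟩, h.symm⟩)
  refine ⟨fun f => if hf : f ∈ G then φ ⟨f, hf⟩ else ψ f, fun f hf => ?_,
    fun f hf g hg hfg hadj => ?_⟩
  · simp only
    split_ifs with hfG
    · exact (mem_sdiff.1 (hφL ⟨f, hfG⟩ (mem_univ _))).1
    · exact hψ.1 f ((mem_union.1 hf).resolve_left hfG)
  · simp only
    split_ifs with hfG hgG hgG
    · exact hφ _ (mem_univ _) _ (mem_univ _) (fun h => hfg (congrArg Subtype.val h))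
        ⟨fun h => hfg (congrArg Subtype.val h), hadj⟩
    · exact hne ⟨f, hfG⟩ g ((mem_union.1 hg).resolve_left hgG) hadj
    · exact (hne ⟨g, hgG⟩ f ((mem_union.1 hf).resolve_left hfG) (Meets.symm _ _ hadj)).symm
    · exact hψ.2 f ((mem_union.1 hf).resolve_left hfG) g ((mem_union.1 hg).resolve_left hgG) hfg
        hadj

theorem card_le_sq_of_two_le {n : ℕ} {H : Finset (Finset (Fin n))} (hH : LinearHG H)
    (h : ∀ e ∈ H, 2 ≤ e.card) : (H.card : ℝ) ≤ (n : ℝ) ^ 2 := by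
  refine le_trans ?_ (sum_card_mul_card_sub_one_le hH)
  rw [← mul_one (H.card : ℝ), ← nsmul_eq_mul]
  refine card_nsmul_le_sum _ _ _ fun e he => ?_
  have : (2 : ℝ) ≤ e.card := by exact_mod_cast h e he
  nlinarith

set_option maxHeartbeats 1000000 in
/-- A linear hypergraph of large edges with few edges of size about `√n` can be coloured with
slightly fewer than `n` colours. -/
theorem eventually_exists_coloring_of_large (δ : ℝ) (hδ : 0 < δ) (hδ1 : δ ≤ 1 / 3) :
    ∃ τ > (0 : ℝ), ∃ r₀ : ℕ, ∀ᶠ n : ℕ in Filter.atTop, ∀ (H : Finset (Finset (Fin n))) (C : ℕ),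
      LinearHG H → (∀ e ∈ H, r₀ ≤ e.card) →
      (((H.filter fun e => (1 - δ) * Real.sqrt n ≤ (e.card : ℝ) ∧
        (e.card : ℝ) ≤ (1 + δ) * Real.sqrt n).card : ℝ) ≤ (1 - 3 * δ) * n) →
      (1 - τ) * n ≤ C → C ≤ n → ∃ ψ, IsListColoring Meets (fun _ => range C) H ψ := by
  obtain ⟨ε₀, hε₀, hsparse⟩ := eventually_exists_isListColoring_of_sparse (δ / 2) (by positivity)
  obtain ⟨s, hs, hsε, hsδ⟩ : ∃ s : ℝ, 0 < s ∧ s ≤ ε₀ ∧ s ≤ δ / 16 :=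
    ⟨min ε₀ (δ / 16), by positivity, min_le_left _ _, min_le_right _ _⟩
  obtain ⟨β, hβ, hβs⟩ : ∃ β : ℝ, 0 < β ∧ β = s / 8 := ⟨_, by positivity, rfl⟩
  obtain ⟨γ, hγ, hγβ⟩ : ∃ γ : ℝ, 0 < γ ∧ γ = β * s / 4 := ⟨_, by positivity, rfl⟩
  obtain ⟨κ, hκ, hκγ⟩ : ∃ κ : ℝ, 0 < κ ∧ κ = γ * s / 32 := ⟨_, by positivity, rfl⟩
  obtain ⟨ε, hε, hεκ⟩ : ∃ ε : ℝ, 0 < ε ∧ ε = κ / 8 := ⟨_, by positivity, rfl⟩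
  have hs1 : s ≤ 1 / 48 := by linarith
  have hγs : γ ≤ s := by rw [hγβ]; nlinarith
  have hκs : κ ≤ s := by rw [hκγ]; nlinarith
  obtain ⟨r₀, hr₀⟩ := exists_nat_ge (2 / ε ^ 2 + 2 / γ + 100 / s)
  have hp1 : 0 < 2 / ε ^ 2 := by positivity
  have hp2 : 0 < 2 / γ := by positivity
  have hp3 : 0 < 100 / s := by positivity
  have hr₀ε : 1 ≤ (ε ^ 2 - ε ^ 2 / 2) * r₀ := by
    have : 2 / ε ^ 2 ≤ r₀ := by linarith
    rw [div_le_iff₀ (by positivity)] at this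
    linarith
  have hr₀γ : 2 ≤ γ * r₀ := by
    have : 2 / γ ≤ r₀ := by linarith
    rw [div_le_iff₀ (by positivity)] at this
    linarith
  have hr₀s : 100 ≤ s * r₀ := by
    have : 100 / s ≤ r₀ := by linarith
    rw [div_le_iff₀ (by positivity)] at this
    linarith
  refine ⟨ε ^ 2 / 2, by positivity, r₀, ?_⟩
  filter_upwards [tendsto_natCast_atTop_atTop.eventually hsparse,
    Filter.eventually_ge_atTop ⌈1 / s⌉₊, Filter.eventually_gt_atTop 0] with n hn hns hn0
  intro H C hH hsize hwin hC hCn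
  have hn0' : (0 : ℝ) < n := by exact_mod_cast hn0
  have hn1 : (1 : ℝ) ≤ n := by exact_mod_cast hn0
  have hns' : 1 ≤ s * n := by
    have := (Nat.le_ceil (1 / s)).trans (Nat.cast_le.2 hns)
    rw [div_le_iff₀ hs] at this
    linarith
  obtain ⟨W, hWH, hdeg, hext⟩ := exists_core (adj := Meets (n := n)) Meets.symm (fun _ => range C) H
  refine hext ?_
  rcases W.eq_empty_or_nonempty with rfl | hne
  · exact ⟨fun _ => 0, by simp [IsListColoring]⟩
  have hW := hH.mono hWH
  have hε1 : ε ≤ 1 / 16 := by linarith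
  have hτ : 0 ≤ ε ^ 2 / 2 := by positivity
  obtain ⟨r, hrr₀, hr, hdef, hcard⟩ := exists_sum_degDefect_le hε (by linarith) hτ hr₀ε hW hne
    (fun f hf => hsize f (hWH hf)) hC (fun f hf => by
      have := hdeg f hf
      rw [card_range] at this
      exact Nat.cast_le.2 this)
  have hrr₀' : (r₀ : ℝ) ≤ r := Nat.cast_le.2 hrr₀
  have hrγ : 2 ≤ γ * r := hr₀γ.trans (by gcongr)
  have hrs : 100 ≤ s * r := hr₀s.trans (by gcongr)
  have hr1 : (100 : ℝ) ≤ r := by nlinarith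
  have hr1' : 1 ≤ r := by
    have : (1 : ℝ) ≤ r := by linarith
    exact_mod_cast this
  have hεr : 1 ≤ ε * r := by
    have h1 : 1 ≤ ε ^ 2 * r := by
      refine hr₀ε.trans ?_
      gcongr
      linarith
    nlinarith
  have hlt := lt_sqrt_of_card_window_le hδ (by linarith) hε (by linarith) hn0 hW hr hεr hcard
    ((Nat.cast_le.2 (card_le_card (filter_subset_filter _ hWH))).trans hwin)
  have hrsq : (r : ℝ) ^ 2 ≤ (1 - δ) ^ 2 * n := by
    rw [← Real.sq_sqrt hn0'.le, ← mul_pow]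
    exact pow_le_pow_left₀ (Nat.cast_nonneg _) hlt.le 2
  obtain ⟨G, hGW, hGsize, hGR, hR⟩ := exists_good_subset (κ := κ) hW hr1' hr hβ (by linarith) hγ
    hrγ (hdef.trans (le_of_eq (by rw [hεκ]; ring)))
  have h4κ : 4 * κ / γ = s / 8 := by
    rw [hκγ]
    field_simp
    norm_num
  have hγβ' : γ / β = s / 4 := by
    rw [hγβ]
    field_simp
  have hκβ : 2 * κ / β ≤ 2 * κ / γ := by
    gcongr
    rw [hγβ]
    nlinarith
  have h2κ : 2 * κ / γ = s / 16 := by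
    rw [hκγ]
    field_simp
    norm_num
  obtain ⟨ψ, hψ⟩ := exists_isListColoring_of_sum_lt hε hε1 hτ hr₀ε (hW.mono sdiff_subset)
    (fun f hf => hsize f (hWH (sdiff_subset hf))) hC (hR.trans_lt (by
      have : (2 * κ / β + 4 * κ / γ) * (n : ℝ) ^ 2 ≤ 1 / 4 * (n : ℝ) ^ 2 := by
        gcongr
        linarith
      refine this.trans_lt ?_
      have : 0 < (n : ℝ) ^ 2 := by positivity
      linarith))
  have hG := hW.mono hGW
  have hGdeg : ∀ v, ((r : ℝ) - 1) * degHG G v ≤ n := fun v => by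
    have := degDefect_nonneg hG (fun f hf => hr f (hGW hf)) v
    rw [degDefect] at this
    linarith
  have hL : ∀ f : G, (1 - s) * n ≤
      (range C \ ((W \ G).filter fun g => Meets f.1 g).image ψ).card := fun f => by
    have h1 := hGR f.1 f.2
    have h2 := le_card_sdiff (((W \ G).filter fun g => Meets f.1 g).image ψ) (range C)
    rw [card_range] at h2
    have h3 : (C : ℝ) ≤ (range C \ ((W \ G).filter fun g => Meets f.1 g).image ψ).card +
        ((W \ G).filter fun g => Meets f.1 g).card := by
      have := card_image_le (s := (W \ G).filter fun g => Meets f.1 g) (f := ψ)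
      exact_mod_cast (by omega)
    rw [h4κ, hγβ'] at h1
    have h5 : ε ^ 2 / 2 * n ≤ s / 16 * n := by
      refine mul_le_mul_of_nonneg_right ?_ hn0'.le
      nlinarith
    linarith
  have hcross : ∀ e f : G, (e.1.card : ℝ) * f.1.card ≤ (1 - δ) * n := fun e f => by
    have h1 := hGsize e.1 e.2
    have h2 := hGsize f.1 f.2
    have h3 : (1 + β) ^ 2 * (1 - δ) ≤ 1 := by nlinarith
    calc (e.1.card : ℝ) * f.1.card ≤ ((1 + β) * r) * ((1 + β) * r) := by gcongr
      _ = (1 + β) ^ 2 * (r : ℝ) ^ 2 := by ring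
      _ ≤ (1 + β) ^ 2 * ((1 - δ) ^ 2 * n) := by gcongr
      _ = ((1 + β) ^ 2 * (1 - δ)) * ((1 - δ) * n) := by ring
      _ ≤ 1 * ((1 - δ) * n) := by
          have : 0 ≤ 1 - δ := by linarith
          gcongr
      _ = _ := one_mul _
  suffices h : ∃ φ, IsListColoring Meets (fun _ => range C) (G ∪ W \ G) φ by
    rwa [union_sdiff_of_subset hGW] at h
  refine exists_isListColoring_union hψ (hn _ _ C (fun _ => sdiff_subset) (Nat.cast_le.2 hCn)
    (fun f => ?_) (fun f => ?_) (fun e he f hf => ?_) ?_)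
  · refine le_trans ?_ (hL f)
    gcongr
  · refine le_trans ?_ (mul_le_mul_of_nonneg_right (by linarith : 1 + s ≤ 1 + ε₀) hn0'.le)
    rw [card_nbrs_meetGraph]
    have h1 : ((G.filter fun g => g ≠ f.1 ∧ Meets f.1 g).card : ℝ) ≤ ∑ v ∈ f.1, (degHG G v : ℝ) :=
      le_trans (Nat.cast_le.2 (card_le_card fun g hg => by
        rw [mem_filter] at hg ⊢
        exact ⟨hg.1, hg.2.2⟩)) (card_filter_meets_le_sum G f.1)
    have h2 : ((r : ℝ) - 1) * ∑ v ∈ f.1, (degHG G v : ℝ) ≤ f.1.card * n := by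
      rw [mul_sum, ← nsmul_eq_mul]
      exact sum_le_card_nsmul _ _ _ fun v _ => hGdeg v
    have h3 := mul_le_mul_of_nonneg_right (hGsize f.1 f.2) hn0'.le
    have hr1'' : (0 : ℝ) < (r : ℝ) - 1 := by linarith
    have h4 := mul_le_mul_of_nonneg_left h1 hr1''.le
    refine le_of_mul_le_mul_left (h4.trans (h2.trans (h3.trans ?_))) hr1''
    rw [← mul_assoc]
    refine mul_le_mul_of_nonneg_right ?_ hn0'.le
    rw [hβs]
    linarith
  · have hadj := mem_nbrs.1 hf
    obtain ⟨x, hx⟩ := hadj.2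
    rw [mem_inter] at hx
    have h1 := card_nbrs_meetGraph_le hG hadj.1 hx.1 hx.2
    have h2 := (hL e).trans (Nat.cast_le.2 (he.trans h1))
    push_cast at h2
    have h3 := hcross e f
    have h4 : (degHG G x : ℝ) ≤ s * n := by
      have h5 := hGdeg x
      have h6 : 1 ≤ s * (r - 1) := by linarith
      have h7 := mul_le_mul_of_nonneg_left h5 hs.le
      have h8 := mul_le_mul_of_nonneg_right h6 (Nat.cast_nonneg (degHG G x) : (0 : ℝ) ≤ _)
      linarith
    have h5 : s * n ≤ δ / 16 * n := by gcongr
    have h6 : δ / 2 * n ≤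
        ((nbrs (meetGraph G) e).filter fun g => g ≠ f ∧ ¬(meetGraph G).Adj f g).card := by
      linarith
    convert h6
  · rw [Fintype.card_coe]
    refine (card_le_sq_of_two_le hG fun f hf => ?_).trans (pow_le_pow_right₀ hn1 (by norm_num))
    have : (2 : ℝ) ≤ r := by linarith
    have : 2 ≤ r := by exact_mod_cast this
    exact this.trans (hr f (hGW hf))

theorem IsProperEC.ite {n : ℕ} {H : Finset (Finset (Fin n))} {p : Finset (Fin n) → Prop}
    [DecidablePred p]
    {φ ψ : Finset (Fin n) → ℕ} (hφ : IsProperEC (H.filter p) φ)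
    (hψ : IsProperEC (H.filter fun e => ¬p e) ψ)
    (h : ∀ e ∈ H, p e → ∀ f ∈ H, ¬p f → Meets e f → φ e ≠ ψ f) :
    IsProperEC H fun e => if p e then φ e else ψ e := by
  intro e he f hf hef hm
  simp only
  split_ifs with hpe hpf hpf
  · exact hφ e (mem_filter.2 ⟨he, hpe⟩) f (mem_filter.2 ⟨hf, hpf⟩) hef hm
  · exact h e he hpe f hf hpf hm
  · exact (h f hf hpf e he hpe (Meets.symm _ _ hm)).symm
  · exact hψ e (mem_filter.2 ⟨he, hpe⟩) f (mem_filter.2 ⟨hf, hpf⟩) hef hm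

theorem IsProperEC.chromIndexLE_of_partition {n K M N : ℕ} {H : Finset (Finset (Fin n))}
    {p q : Finset (Fin n) → Prop} [DecidablePred p] [DecidablePred q]
    {ψ χ ω : Finset (Fin n) → ℕ}
    (hψ : IsProperEC (H.filter p) ψ)
    (hχ : IsProperEC ((H.filter fun e => ¬p e).filter q) χ)
    (hω : IsProperEC ((H.filter fun e => ¬p e).filter fun e => ¬q e) ω)
    (hψlt : ∀ e ∈ H.filter p, ψ e < K)
    (hχlt : ∀ e ∈ (H.filter fun e => ¬p e).filter q, χ e < K + M)
    (hωlt : ∀ e ∈ (H.filter fun e => ¬p e).filter fun e => ¬q e, ω e < N)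
    (hψχ : ∀ e ∈ H.filter p, ∀ f ∈ (H.filter fun e => ¬p e).filter q, Meets e f → ψ e ≠ χ f) :
    ChromIndexLE H (K + M + N) := by
  refine ⟨fun e => if p e then ψ e else if q e then χ e else K + M + ω e, fun e he => ?_,
    hψ.ite (hχ.ite (fun e he f hf hef hm h => hω e he f hf hef hm (by omega)) ?_) ?_⟩
  · simp only
    split_ifs with h1 h2
    · have := hψlt e (mem_filter.2 ⟨he, h1⟩)
      omega
    · have := hχlt e (mem_filter.2 ⟨mem_filter.2 ⟨he, h1⟩, h2⟩)
      omega
    · have := hωlt e (mem_filter.2 ⟨mem_filter.2 ⟨he, h1⟩, h2⟩)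
      omega
  · intro e he h1 f hf h2 _
    have := hχlt e (mem_filter.2 ⟨he, h1⟩)
    omega
  · intro e he h1 f hf h2 hm
    split_ifs with h3
    · exact hψχ e (mem_filter.2 ⟨he, h1⟩) f (mem_filter.2 ⟨mem_filter.2 ⟨hf, h2⟩, h3⟩) hm
    · have := hψlt e (mem_filter.2 ⟨he, h1⟩)
      omega

theorem mul_degHG_le {n r : ℕ} {H : Finset (Finset (Fin n))} (hH : LinearHG H)
    (hr : ∀ f ∈ H, r + 1 ≤ f.card) (v : Fin n) : (r : ℝ) * degHG H v ≤ n := by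
  have := degDefect_nonneg hH hr v
  rw [degDefect] at this
  push_cast at this
  linarith

theorem lt_of_mem_or_le {C m x : ℕ} {L : Finset ℕ} {y : ℝ} (hL : L ⊆ range m) (hm : m ≤ C)
    (h : x ∈ L ∨ (m ≤ x ∧ (x : ℝ) ≤ m + y)) : x < C + ⌊y⌋₊ + 1 := by
  rcases h with h | ⟨-, h⟩
  · have := mem_range.1 (hL h)
    omega
  · have h1 := Nat.lt_floor_add_one y
    have h2 : (x : ℝ) < (m + ⌊y⌋₊ + 1 : ℕ) := by
      push_cast
      linarith
    have : x < m + ⌊y⌋₊ + 1 := by exact_mod_cast h2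
    omega

set_option maxHeartbeats 1000000 in
theorem eventually_chromIndexLE (δ : ℝ) (hδ : 0 < δ) (hδ1 : δ ≤ 1 / 3) :
    ∃ σ > (0 : ℝ), ∀ᶠ n : ℕ in Filter.atTop, ∀ H : Finset (Finset (Fin n)),
      (∀ e ∈ H, e.Nonempty) → LinearHG H → (∀ v, (degHG H v : ℝ) ≤ (1 - δ) * n) →
      (((H.filter fun e => (1 - δ) * Real.sqrt n ≤ (e.card : ℝ) ∧
        (e.card : ℝ) ≤ (1 + δ) * Real.sqrt n).card : ℝ) ≤ (1 - 3 * δ) * n) →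
      ∃ k : ℕ, (k : ℝ) ≤ (1 - σ) * n ∧ ChromIndexLE H k := by
  obtain ⟨τ₀, hτ₀, r₀, hlarge⟩ := eventually_exists_coloring_of_large δ hδ hδ1
  obtain ⟨τ, hτ, hττ₀, hτδ⟩ : ∃ τ : ℝ, 0 < τ ∧ τ ≤ τ₀ ∧ τ ≤ δ / 4 :=
    ⟨min τ₀ (δ / 4), by positivity, min_le_left _ _, min_le_right _ _⟩
  obtain ⟨r₁, hr₁⟩ := exists_nat_ge (8 / τ)
  obtain ⟨r₂, hr₂⟩ := exists_nat_ge (r₁ / τ)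
  obtain ⟨N, hN⟩ := exists_nat_ge (32 / τ)
  rw [div_le_iff₀ hτ] at hr₁ hr₂ hN
  refine ⟨τ / 2, by positivity, ?_⟩
  filter_upwards [hlarge, eventually_exists_list_coloring r₁ (1 / 2) (τ / 8) (by norm_num)
    (by positivity), eventually_exists_list_coloring (max r₀ (r₂ + 1)) (τ / 8) (τ / 8)
    (by positivity) (by positivity), Filter.eventually_ge_atTop N] with n hL hS hM hn
  intro H hne hH hdeg hwin
  have hnτ : 32 ≤ n * τ := hN.trans (by gcongr)
  have hn0 : (0 : ℝ) ≤ n := Nat.cast_nonneg n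
  obtain ⟨C, hC⟩ : ∃ C, C = ⌈(1 - τ) * (n : ℝ)⌉₊ := ⟨_, rfl⟩
  have hCge : (1 - τ) * n ≤ C := hC ▸ Nat.le_ceil _
  have hClt : (C : ℝ) < (1 - τ) * n + 1 :=
    hC ▸ Nat.ceil_lt_add_one (mul_nonneg (by linarith) hn0)
  have hCn : C ≤ n := by
    rw [hC, Nat.ceil_le]
    nlinarith
  obtain ⟨D, hD⟩ : ∃ D, D = ⌊(1 - δ) * (n : ℝ)⌋₊ := ⟨_, rfl⟩
  have hDle : (D : ℝ) ≤ (1 - δ) * n := hD ▸ Nat.floor_le (mul_nonneg (by linarith) hn0)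
  have hDlt : (1 - δ) * n < D + 1 := hD ▸ Nat.lt_floor_add_one _
  obtain ⟨D', hD'⟩ : ∃ D, D = ⌈τ / 8 * (n : ℝ)⌉₊ := ⟨_, rfl⟩
  have hD'ge : τ / 8 * n ≤ D' := hD' ▸ Nat.le_ceil _
  have hD'lt : (D' : ℝ) < τ / 8 * n + 1 := hD' ▸ Nat.ceil_lt_add_one (by positivity)
  obtain ⟨a, ha⟩ : ∃ a, a = ⌊τ / 8 * (n : ℝ)⌋₊ := ⟨_, rfl⟩
  have hale : (a : ℝ) ≤ τ / 8 * n := ha ▸ Nat.floor_le (by positivity)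
  have hδn : 32 ≤ δ / 4 * n := by nlinarith
  obtain ⟨ψ, hψ⟩ := hL (H.filter fun e => max r₀ (r₂ + 1) ≤ e.card) C (hH.mono (filter_subset _ _))
    (fun e he => (le_max_left _ _).trans (mem_filter.1 he).2)
    ((Nat.cast_le.2 (card_le_card (filter_subset_filter _ (filter_subset _ _)))).trans hwin)
    (le_trans (by gcongr) hCge) hCn
  have hψ' : IsProperEC (H.filter fun e => max r₀ (r₂ + 1) ≤ e.card) ψ := hψ.2
  obtain ⟨χ, hχ, hχL⟩ := hS ((H.filter fun e => ¬max r₀ (r₂ + 1) ≤ e.card).filter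
      fun e => e.card ≤ r₁)
    (fun e => range C \ ((H.filter fun e => max r₀ (r₂ + 1) ≤ e.card).filter
      fun f => Meets e f).image ψ) D C
    (hH.mono ((filter_subset _ _).trans (filter_subset _ _)))
    (fun e he => hne e ((filter_subset _ _).trans (filter_subset _ _) he))
    (fun e he => (mem_filter.1 he).2) (by nlinarith)
    (fun v => by
      rw [hD]
      exact Nat.le_floor ((Nat.cast_le.2 (degHG_mono
        ((filter_subset _ _).trans (filter_subset _ _)) v)).trans (hdeg v)))
    (by exact_mod_cast (show (D : ℝ) ≤ n by nlinarith)) hCn (fun e _ => sdiff_subset)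
    (fun e he => by
      have h1 := le_card_sdiff (((H.filter fun e => max r₀ (r₂ + 1) ≤ e.card).filter
        fun f => Meets e f).image ψ) (range C)
      have h2 := card_image_le (s := (H.filter fun e => max r₀ (r₂ + 1) ≤ e.card).filter
        fun f => Meets e f) (f := ψ)
      rw [card_range] at h1
      have h3 : (((H.filter fun e => max r₀ (r₂ + 1) ≤ e.card).filter
          fun f => Meets e f).card : ℝ) ≤ τ * n := by
        have h4 := card_filter_meets_le_sum (H.filter fun e => max r₀ (r₂ + 1) ≤ e.card) e
        have h5 : (r₂ : ℝ) * ∑ v ∈ e,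
            (degHG (H.filter fun e => max r₀ (r₂ + 1) ≤ e.card) v : ℝ) ≤ e.card * n := by
          rw [mul_sum, ← nsmul_eq_mul]
          exact sum_le_card_nsmul _ _ _ fun v _ => mul_degHG_le (hH.mono (filter_subset _ _))
            (fun f hf => (le_max_right _ _).trans (mem_filter.1 hf).2) v
        have h6 : (e.card : ℝ) ≤ r₁ := Nat.cast_le.2 (mem_filter.1 he).2
        have h7 : 0 < (r₂ : ℝ) := by
          by_contra! h
          nlinarith
        refine le_of_mul_le_mul_left ?_ h7
        nlinarith [mul_le_mul_of_nonneg_left h4 h7.le, mul_le_mul_of_nonneg_right h6 hn0,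
          mul_le_mul_of_nonneg_right hr₂ hn0]
      have h8 : (D : ℝ) + ((H.filter fun e => max r₀ (r₂ + 1) ≤ e.card).filter
          fun f => Meets e f).card ≤ C := by nlinarith
      have h9 : D + ((H.filter fun e => max r₀ (r₂ + 1) ≤ e.card).filter
          fun f => Meets e f).card ≤ C := by exact_mod_cast h8
      omega)
  obtain ⟨ω, hω, hωL⟩ := hM ((H.filter fun e => ¬max r₀ (r₂ + 1) ≤ e.card).filter
      fun e => ¬e.card ≤ r₁) (fun _ => range D') D' D'
    (hH.mono ((filter_subset _ _).trans (filter_subset _ _)))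
    (fun e he => hne e ((filter_subset _ _).trans (filter_subset _ _) he))
    (fun e he => (not_le.1 (mem_filter.1 (mem_filter.1 he).1).2).le) hD'ge
    (fun v => by
      have h1 := mul_degHG_le (r := r₁)
        (hH.mono ((filter_subset (fun e => ¬e.card ≤ r₁) _).trans
          (filter_subset (fun e => ¬max r₀ (r₂ + 1) ≤ e.card) H)))
        (fun f hf => not_le.1 (mem_filter.1 hf).2) v
      have h2 : (degHG ((H.filter fun e => ¬max r₀ (r₂ + 1) ≤ e.card).filter
          fun e => ¬e.card ≤ r₁) v : ℝ) ≤ D' := by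
        refine le_trans ?_ hD'ge
        have h3 := mul_le_mul_of_nonneg_right hr₁ (Nat.cast_nonneg
          (degHG ((H.filter fun e => ¬max r₀ (r₂ + 1) ≤ e.card).filter
            fun e => ¬e.card ≤ r₁) v) : (0 : ℝ) ≤ _)
        have h4 := mul_le_mul_of_nonneg_left h1 hτ.le
        linarith
      exact_mod_cast h2)
    (by exact_mod_cast (show (D' : ℝ) ≤ n by nlinarith))
    (by exact_mod_cast (show (D' : ℝ) ≤ n by nlinarith)) (fun e _ => Subset.rfl)
    (fun e _ => by rw [card_range])
  have hχlt : ∀ e ∈ (H.filter fun e => ¬max r₀ (r₂ + 1) ≤ e.card).filter fun e => e.card ≤ r₁,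
      χ e < C + a + 1 := fun e he =>
    ha ▸ lt_of_mem_or_le sdiff_subset le_rfl (hχL e he)
  have hωlt : ∀ e ∈ (H.filter fun e => ¬max r₀ (r₂ + 1) ≤ e.card).filter fun e => ¬e.card ≤ r₁,
      ω e < D' + a + 1 := fun e he =>
    ha ▸ lt_of_mem_or_le Subset.rfl le_rfl (hωL e he)
  have hψlt : ∀ e ∈ H, max r₀ (r₂ + 1) ≤ e.card → ψ e < C := fun e he h =>
    mem_range.1 (hψ.1 e (mem_filter.2 ⟨he, h⟩))
  refine ⟨C + (a + 1) + (D' + a + 1), ?_, hψ'.chromIndexLE_of_partition hχ hω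
    (fun e he => hψlt e (mem_filter.1 he).1 (mem_filter.1 he).2) hχlt hωlt
    fun e he f hf hm h => ?_⟩
  · push_cast
    nlinarith
  · rcases hχL f hf with h1 | h1
    · exact (mem_sdiff.1 h1).2 (mem_image.2
        ⟨e, mem_filter.2 ⟨he, Meets.symm _ _ hm⟩, h⟩)
    · have := hψlt e (mem_filter.1 he).1 (mem_filter.1 he).2
      omega

/-- Linear stability: for every `δ > 0` there exist `n0` and `σ > 0` such that every `n`-vertex
linear hypergraph (`n ≥ n0`) of maximum degree at most `(1-δ)n` with at most `(1-3δ)n` edges of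
size `(1±δ)√n` has chromatic index at most `(1-σ)n`. -/
theorem linear_stability :
    ∀ δ : ℝ, 0 < δ →
      ∃ (n0 : ℕ) (σ : ℝ), 0 < σ ∧
        ∀ n : ℕ, n0 ≤ n → ∀ H : Finset (Finset (Fin n)),
          (∀ e ∈ H, e.Nonempty) → LinearHG H →
          (∀ v : Fin n, (degHG H v : ℝ) ≤ (1 - δ) * n) →
          (((H.filter fun e =>
                (1 - δ) * Real.sqrt n ≤ (e.card : ℝ) ∧
                  (e.card : ℝ) ≤ (1 + δ) * Real.sqrt n).card : ℝ) ≤ (1 - 3 * δ) * n) →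
          ∃ k : ℕ, (k : ℝ) ≤ (1 - σ) * n ∧ ChromIndexLE H k := by
  intro δ hδ
  rcases le_or_gt δ (1 / 3) with hδ1 | hδ1
  · obtain ⟨σ, hσ, h⟩ := eventually_chromIndexLE δ hδ hδ1
    obtain ⟨n0, hn0⟩ := Filter.eventually_atTop.1 h
    exact ⟨n0, σ, hσ, hn0⟩
  · refine ⟨1, 1, one_pos, fun n hn H _ _ _ hwin => ?_⟩
    have hn' : (1 : ℝ) ≤ n := by exact_mod_cast hn
    have := (Nat.cast_nonneg _).trans hwin
    nlinarith
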